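/- For every ε > 0 and every δ ∈ (0,1) there exists N₀ ∈ ℕ such that for all integers N ≥ N₀ the set A_N := { a ∈ ℕ : 1 ≤ a ≤ N and r_{4,4}(n) = 0 for all integers n with a − a^{4059/16384 + ε} < n ≤ a } has cardinality at most δ·N. In other words, for almost every a ∈ ℕ the interval (a − a^{4059/16384+ε}, a] contains a sum of four nonnegative fourth powers. -/

import Mathlib

/-- `r44 n` is the number of quadruples `(n₁,n₂,n₃,n₄) ∈ ℕ⁴` with
`n₁⁴+n₂⁴+n₃⁴+n₄⁴ = n`. -/
noncomputable def r44 (n : ℕ) : ℕ :=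
  Nat.card {v : Fin 4 → ℕ // ∑ i, (v i) ^ 4 = n}

open Finset

/-- The additive character `x ↦ exp (2πix)`. -/
noncomputable def ee (x : ℝ) : ℂ := Complex.exp (2 * Real.pi * x * Complex.I)

lemma ee_zero : ee 0 = 1 := by simp [ee]

lemma ee_add (x y : ℝ) : ee (x + y) = ee x * ee y := by
  unfold ee
  rw [← Complex.exp_add]
  congr 1
  push_cast
  ring

lemma norm_ee (x : ℝ) : ‖ee x‖ = 1 := by
  have : (2 * Real.pi * x * Complex.I : ℂ) = ((2 * Real.pi * x : ℝ) : ℂ) * Complex.I := by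
    push_cast; ring
  rw [ee, this, Complex.norm_exp_ofReal_mul_I]

lemma conj_ee (x : ℝ) : (starRingEnd ℂ) (ee x) = ee (-x) := by
  unfold ee
  rw [← Complex.exp_conj]
  congr 1
  simp only [map_mul, Complex.conj_ofReal, Complex.conj_I, map_ofNat]
  push_cast
  ring

lemma ee_eq_one_iff (x : ℝ) : ee x = 1 ↔ ∃ n : ℤ, x = n := by
  unfold ee
  rw [Complex.exp_eq_one_iff]
  have h : (2 * Real.pi * Complex.I : ℂ) ≠ 0 := by simp [Real.pi_ne_zero]
  constructor
  · rintro ⟨n, hn⟩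
    refine ⟨n, ?_⟩
    have h1 : (x : ℂ) * (2 * Real.pi * Complex.I) = n * (2 * Real.pi * Complex.I) := by
      rw [← hn]; ring
    have h2 := mul_right_cancel₀ h h1
    exact_mod_cast h2
  · rintro ⟨n, rfl⟩
    exact ⟨n, by push_cast; ring⟩

lemma ee_int (n : ℤ) : ee n = 1 := (ee_eq_one_iff _).2 ⟨n, rfl⟩

lemma ee_sum {κ : Type*} (s : Finset κ) (f : κ → ℝ) : ee (∑ i ∈ s, f i) = ∏ i ∈ s, ee (f i) := by
  classical
  induction s using Finset.induction_on with
  | empty => simp [ee_zero]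
  | insert a s ha ih => rw [sum_insert ha, prod_insert ha, ee_add, ih]

lemma ee_re (x : ℝ) : (ee x).re = Real.cos (2 * Real.pi * x) := by
  have : (2 * Real.pi * x * Complex.I : ℂ) = ((2 * Real.pi * x : ℝ) : ℂ) * Complex.I := by
    push_cast; ring
  rw [ee, this, Complex.exp_ofReal_mul_I_re]

lemma norm_ee_sub_one (x : ℝ) : ‖ee x - 1‖ = 2 * |Real.sin (Real.pi * x)| := by
  have h : ee x - 1 = ee (x / 2) * (2 * Complex.I * (Real.sin (Real.pi * x) : ℝ)) := by
    have h1 : ee x = ee (x/2) * ee (x/2) := by rw [← ee_add]; congr 1; ring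
    have h2 : (1 : ℂ) = ee (x/2) * ee (-(x/2)) := by rw [← ee_add, add_neg_cancel, ee_zero]
    have h3 : (2 * Complex.I * (Real.sin (Real.pi * x) : ℝ) : ℂ) = ee (x/2) - ee (-(x/2)) := by
      unfold ee
      rw [show (2 * Real.pi * ((x/2 : ℝ) : ℂ) * Complex.I : ℂ) = ((Real.pi * x : ℝ) : ℂ) * Complex.I by
        push_cast; ring,
        show (2 * Real.pi * ((-(x/2) : ℝ) : ℂ) * Complex.I : ℂ)
          = ((-(Real.pi * x) : ℝ) : ℂ) * Complex.I by push_cast; ring]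
      rw [Complex.exp_mul_I, Complex.exp_mul_I]
      push_cast
      rw [Complex.cos_neg, Complex.sin_neg]
      ring
    rw [h3, mul_sub, ← h1, ← h2]
  rw [h, norm_mul, norm_ee, norm_mul, norm_mul, Complex.norm_real, Real.norm_eq_abs]
  simp

lemma norm_ee_sub_one_le (x : ℝ) : ‖ee x - 1‖ ≤ 2 * Real.pi * |x| := by
  rw [norm_ee_sub_one]
  have := Real.abs_sin_le_abs (x := Real.pi * x)
  rw [abs_mul, abs_of_pos Real.pi_pos] at this
  linarith

/-- Distance to the nearest integer bounds the character from below. -/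
lemma four_mul_dist_le_norm_ee_sub_one (x : ℝ) : 4 * |x - round x| ≤ ‖ee x - 1‖ := by
  have h1 : ee x = ee (x - round x) := by
    have : x = (x - round x) + (round x : ℤ) := by ring
    conv_lhs => rw [this, ee_add, ee_int, mul_one]
  rw [h1, norm_ee_sub_one]
  set y := x - round x with hy
  have hy2 : |y| ≤ 1 / 2 := abs_sub_round x
  have h2 : |Real.sin (Real.pi * y)| = Real.sin (Real.pi * |y|) := by
    have hp := Real.pi_pos
    rcases abs_cases y with ⟨h, h0⟩ | ⟨h, h0⟩
    · rw [h, abs_of_nonneg]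
      apply Real.sin_nonneg_of_nonneg_of_le_pi <;> nlinarith
    · rw [h, mul_neg, Real.sin_neg, abs_of_nonpos]
      have : 0 ≤ Real.sin (-(Real.pi * y)) := by
        apply Real.sin_nonneg_of_nonneg_of_le_pi <;> nlinarith
      rw [Real.sin_neg] at this; linarith
  rw [h2]
  have h3 := Real.mul_le_sin (x := Real.pi * |y|) (by positivity)
    (by nlinarith [Real.pi_pos])
  have h4 : 2 / Real.pi * (Real.pi * |y|) = 2 * |y| := by
    field_simp
  linarith

/-- Geometric sums over intervals of integers. -/
lemma norm_sum_ee_linear_le (a b : ℤ) (θ β : ℝ) (X : ℝ) (hX : 0 < X) (hab : (b - a : ℝ) ≤ X) :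
    ‖∑ x ∈ Ico a b, ee (θ * x + β)‖ ≤ 2 * X / (1 + X * |θ - round θ|) := by
  set S := ∑ x ∈ Ico a b, ee (θ * x + β) with hS
  set d := |θ - round θ|
  have hd : 0 ≤ d := abs_nonneg _
  have h1 : ‖S‖ ≤ X := by
    calc ‖S‖ ≤ ∑ x ∈ Ico a b, ‖ee (θ * x + β)‖ := norm_sum_le _ _
      _ = ((b - a).toNat : ℝ) := by simp [norm_ee]
      _ ≤ X := by
        rcases le_total a b with h | h
        · have : (((b - a).toNat : ℤ) : ℝ) = ((b - a : ℤ) : ℝ) := by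
            rw [Int.toNat_of_nonneg (by omega)]
          push_cast at this
          linarith
        · rw [Int.toNat_of_nonpos (by omega)]; simp; linarith
  have h2 : ‖S‖ * (2 * d) ≤ 1 := by
    rcases le_or_gt b a with h | h
    · have : S = 0 := by rw [hS, Ico_eq_empty (by omega)]; simp
      rw [this]; simp
    have h3 : S * (ee θ - 1) = ee (θ * b + β) - ee (θ * a + β) := by
      have key : ∀ n : ℕ, (∑ x ∈ Ico a (a + n), ee (θ * x + β)) * (ee θ - 1)
          = ee (θ * ((a + n : ℤ) : ℝ) + β) - ee (θ * a + β) := by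
        intro n
        induction n with
        | zero => simp
        | succ n ih =>
          have : Ico a (a + ((n + 1 : ℕ) : ℤ)) = insert (a + (n : ℤ)) (Ico a (a + n)) := by
            ext y; simp; omega
          rw [this, sum_insert (by simp), add_mul, ih]
          have h5 : ee (θ * ((a + ((n + 1 : ℕ) : ℤ) : ℤ) : ℝ) + β)
              = ee (θ * ((a + n : ℤ) : ℝ) + β) * ee θ := by
            rw [← ee_add]; congr 1; push_cast; ring
          rw [h5]; ring
      have := key (b - a).toNat
      rw [Int.toNat_of_nonneg (by omega), add_sub_cancel] at this
      exact this
    have h4 : ‖S‖ * ‖ee θ - 1‖ ≤ 2 := by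
      rw [← norm_mul, h3]
      refine (norm_sub_le _ _).trans ?_
      rw [norm_ee, norm_ee]; norm_num
    have h5 := four_mul_dist_le_norm_ee_sub_one θ
    nlinarith [norm_nonneg S, mul_le_mul_of_nonneg_left h5 (norm_nonneg S)]
  rw [le_div_iff₀ (by positivity)]
  nlinarith

/-- The Dirichlet kernel is large near the origin. -/
lemma half_le_norm_sum_ee (J : ℕ) (θ : ℝ) (h : 8 * (J * |θ|) ≤ 1) :
    (J : ℝ) / 2 ≤ ‖∑ j ∈ range J, ee (j * θ)‖ := by
  refine le_trans ?_ (Complex.re_le_norm _)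
  rw [Complex.re_sum]
  have : ∀ j ∈ range J, (1 / 2 : ℝ) ≤ (ee (j * θ)).re := by
    intro j hj
    rw [ee_re]
    have hj' : (j : ℝ) ≤ J := by exact_mod_cast (mem_range.1 hj).le
    have h1 : |2 * Real.pi * (j * θ)| ≤ 1 := by
      rw [abs_mul (2 * Real.pi), abs_mul (j : ℝ), abs_of_pos (by positivity : (0:ℝ) < 2 * Real.pi),
        Nat.abs_cast]
      have h2 : (j : ℝ) * |θ| ≤ 1 / 8 := by
        have := mul_le_mul_of_nonneg_right hj' (abs_nonneg θ)
        linarith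
      have := Real.pi_lt_four
      have h0 : 0 ≤ (j : ℝ) * |θ| := by positivity
      nlinarith [Real.pi_pos]
    have h2 := Real.one_sub_sq_div_two_le_cos (x := 2 * Real.pi * (j * θ))
    have h3 : (2 * Real.pi * (j * θ)) ^ 2 ≤ 1 := by
      rw [← sq_abs]; nlinarith [abs_nonneg (2 * Real.pi * (j * θ))]
    linarith
  calc (J : ℝ) / 2 = ∑ j ∈ range J, (1 / 2 : ℝ) := by simp; ring
    _ ≤ _ := sum_le_sum this

/-- Orthogonality of characters modulo `2R`. -/
lemma sum_ee_orthogonality (R : ℕ) (hR : 0 < R) (n : ℤ) (hn : |n| < 2 * R) :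
    ∑ k ∈ Ico (-R : ℤ) R, ee ((k : ℝ) * n / (2 * R)) = if n = 0 then (2 * R : ℂ) else 0 := by
  have hR' : (R : ℝ) ≠ 0 := by positivity
  split_ifs with h0
  · subst h0
    simp [ee_zero]
    have : (((R : ℤ) + R).toNat) = 2 * R := by omega
    rw [this]; push_cast; ring
  set S := ∑ k ∈ Ico (-R : ℤ) R, ee ((k : ℝ) * n / (2 * R)) with hS
  have h1 : S * ee ((n : ℝ) / (2 * R)) = S := by
    have e1 : S * ee ((n : ℝ) / (2 * R)) = ∑ k ∈ Ico (-R + 1 : ℤ) (R + 1), ee ((k : ℝ) * n / (2 * R)) := by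
      rw [hS, sum_mul, ← Finset.map_add_right_Ico, sum_map]
      apply sum_congr rfl
      intro k _
      rw [← ee_add]
      congr 1
      simp
      ring
    have e2 : Ico (-R : ℤ) R = insert (-R : ℤ) (Ico (-R + 1 : ℤ) R) := by ext y; simp; omega
    have e3 : Ico (-R + 1 : ℤ) (R + 1) = insert (R : ℤ) (Ico (-R + 1 : ℤ) R) := by ext y; simp; omega
    rw [e1, e3, sum_insert (by simp), hS, e2, sum_insert (by simp)]
    congr 1
    have : ((R : ℤ) : ℝ) * n / (2 * R) = ((-R : ℤ) : ℝ) * n / (2 * R) + n := by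
      push_cast; field_simp; ring
    rw [this, ee_add, ee_int, mul_one]
  have h2 : ee ((n : ℝ) / (2 * R)) ≠ 1 := by
    intro h
    obtain ⟨m, hm⟩ := (ee_eq_one_iff _).1 h
    have hm2 : (n : ℝ) = m * (2 * R) := by field_simp at hm; linarith
    have hm3 : n = m * (2 * R) := by exact_mod_cast hm2
    rcases eq_or_ne m 0 with h4 | h4
    · subst h4; simp at hm3; exact h0 hm3
    · have : 1 ≤ |m| := Int.one_le_abs h4
      rw [hm3, abs_mul, abs_of_nonneg (by positivity : (0 : ℤ) ≤ 2 * R)] at hn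
      nlinarith
  have h3 : S * (ee ((n : ℝ) / (2 * R)) - 1) = 0 := by rw [mul_sub, h1]; ring
  exact (mul_eq_zero.1 h3).resolve_right (sub_ne_zero.2 h2)

/-- Parseval's identity modulo `2R`. -/
lemma parseval {ι : Type*} (s : Finset ι) (w : ι → ℂ) (v : ι → ℤ) (R : ℕ) (hR : 0 < R)
    (hv : ∀ i ∈ s, v i ∈ Ico (0 : ℤ) (2 * R)) :
    ∑ k ∈ Ico (-R : ℤ) R, ‖∑ i ∈ s, w i * ee ((k : ℝ) * v i / (2 * R))‖ ^ 2
      = 2 * R * ∑ a ∈ Ico (0 : ℤ) (2 * R), ‖∑ i ∈ s with v i = a, w i‖ ^ 2 := by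
  have hsq : ∀ z : ℂ, ((‖z‖ ^ 2 : ℝ) : ℂ) = z * (starRingEnd ℂ) z := by
    intro z; rw [Complex.mul_conj, Complex.normSq_eq_norm_sq]
  apply Complex.ofReal_injective
  rw [Complex.ofReal_mul, Complex.ofReal_sum, Complex.ofReal_sum]
  simp only [hsq, map_sum, map_mul, conj_ee]
  have lhs : ∀ k : ℤ, (∑ i ∈ s, w i * ee ((k : ℝ) * v i / (2 * R))) *
      (∑ j ∈ s, (starRingEnd ℂ) (w j) * ee (-((k : ℝ) * v j / (2 * R))))
      = ∑ i ∈ s, ∑ j ∈ s, w i * (starRingEnd ℂ) (w j) * ee ((k : ℝ) * (v i - v j : ℤ) / (2 * R)) := by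
    intro k
    rw [sum_mul_sum]
    refine sum_congr rfl fun i _ => sum_congr rfl fun j _ => ?_
    have : (k : ℝ) * (v i - v j : ℤ) / (2 * R)
        = (k : ℝ) * v i / (2 * R) + -((k : ℝ) * v j / (2 * R)) := by push_cast; ring
    rw [this, ee_add]; ring
  simp only [lhs]
  have swap : ∀ (A : Finset ℤ) (f : ℤ → ι → ι → ℂ), ∑ a ∈ A, ∑ i ∈ s, ∑ j ∈ s, f a i j
      = ∑ i ∈ s, ∑ j ∈ s, ∑ a ∈ A, f a i j := by
    intro A f
    rw [sum_comm]
    exact sum_congr rfl fun i _ => sum_comm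
  rw [swap]
  simp only [← mul_sum]
  have rhs : ∀ a : ℤ, (∑ i ∈ s with v i = a, w i) * (∑ j ∈ s with v j = a, (starRingEnd ℂ) (w j))
      = ∑ i ∈ s, ∑ j ∈ s, if v i = a ∧ v j = a then w i * (starRingEnd ℂ) (w j) else 0 := by
    intro a
    rw [sum_filter, sum_filter, sum_mul_sum]
    refine sum_congr rfl fun i _ => sum_congr rfl fun j _ => ?_
    split_ifs <;> simp_all
  simp only [rhs]
  rw [swap, mul_sum]
  refine sum_congr rfl fun i hi => ?_
  rw [mul_sum]
  refine sum_congr rfl fun j hj => ?_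
  have hi' := mem_Ico.1 (hv i hi)
  have hj' := mem_Ico.1 (hv j hj)
  rw [sum_ee_orthogonality R hR _ (by rw [abs_lt]; constructor <;> omega)]
  by_cases h : v i = v j
  · rw [if_pos (by omega), sum_eq_single (v i)]
    · rw [if_pos ⟨rfl, h.symm⟩]; push_cast; ring
    · intro b _ hb; rw [if_neg]; intro h2; exact hb h2.1.symm
    · intro h2; exact absurd (hv i hi) h2
  · rw [if_neg (by omega), sum_eq_zero]
    · simp
    · intro b _; rw [if_neg]; intro h2; exact h (h2.1.trans h2.2.symm)

/-- The exponential sum `∑ i ∈ s, e (α f i)`. -/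
noncomputable def expSum {ι : Type*} (s : Finset ι) (f : ι → ℤ) (α : ℝ) : ℂ :=
  ∑ i ∈ s, ee (α * f i)

/-- The number of pairs of indices whose values differ by less than `L`. -/
def pairCount {ι : Type*} (s : Finset ι) (f : ι → ℤ) (L : ℕ) : ℕ :=
  #{p ∈ s ×ˢ s | |f p.1 - f p.2| < L}

lemma norm_expSum_le {ι : Type*} (s : Finset ι) (f : ι → ℤ) (α : ℝ) :
    ‖expSum s f α‖ ≤ #s := by
  refine (norm_sum_le _ _).trans ?_
  simp [norm_ee]

lemma expSum_prod {ι κ : Type*} (s : Finset ι) (t : Finset κ) (f : ι → ℤ) (g : κ → ℤ) (α : ℝ) :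
    expSum (s ×ˢ t) (fun p => f p.1 + g p.2) α = expSum s f α * expSum t g α := by
  unfold expSum
  rw [sum_product, sum_mul_sum]
  refine sum_congr rfl fun i _ => sum_congr rfl fun j _ => ?_
  rw [← ee_add]; congr 1; push_cast; ring

lemma expSum_neg_fun {ι : Type*} (s : Finset ι) (f : ι → ℤ) (α : ℝ) :
    expSum s (fun i => -f i) α = (starRingEnd ℂ) (expSum s f α) := by
  unfold expSum
  rw [map_sum]
  refine sum_congr rfl fun i _ => ?_
  rw [conj_ee]; congr 1; push_cast; ring

lemma norm_expSum_neg {ι : Type*} (s : Finset ι) (f : ι → ℤ) (α : ℝ) :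
    ‖expSum s f (-α)‖ = ‖expSum s f α‖ := by
  have : expSum s f (-α) = (starRingEnd ℂ) (expSum s f α) := by
    rw [← expSum_neg_fun]
    unfold expSum
    refine sum_congr rfl fun i _ => ?_
    congr 1; push_cast; ring
  rw [this, RCLike.norm_conj]

lemma sum_sq_card_fiber {σ : Type*} (S : Finset σ) (v : σ → ℤ) (A : Finset ℤ)
    (hv : ∀ i ∈ S, v i ∈ A) :
    ∑ a ∈ A, #{i ∈ S | v i = a} ^ 2 = #{p ∈ S ×ˢ S | v p.1 = v p.2} := by
  classical
  rw [card_eq_sum_card_fiberwise (f := fun p => v p.1) (t := A)]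
  · refine sum_congr rfl fun a _ => ?_
    rw [sq, ← card_product]
    congr 1
    ext ⟨x, y⟩
    simp only [mem_product, mem_filter]
    constructor
    · rintro ⟨⟨h1, h2⟩, h3, h4⟩; exact ⟨⟨⟨h1, h3⟩, h2.trans h4.symm⟩, h2⟩
    · rintro ⟨⟨⟨h1, h3⟩, h2⟩, h4⟩; exact ⟨⟨h1, h4⟩, h3, h2.symm.trans h4⟩
  · intro p hp
    simp only [coe_filter, mem_product, Set.mem_ofPred_eq] at hp
    exact hv _ hp.1.1

/-- The mean square of an exponential sum near the origin, bounded by the number of close pairs. -/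
lemma sum_norm_sq_expSum_le {ι : Type*} (s : Finset ι) (f : ι → ℤ) (R J : ℕ) (hR : 0 < R)
    (hJ : 0 < J) (hf : ∀ i ∈ s, 0 ≤ f i ∧ f i + J ≤ 2 * R) :
    J * ∑ k ∈ Ico (-R : ℤ) R with 4 * (J : ℤ) * |k| ≤ R, ‖expSum s f ((k : ℝ) / (2 * R))‖ ^ 2
      ≤ 8 * R * pairCount s f J := by
  have hR' : (0 : ℝ) < R := by exact_mod_cast hR
  have hJ' : (0 : ℝ) < J := by exact_mod_cast hJ
  set v : ι × ℕ → ℤ := fun p => f p.1 + p.2 with hv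
  have h1 := parseval (s ×ˢ range J) (fun _ => 1) v R hR (by
    rintro ⟨i, j⟩ hp
    simp only [mem_product, mem_range] at hp
    have := hf i hp.1
    simp only [hv, mem_Ico]
    omega)
  have h2 : ∀ k : ℤ, ∑ p ∈ s ×ˢ range J, (1 : ℂ) * ee ((k : ℝ) * v p / (2 * R))
      = expSum s f ((k : ℝ) / (2 * R)) * ∑ j ∈ range J, ee (j * ((k : ℝ) / (2 * R))) := by
    intro k
    unfold expSum
    rw [sum_product, sum_mul_sum]
    refine sum_congr rfl fun i _ => sum_congr rfl fun j _ => ?_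
    rw [← ee_add, one_mul]; congr 1; simp only [hv]; push_cast; ring
  simp only [h2] at h1
  have h3 : ∑ k ∈ Ico (-R : ℤ) R with 4 * (J : ℤ) * |k| ≤ R,
      ((J : ℝ) ^ 2 / 4) * ‖expSum s f ((k : ℝ) / (2 * R))‖ ^ 2 ≤
      ∑ k ∈ Ico (-R : ℤ) R, ‖expSum s f ((k : ℝ) / (2 * R)) *
        ∑ j ∈ range J, ee (j * ((k : ℝ) / (2 * R)))‖ ^ 2 := by
    refine le_trans (sum_le_sum fun k hk => ?_)
      (sum_le_sum_of_subset_of_nonneg (filter_subset _ _) fun _ _ _ => by positivity)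
    rw [norm_mul, mul_pow, mul_comm]
    refine mul_le_mul_of_nonneg_left ?_ (by positivity)
    have hk' : (4 * J * |(k : ℝ)|) ≤ R := by exact_mod_cast (mem_filter.1 hk).2
    have := half_le_norm_sum_ee J ((k : ℝ) / (2 * R)) (by
      rw [abs_div, abs_of_pos (by positivity : (0:ℝ) < 2 * R), ← mul_div_assoc, ← mul_div_assoc,
        div_le_one (by positivity)]
      linarith)
    calc (J : ℝ) ^ 2 / 4 = (J / 2) ^ 2 := by ring
      _ ≤ _ := by gcongr
  have h4 : ∑ a ∈ Ico (0 : ℤ) (2 * R), ‖∑ i ∈ s ×ˢ range J with v i = a, (1 : ℂ)‖ ^ 2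
      ≤ (J * pairCount s f J : ℝ) := by
    have e1 : ∀ a : ℤ, ‖∑ i ∈ s ×ˢ range J with v i = a, (1 : ℂ)‖ ^ 2
        = ((#{i ∈ s ×ˢ range J | v i = a} ^ 2 : ℕ) : ℝ) := by
      intro a; simp
    simp only [e1]
    rw [← Nat.cast_sum, sum_sq_card_fiber]
    · have : #{p ∈ (s ×ˢ range J) ×ˢ (s ×ˢ range J) | v p.1 = v p.2} ≤
          #((range J) ×ˢ {p ∈ s ×ˢ s | |f p.1 - f p.2| < J}) := by
        apply card_le_card_of_injOn (fun p => (p.1.2, (p.1.1, p.2.1)))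
        · rintro ⟨⟨i, j⟩, ⟨i', j'⟩⟩ hp
          simp only [coe_filter, mem_product, mem_range, Set.mem_ofPred_eq, hv] at hp
          simp only [coe_product, Set.mem_prod, coe_range, Set.mem_Iio, coe_filter,
            Set.mem_ofPred_eq, mem_product]
          refine ⟨hp.1.1.2, ⟨hp.1.1.1, hp.1.2.1⟩, ?_⟩
          rw [abs_lt]; constructor <;> omega
        · rintro ⟨⟨i, j⟩, ⟨i', j'⟩⟩ hp ⟨⟨i1, j1⟩, ⟨i1', j1'⟩⟩ hp1 h
          simp only [coe_filter, mem_product, mem_range, Set.mem_ofPred_eq, hv] at hp hp1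
          simp only [Prod.mk.injEq] at h ⊢
          obtain ⟨rfl, rfl, rfl⟩ := h
          refine ⟨⟨rfl, rfl⟩, rfl, ?_⟩
          omega
      rw [card_product, card_range] at this
      unfold pairCount
      exact_mod_cast this
    · rintro ⟨i, j⟩ hp
      simp only [mem_product, mem_range] at hp
      have := hf i hp.1
      simp only [hv, mem_Ico]
      omega
  rw [← mul_sum, h1] at h3
  have h5 := h3.trans (mul_le_mul_of_nonneg_left h4 (by positivity))
  set U := ∑ k ∈ Ico (-R : ℤ) R with 4 * (J : ℤ) * |k| ≤ R, ‖expSum s f ((k : ℝ) / (2 * R))‖ ^ 2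
  have h6 : (J : ℝ) * (J * U) ≤ J * (8 * R * pairCount s f J) := by nlinarith
  exact le_of_mul_le_mul_left h6 hJ'

/-- A count of small values, bounded by exponential sums over short frequencies. -/
lemma card_small_le_sum_norm_expSum {κ : Type*} (c : Finset κ) (t : κ → ℤ) (R M : ℕ) (hR : 0 < R)
    (hM : 0 < M) :
    (M : ℝ) * #{i ∈ c | 4 * (M : ℤ) * |t i| ≤ R}
      ≤ 4 * ∑ k ∈ Ioo (-M : ℤ) M, ‖expSum c t ((k : ℝ) / (2 * R))‖ := by
  have hR' : (0 : ℝ) < R := by exact_mod_cast hR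
  have hM' : (0 : ℝ) < M := by exact_mod_cast hM
  set F : ℤ → ℝ := fun k => ‖expSum c t ((k : ℝ) / (2 * R))‖ with hF
  have h1 : ((M : ℝ) ^ 2 / 4) * #{i ∈ c | 4 * (M : ℤ) * |t i| ≤ R}
      ≤ ∑ i ∈ c, ‖∑ m ∈ range M, ee (m * ((t i : ℝ) / (2 * R)))‖ ^ 2 := by
    rw [mul_comm, ← nsmul_eq_mul, ← sum_const]
    refine le_trans (sum_le_sum fun i hi => ?_)
      (sum_le_sum_of_subset_of_nonneg (filter_subset _ _) fun _ _ _ => by positivity)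
    have hk' : (4 * M * |(t i : ℝ)|) ≤ R := by exact_mod_cast (mem_filter.1 hi).2
    have := half_le_norm_sum_ee M ((t i : ℝ) / (2 * R)) (by
      rw [abs_div, abs_of_pos (by positivity : (0:ℝ) < 2 * R), ← mul_div_assoc, ← mul_div_assoc,
        div_le_one (by positivity)]
      linarith)
    calc (M : ℝ) ^ 2 / 4 = (M / 2) ^ 2 := by ring
      _ ≤ _ := by gcongr
  have h2 : ∑ i ∈ c, ‖∑ m ∈ range M, ee (m * ((t i : ℝ) / (2 * R)))‖ ^ 2
      ≤ ∑ m ∈ range M, ∑ m' ∈ range M, F ((m : ℤ) - m') := by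
    have hsq : ∀ z : ℂ, ((‖z‖ ^ 2 : ℝ) : ℂ) = z * (starRingEnd ℂ) z := by
      intro z; rw [Complex.mul_conj, Complex.normSq_eq_norm_sq]
    have e : ((∑ i ∈ c, ‖∑ m ∈ range M, ee (m * ((t i : ℝ) / (2 * R)))‖ ^ 2 : ℝ) : ℂ)
        = ∑ m ∈ range M, ∑ m' ∈ range M, expSum c t ((((m : ℤ) - m' : ℤ) : ℝ) / (2 * R)) := by
      unfold expSum
      rw [Complex.ofReal_sum]
      simp only [hsq, map_sum, conj_ee, sum_mul_sum]
      rw [sum_comm]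
      refine sum_congr rfl fun m _ => ?_
      rw [sum_comm]
      refine sum_congr rfl fun m' _ => sum_congr rfl fun i _ => ?_
      rw [← ee_add]; congr 1; push_cast; ring
    have h0 : 0 ≤ ∑ i ∈ c, ‖∑ m ∈ range M, ee (m * ((t i : ℝ) / (2 * R)))‖ ^ 2 := by positivity
    calc ∑ i ∈ c, ‖∑ m ∈ range M, ee (m * ((t i : ℝ) / (2 * R)))‖ ^ 2
        = ‖((∑ i ∈ c, ‖∑ m ∈ range M, ee (m * ((t i : ℝ) / (2 * R)))‖ ^ 2 : ℝ) : ℂ)‖ := by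
          rw [Complex.norm_real, Real.norm_of_nonneg h0]
      _ ≤ _ := by
          rw [e]
          refine (norm_sum_le _ _).trans (sum_le_sum fun m _ => norm_sum_le _ _)
  have h3 : ∑ m ∈ range M, ∑ m' ∈ range M, F ((m : ℤ) - m') ≤ M * ∑ k ∈ Ioo (-M : ℤ) M, F k := by
    calc _ ≤ ∑ m ∈ range M, ∑ k ∈ Ioo (-M : ℤ) M, F k := by
          refine sum_le_sum fun m hm => ?_
          have hm := mem_range.1 hm
          have inj : Set.InjOn (fun m' : ℕ => (m : ℤ) - m') (range M) := by
            intro a _ b _ hab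
            simp only at hab; omega
          rw [← sum_image (f := F) inj]
          apply sum_le_sum_of_subset_of_nonneg
          · intro k hk
            obtain ⟨m', hm', rfl⟩ := mem_image.1 hk
            have := mem_range.1 hm'
            rw [mem_Ioo]; omega
          · intro _ _ _; exact norm_nonneg _
      _ = _ := by simp
  have h4 := (h1.trans h2).trans h3
  have h5 : (M : ℝ) * (M * #{i ∈ c | 4 * (M : ℤ) * |t i| ≤ R}) ≤ M * (4 * ∑ k ∈ Ioo (-M : ℤ) M, F k) := by
    nlinarith
  exact le_of_mul_le_mul_left h5 hM'

/-- The divisor bound: `d(n) ^ k = O_k(n)`. -/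
lemma exists_card_divisors_pow_le (k : ℕ) :
    ∃ C : ℕ, 0 < C ∧ ∀ n : ℕ, n ≠ 0 → (n.divisors.card) ^ k ≤ C * n := by
  obtain ⟨A, hA⟩ : ∃ A : ℕ, ∀ v : ℕ, (v + 1) ^ k ≤ A * 2 ^ v := by
    have h : Filter.Tendsto (fun v : ℕ => ((v : ℝ)) ^ k / 2 ^ v) Filter.atTop (nhds 0) :=
      tendsto_pow_const_div_const_pow_of_one_lt k (by norm_num)
    obtain ⟨B, hB⟩ := h.bddAbove_range
    obtain ⟨A, hA⟩ := exists_nat_ge (2 * B)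
    refine ⟨A, fun v => ?_⟩
    have h1 : ((v + 1 : ℕ) : ℝ) ^ k / 2 ^ (v + 1) ≤ B := hB ⟨v + 1, rfl⟩
    rw [div_le_iff₀ (by positivity)] at h1
    have h2 : (((v + 1) ^ k : ℕ) : ℝ) ≤ ((A * 2 ^ v : ℕ) : ℝ) := by
      push_cast at h1 ⊢
      calc ((v : ℝ) + 1) ^ k ≤ B * 2 ^ (v + 1) := h1
        _ = (2 * B) * 2 ^ v := by ring
        _ ≤ A * 2 ^ v := by gcongr
    exact_mod_cast h2
  have hA1 : 1 ≤ A := by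
    have := hA 0
    simpa using this
  refine ⟨A ^ (2 ^ k), by positivity, fun n hn => ?_⟩
  rw [Nat.card_divisors hn, ← prod_pow]
  have h1 : ∀ p ∈ n.primeFactors, (n.factorization p + 1) ^ k
      ≤ (if p < 2 ^ k then A else 1) * p ^ n.factorization p := by
    intro p hp
    have hp2 : 2 ≤ p := (Nat.prime_of_mem_primeFactors hp).two_le
    set v := n.factorization p
    split_ifs with h
    · exact (hA v).trans (Nat.mul_le_mul_left _ (Nat.pow_le_pow_left hp2 _))
    · push Not at h
      calc (v + 1) ^ k ≤ (2 ^ v) ^ k := Nat.pow_le_pow_left Nat.lt_two_pow_self _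
        _ = (2 ^ k) ^ v := by rw [← pow_mul, ← pow_mul, mul_comm]
        _ ≤ p ^ v := Nat.pow_le_pow_left h _
        _ = 1 * p ^ v := (one_mul _).symm
  refine (prod_le_prod' h1).trans ?_
  rw [prod_mul_distrib]
  have h2 : ∏ p ∈ n.primeFactors, p ^ n.factorization p = n :=
    Nat.prod_factorization_pow_eq_self hn
  rw [h2, ← prod_filter, prod_const]
  gcongr
  calc #{p ∈ n.primeFactors | p < 2 ^ k} ≤ #(range (2 ^ k)) := by
        apply card_le_card
        intro p hp
        exact mem_range.2 (mem_filter.1 hp).2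
    _ = 2 ^ k := card_range _

lemma sum_fractional_le (X N : ℕ) (hX : 0 < X) (β Hm : ℝ) (hβ : 0 < β)
    (hH : ∑ j ∈ Icc 1 N, (1 / (j : ℝ)) ≤ Hm) :
    ∑ m ∈ Icc 1 N, 2 * X / (1 + X * |(m : ℝ) * β - round ((m : ℝ) * β)|)
      ≤ 4 * (β * N + 2) * (X + 2 / β * Hm) := by
  have hX' : (0 : ℝ) < X := by exact_mod_cast hX
  set ρ : ℕ → ℤ := fun m => round ((m : ℝ) * β) with hρ
  have hmaps : ∀ m ∈ Icc 1 N, ρ m ∈ Icc 0 (round ((N : ℝ) * β)) := by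
    intro m hm
    have hm' : (m : ℝ) ≤ N := by exact_mod_cast (mem_Icc.1 hm).2
    rw [mem_Icc]
    simp only [hρ, round_eq]
    constructor
    · apply Int.floor_nonneg.2; positivity
    · apply Int.floor_mono; gcongr
  rw [← sum_fiberwise_of_maps_to hmaps]
  set F : ℕ → ℝ := fun j => if j = 0 then (X : ℝ) else 2 / β * (1 / j) with hF
  have hF0 : ∀ j, 0 ≤ F j := by
    intro j; simp only [hF]; split_ifs <;> positivity
  have hFsum : ∑ j ∈ range (N + 1), F j ≤ X + 2 / β * Hm := by
    have : range (N + 1) = insert 0 (Icc 1 N) := by ext y; simp; omega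
    rw [this, sum_insert (by simp)]
    refine add_le_add (by simp [hF]) ?_
    refine le_trans (le_of_eq ?_) (mul_le_mul_of_nonneg_left hH (by positivity))
    rw [mul_sum]
    refine sum_congr rfl fun j hj => ?_
    simp only [hF]; rw [if_neg]
    have := (mem_Icc.1 hj).1; omega
  have fib : ∀ n : ℤ, ∑ m ∈ Icc 1 N with ρ m = n, 2 * X / (1 + X * |(m : ℝ) * β - ρ m|)
      ≤ 4 * (X + 2 / β * Hm) := by
    intro n
    set A := {m ∈ Icc 1 N | ρ m = n} with hA
    rcases A.eq_empty_or_nonempty with h | h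
    · rw [h, sum_empty]
      have : 0 ≤ ∑ j ∈ range (N + 1), F j := sum_nonneg fun _ _ => hF0 _
      linarith
    obtain ⟨m0, hm0, hmin⟩ := exists_min_image A (fun m => |(m : ℝ) * β - n|) h
    have hAN : ∀ m ∈ A, 1 ≤ m ∧ m ≤ N := fun m hm => mem_Icc.1 (mem_filter.1 hm).1
    have key : ∀ m ∈ A, ∀ j : ℕ, (j : ℝ) ≤ |(m : ℝ) - m0| →
        2 * X / (1 + X * |(m : ℝ) * β - ρ m|) ≤ 2 * F j := by
      intro m hm j hj
      rw [(mem_filter.1 hm).2]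
      have h1 : β * j ≤ 2 * |(m : ℝ) * β - n| := by
        have e1 : β * |(m : ℝ) - m0| ≤ |(m : ℝ) * β - n| + |(m0 : ℝ) * β - n| := by
          calc β * |(m : ℝ) - m0| = |((m : ℝ) * β - n) - ((m0 : ℝ) * β - n)| := by
                rw [← abs_of_pos hβ, ← abs_mul, abs_of_pos hβ]; congr 1; ring
            _ ≤ _ := abs_sub _ _
        have e2 := hmin m hm
        nlinarith
      simp only [hF]
      split_ifs with h0
      · rw [div_le_iff₀ (by positivity)]
        have : 0 ≤ (X : ℝ) * |(m : ℝ) * β - n| := by positivity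
        nlinarith
      · have hj0 : (0 : ℝ) < j := by exact_mod_cast Nat.pos_of_ne_zero h0
        rw [div_le_iff₀ (by positivity)]
        have e3 : 2 * (2 / β * (1 / (j : ℝ))) * (1 + X * |(m : ℝ) * β - n|)
            = 4 * (1 + X * |(m : ℝ) * β - n|) / (β * j) := by field_simp; ring
        rw [e3, le_div_iff₀ (by positivity)]
        nlinarith
    rw [← sum_filter_add_sum_filter_not A (fun m => m0 ≤ m)]
    have p1 : ∑ m ∈ A with m0 ≤ m, 2 * X / (1 + X * |(m : ℝ) * β - ρ m|)
        ≤ 2 * ∑ j ∈ range (N + 1), F j := by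
      calc _ ≤ ∑ m ∈ A with m0 ≤ m, 2 * F (m - m0) := by
            refine sum_le_sum fun m hm => ?_
            have hm := mem_filter.1 hm
            apply key m hm.1
            rw [Nat.cast_sub hm.2]; exact le_abs_self _
        _ = 2 * ∑ j ∈ image (fun m => m - m0) {m ∈ A | m0 ≤ m}, F j := by
            rw [sum_image, mul_sum]
            intro a ha b hb hab
            have ha := (mem_filter.1 ha).2
            have hb := (mem_filter.1 hb).2
            simp only at hab; omega
        _ ≤ _ := by
            refine mul_le_mul_of_nonneg_left ?_ zero_le_two
            apply sum_le_sum_of_subset_of_nonneg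
            · intro j hj
              obtain ⟨m, hm, rfl⟩ := mem_image.1 hj
              have := hAN m (mem_filter.1 hm).1
              rw [mem_range]; omega
            · intro j _ _; exact hF0 j
    have p2 : ∑ m ∈ A with ¬ m0 ≤ m, 2 * X / (1 + X * |(m : ℝ) * β - ρ m|)
        ≤ 2 * ∑ j ∈ range (N + 1), F j := by
      calc _ ≤ ∑ m ∈ A with ¬ m0 ≤ m, 2 * F (m0 - m) := by
            refine sum_le_sum fun m hm => ?_
            have hm := mem_filter.1 hm
            apply key m hm.1
            rw [Nat.cast_sub (by omega), abs_sub_comm]; exact le_abs_self _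
        _ = 2 * ∑ j ∈ image (fun m => m0 - m) {m ∈ A | ¬ m0 ≤ m}, F j := by
            rw [sum_image, mul_sum]
            intro a ha b hb hab
            have ha := (mem_filter.1 ha).2
            have hb := (mem_filter.1 hb).2
            simp only at hab; omega
        _ ≤ _ := by
            refine mul_le_mul_of_nonneg_left ?_ zero_le_two
            apply sum_le_sum_of_subset_of_nonneg
            · intro j hj
              obtain ⟨m, hm, rfl⟩ := mem_image.1 hj
              have := hAN m0 hm0
              rw [mem_range]; omega
            · intro j _ _; exact hF0 j
    linarith
  calc _ ≤ ∑ n ∈ Icc 0 (round ((N : ℝ) * β)), 4 * (X + 2 / β * Hm) := sum_le_sum fun n _ => fib n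
    _ = ((round ((N : ℝ) * β) + 1).toNat : ℝ) * (4 * (X + 2 / β * Hm)) := by simp
    _ ≤ (β * N + 2) * (4 * (X + 2 / β * Hm)) := by
        have hs : 0 ≤ X + 2 / β * Hm := le_trans (sum_nonneg fun _ _ => hF0 _) hFsum
        gcongr
        have h1 : 0 ≤ round ((N : ℝ) * β) := by
          rw [round_eq]; apply Int.floor_nonneg.2; positivity
        have h2 : (((round ((N : ℝ) * β) + 1).toNat : ℤ) : ℝ) = (round ((N : ℝ) * β) + 1 : ℤ) := by
          rw [Int.toNat_of_nonneg (by omega)]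
        have h3 := abs_sub_round ((N : ℝ) * β)
        rw [abs_le] at h3
        rw [Int.cast_natCast] at h2
        rw [h2]; push_cast; linarith
    _ = _ := by ring

/-- Weyl differencing. -/
lemma norm_sq_sum_ee_le (a b : ℤ) (X : ℕ) (hab : b - a ≤ X) (φ : ℤ → ℝ) :
    ‖∑ x ∈ Ico a b, ee (φ x)‖ ^ 2 ≤ ∑ u ∈ Ioo (-X : ℤ) X,
      ‖∑ x ∈ Ico (max a (a - u)) (min b (b - u)), ee (φ (x + u) - φ x)‖ := by
  have e : ((‖∑ x ∈ Ico a b, ee (φ x)‖ ^ 2 : ℝ) : ℂ) = ∑ u ∈ Ioo (-X : ℤ) X,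
      ∑ x ∈ Ico (max a (a - u)) (min b (b - u)), ee (φ (x + u) - φ x) := by
    have h1 : ∀ z : ℂ, ((‖z‖ ^ 2 : ℝ) : ℂ) = (starRingEnd ℂ) z * z := by
      intro z; rw [mul_comm, Complex.mul_conj, Complex.normSq_eq_norm_sq]
    rw [h1, map_sum, sum_mul_sum]
    have h2 : ∀ u : ℤ, Ico (max a (a - u)) (min b (b - u)) = {x ∈ Ico a b | x + u ∈ Ico a b} := by
      intro u; ext x; simp; omega
    simp only [h2, sum_filter]
    rw [sum_comm (s := Ioo (-X : ℤ) X)]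
    refine sum_congr rfl fun x hx => ?_
    rw [← sum_filter]
    refine sum_nbij' (fun y => y - x) (fun u => x + u) ?_ ?_ ?_ ?_ ?_
    · intro y hy
      simp only [mem_Ico, mem_filter, mem_Ioo] at hx hy ⊢
      omega
    · intro u hu
      exact (mem_filter.1 hu).2
    · intro y _; ring
    · intro u _; ring
    · intro y _
      rw [conj_ee, ← ee_add]
      congr 1
      rw [show x + (y - x) = y by ring]; ring
  have h0 : 0 ≤ ‖∑ x ∈ Ico a b, ee (φ x)‖ ^ 2 := by positivity
  calc ‖∑ x ∈ Ico a b, ee (φ x)‖ ^ 2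
      = ‖((‖∑ x ∈ Ico a b, ee (φ x)‖ ^ 2 : ℝ) : ℂ)‖ := by
        rw [Complex.norm_real, Real.norm_of_nonneg h0]
    _ ≤ _ := by
        rw [e]
        exact norm_sum_le _ _

lemma sum_Ioo_natAbs_le (X : ℕ) (F : ℕ → ℝ) (hF : ∀ n, 0 ≤ F n) :
    ∑ u ∈ Ioo (-X : ℤ) X, F u.natAbs ≤ 2 * ∑ u ∈ range X, F u := by
  rw [← sum_filter_add_sum_filter_not (Ioo (-X : ℤ) X) (fun u => 0 ≤ u)]
  have h1 : ∑ u ∈ Ioo (-X : ℤ) X with 0 ≤ u, F u.natAbs ≤ ∑ u ∈ range X, F u := by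
    rw [← sum_image (f := F)]
    · apply sum_le_sum_of_subset_of_nonneg
      · intro j hj
        obtain ⟨m, hm, rfl⟩ := mem_image.1 hj
        simp only [mem_filter, mem_Ioo] at hm
        rw [mem_range]; omega
      · intro j _ _; exact hF j
    · intro x hx y hy hxy
      simp only [coe_filter, mem_Ioo, Set.mem_ofPred_eq] at hx hy
      omega
  have h2 : ∑ u ∈ Ioo (-X : ℤ) X with ¬ 0 ≤ u, F u.natAbs ≤ ∑ u ∈ range X, F u := by
    rw [← sum_image (f := F)]
    · apply sum_le_sum_of_subset_of_nonneg
      · intro j hj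
        obtain ⟨m, hm, rfl⟩ := mem_image.1 hj
        simp only [mem_filter, mem_Ioo] at hm
        rw [mem_range]; omega
      · intro j _ _; exact hF j
    · intro x hx y hy hxy
      simp only [coe_filter, mem_Ioo, Set.mem_ofPred_eq] at hx hy
      omega
  linarith

lemma sum_triple_product_le (D X τ : ℕ) (F : ℕ → ℝ) (hF : ∀ n, 0 ≤ F n)
    (hτ : ∀ n ∈ Icc 1 (D * X ^ 2), (n.divisors.card) ^ 2 ≤ τ) :
    ∑ h ∈ Icc 1 D, ∑ u ∈ Icc 1 X, ∑ v ∈ Icc 1 X, F (h * u * v)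
      ≤ τ * ∑ n ∈ Icc 1 (D * X ^ 2), F n := by
  have e : ∑ h ∈ Icc 1 D, ∑ u ∈ Icc 1 X, ∑ v ∈ Icc 1 X, F (h * u * v)
      = ∑ p ∈ Icc 1 D ×ˢ (Icc 1 X ×ˢ Icc 1 X), F (p.1 * p.2.1 * p.2.2) := by
    rw [sum_product]
    refine sum_congr rfl fun h _ => ?_
    rw [sum_product]
  have hmem : ∀ p ∈ Icc 1 D ×ˢ (Icc 1 X ×ˢ Icc 1 X), p.1 * p.2.1 * p.2.2 ∈ Icc 1 (D * X ^ 2) := by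
    rintro ⟨h, u, v⟩ hp
    simp only [mem_product, mem_Icc] at hp ⊢
    obtain ⟨⟨h1, h2⟩, ⟨h3, h4⟩, h5, h6⟩ := hp
    refine ⟨Nat.succ_le_of_lt (by positivity), ?_⟩
    calc h * u * v ≤ D * X * X := by gcongr
      _ = _ := by ring
  rw [e, ← sum_fiberwise_of_maps_to hmem, mul_sum]
  refine sum_le_sum fun n hn => ?_
  have : ∑ p ∈ Icc 1 D ×ˢ (Icc 1 X ×ˢ Icc 1 X) with p.1 * p.2.1 * p.2.2 = n,
      F (p.1 * p.2.1 * p.2.2)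
      = (#{p ∈ Icc 1 D ×ˢ (Icc 1 X ×ˢ Icc 1 X) | p.1 * p.2.1 * p.2.2 = n} : ℝ) * F n := by
    rw [sum_congr rfl (g := fun _ => F n), sum_const, nsmul_eq_mul]
    intro p hp
    rw [(mem_filter.1 hp).2]
  rw [this]
  refine mul_le_mul_of_nonneg_right ?_ (hF n)
  have hn0 : n ≠ 0 := by have := (mem_Icc.1 hn).1; omega
  have : #{p ∈ Icc 1 D ×ˢ (Icc 1 X ×ˢ Icc 1 X) | p.1 * p.2.1 * p.2.2 = n}
      ≤ #(n.divisors ×ˢ n.divisors) := by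
    apply card_le_card_of_injOn (fun p => (p.1, p.2.1))
    · rintro ⟨h, u, v⟩ hp
      simp only [coe_filter, Set.mem_ofPred_eq] at hp
      simp only [coe_product, Set.mem_prod, mem_coe, Nat.mem_divisors]
      refine ⟨⟨⟨u * v, by rw [← hp.2]; ring⟩, hn0⟩, ⟨⟨h * v, by rw [← hp.2]; ring⟩, hn0⟩⟩
    · rintro ⟨h, u, v⟩ hp ⟨h', u', v'⟩ hp' hh
      simp only [coe_filter, Set.mem_ofPred_eq] at hp hp'
      simp only [Prod.mk.injEq] at hh ⊢
      obtain ⟨rfl, rfl⟩ := hh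
      refine ⟨rfl, rfl, ?_⟩
      have h1 : h * u * v = h * u * v' := hp.2.trans hp'.2.symm
      have h2 : 0 < h * u := by
        rcases Nat.eq_zero_or_pos (h * u) with h0 | h0
        · exfalso; rw [h0] at hp; omega
        · exact h0
      exact Nat.eq_of_mul_eq_mul_left h2 h1
  rw [card_product, ← sq] at this
  exact_mod_cast this.trans (hτ n hn)

lemma sum_pow_four_le {ι : Type*} (s : Finset ι) (f : ι → ℝ) :
    (∑ i ∈ s, f i) ^ 4 ≤ (#s : ℝ) ^ 2 * (∑ i ∈ s, f i ^ 2) ^ 2 := by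
  have h := sq_sum_le_card_mul_sum_sq (s := s) (f := f)
  calc (∑ i ∈ s, f i) ^ 4 = ((∑ i ∈ s, f i) ^ 2) ^ 2 := by ring
    _ ≤ (#s * ∑ i ∈ s, f i ^ 2) ^ 2 := by gcongr
    _ = _ := by ring

/-- Weyl's inequality for the differenced quartic, averaged over the shift. -/
lemma weyl_differenced (a b : ℤ) (X D τ : ℕ) (hX : 0 < X) (hD : 0 < D) (hab : b - a ≤ X)
    (hτ : ∀ n ∈ Icc 1 (D * X ^ 2), (n.divisors.card) ^ 2 ≤ τ) (Hm : ℝ)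
    (hH : ∑ j ∈ Icc 1 (D * X ^ 2), (1 / (j : ℝ)) ≤ Hm) (α : ℝ) (hα : α ≠ 0) :
    (∑ h ∈ Icc 1 D, ‖expSum (Ico a b) (fun x : ℤ => (x + h) ^ 4 - x ^ 4) α‖) ^ 4
      ≤ 800 * τ * Hm * D ^ 4 * X ^ 3 * (1 + |α| * X + 1 / (|α| * (D * X ^ 2))) := by
  wlog hpos : 0 < α generalizing α
  · have := this (-α) (neg_ne_zero.2 hα) (by
      rcases lt_or_gt_of_ne hα with h | h
      · linarith
      · exact absurd h hpos)
    simpa only [norm_expSum_neg, abs_neg] using this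
  rw [abs_of_pos hpos]
  have hX' : (1 : ℝ) ≤ X := by exact_mod_cast hX
  have hD' : (1 : ℝ) ≤ D := by exact_mod_cast hD
  set β : ℝ := 24 * α with hβ
  have hβ0 : 0 < β := by positivity
  set F : ℕ → ℝ := fun n => 2 * X / (1 + X * |(n : ℝ) * β - round ((n : ℝ) * β)|) with hF
  have hF0 : ∀ n, 0 ≤ F n := fun n => by simp only [hF]; positivity
  set N := D * X ^ 2 with hN
  have hN1 : 1 ≤ N := Nat.succ_le_of_lt (by positivity)
  have hτ1 : (1 : ℝ) ≤ τ := by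
    have := hτ 1 (by simp; omega)
    simp at this; exact_mod_cast this
  have hHm1 : 1 ≤ Hm := by
    refine le_trans ?_ hH
    have h1 : (1 : ℝ) = 1 / ((1 : ℕ) : ℝ) := by simp
    conv_lhs => rw [h1]
    exact single_le_sum (f := fun j : ℕ => 1 / (j : ℝ)) (fun i _ => by positivity)
      (mem_Icc.2 ⟨le_refl 1, hN1⟩)
  have hIoo : (#(Ioo (-X : ℤ) X) : ℝ) ≤ 2 * X := by
    have : #(Ioo (-X : ℤ) X) ≤ 2 * X := by simp; omega
    exact_mod_cast this
  -- differencing twice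
  have main : ∀ h : ℕ, ‖expSum (Ico a b) (fun x : ℤ => (x + h) ^ 4 - x ^ 4) α‖ ^ 4
      ≤ 2 * X * (4 * ∑ u ∈ range X, ∑ v ∈ range X, F (h * u * v)) := by
    intro h
    set φ : ℤ → ℝ := fun x => α * ((x + h : ℝ) ^ 4 - x ^ 4) with hφ
    have e0 : expSum (Ico a b) (fun x : ℤ => (x + h) ^ 4 - x ^ 4) α = ∑ x ∈ Ico a b, ee (φ x) := by
      unfold expSum
      refine sum_congr rfl fun x _ => ?_
      simp only [hφ]; push_cast; rfl
    have s1 := norm_sq_sum_ee_le a b X hab φ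
    have s2 : ∀ u : ℤ, ‖∑ x ∈ Ico (max a (a - u)) (min b (b - u)), ee (φ (x + u) - φ x)‖ ^ 2
        ≤ 2 * ∑ v ∈ range X, F (h * u.natAbs * v) := by
      intro u
      refine (norm_sq_sum_ee_le _ _ X (by omega) (fun x => φ (x + u) - φ x)).trans ?_
      refine le_trans (sum_le_sum (g := fun v : ℤ => F (h * u.natAbs * v.natAbs)) fun v _ => ?_)
        (sum_Ioo_natAbs_le X (fun v => F (h * u.natAbs * v)) fun v => hF0 _)
      set A := max (max a (a - u)) (max a (a - u) - v)
      set B := min (min b (b - u)) (min b (b - u) - v)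
      have hlin : ∀ x : ℤ, (φ (x + v + u) - φ (x + v) - (φ (x + u) - φ x))
          = ((h * u * v : ℤ) : ℝ) * β * x
            + α * (h * u * v * (12 * (h + u + v))) := by
        intro x; simp only [hφ, hβ]; push_cast; ring
      simp only [hlin]
      refine (norm_sum_ee_linear_le A B _ _ X (by linarith) ?_).trans (le_of_eq ?_)
      · have : B - A ≤ (X : ℤ) := by omega
        exact_mod_cast this
      · simp only [hF]
        have key : ∀ y z : ℝ, y = z ∨ y = -z → |y - round y| = |z - round z| := by
          rintro y z (rfl | rfl)
          · rfl
          · rw [abs_sub_round_eq_min, abs_sub_round_eq_min]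
            rcases eq_or_ne (Int.fract z) 0 with h0 | h0
            · rw [h0, Int.fract_neg_eq_zero.2 h0]
            · rw [Int.fract_neg h0, sub_sub_cancel, min_comm]
        have hk := key (((h * u * v : ℤ) : ℝ) * β) (((h * u.natAbs * v.natAbs : ℕ) : ℝ) * β) (by
          have : ((h * u * v : ℤ)).natAbs = h * u.natAbs * v.natAbs := by
            rw [Int.natAbs_mul, Int.natAbs_mul, Int.natAbs_natCast]
          rw [← this]
          rcases Int.natAbs_eq (h * u * v : ℤ) with h1 | h1
          · left
            have : ((h * u * v : ℤ) : ℝ) = ((((h * u * v : ℤ)).natAbs : ℤ) : ℝ) := by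
              exact_mod_cast h1
            rw [this, Int.cast_natCast]
          · right
            have : ((h * u * v : ℤ) : ℝ) = ((-(((h * u * v : ℤ)).natAbs : ℤ) : ℤ) : ℝ) := by
              exact_mod_cast h1
            rw [this, Int.cast_neg, Int.cast_natCast]; ring)
        rw [hk]
    rw [e0]
    calc ‖∑ x ∈ Ico a b, ee (φ x)‖ ^ 4 = (‖∑ x ∈ Ico a b, ee (φ x)‖ ^ 2) ^ 2 := by ring
      _ ≤ (∑ u ∈ Ioo (-X : ℤ) X,
          ‖∑ x ∈ Ico (max a (a - u)) (min b (b - u)), ee (φ (x + u) - φ x)‖) ^ 2 := by gcongr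
      _ ≤ #(Ioo (-X : ℤ) X) * ∑ u ∈ Ioo (-X : ℤ) X,
          ‖∑ x ∈ Ico (max a (a - u)) (min b (b - u)), ee (φ (x + u) - φ x)‖ ^ 2 :=
          sq_sum_le_card_mul_sum_sq
      _ ≤ 2 * X * ∑ u ∈ Ioo (-X : ℤ) X, 2 * ∑ v ∈ range X, F (h * u.natAbs * v) := by
          gcongr with u hu
          exact s2 u
      _ ≤ 2 * X * (2 * ∑ u ∈ range X, 2 * ∑ v ∈ range X, F (h * u * v)) := by
          gcongr
          exact sum_Ioo_natAbs_le X (fun u => 2 * ∑ v ∈ range X, F (h * u * v))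
            fun u => mul_nonneg zero_le_two (sum_nonneg fun _ _ => hF0 _)
      _ = _ := by rw [← mul_sum]; ring
  have hcount : ∑ h ∈ Icc 1 D, ∑ u ∈ range X, ∑ v ∈ range X, F (h * u * v)
      ≤ 4 * N + τ * (4 * (β * N + 2) * (X + 2 / β * Hm)) := by
    have z1 : ∀ h ∈ Icc 1 D, ∑ u ∈ range X, ∑ v ∈ range X, F (h * u * v)
        ≤ 4 * X ^ 2 + ∑ u ∈ Icc 1 X, ∑ v ∈ Icc 1 X, F (h * u * v) := by
      intro h _
      have sub : range X ⊆ insert 0 (Icc 1 X) := by intro y; simp; omega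
      have F0 : F 0 = 2 * X := by simp [hF]
      have i1 : ∀ u, ∑ v ∈ range X, F (h * u * v) ≤ 2 * X + ∑ v ∈ Icc 1 X, F (h * u * v) := by
        intro u
        refine (sum_le_sum_of_subset_of_nonneg sub fun _ _ _ => hF0 _).trans ?_
        rw [sum_insert (by simp), mul_zero, F0]
      have i2 : ∑ u ∈ range X, ∑ v ∈ Icc 1 X, F (h * u * v)
          ≤ 2 * X ^ 2 + ∑ u ∈ Icc 1 X, ∑ v ∈ Icc 1 X, F (h * u * v) := by
        refine (sum_le_sum_of_subset_of_nonneg sub fun _ _ _ => sum_nonneg fun _ _ => hF0 _).trans ?_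
        rw [sum_insert (by simp)]
        simp only [mul_zero, zero_mul, F0]
        simp
        apply le_of_eq; ring
      calc _ ≤ ∑ u ∈ range X, (2 * X + ∑ v ∈ Icc 1 X, F (h * u * v)) :=
            sum_le_sum fun u _ => i1 u
        _ = 2 * X ^ 2 + ∑ u ∈ range X, ∑ v ∈ Icc 1 X, F (h * u * v) := by
            rw [sum_add_distrib]; simp; ring
        _ ≤ _ := by linarith
    refine (sum_le_sum z1).trans ?_
    rw [sum_add_distrib]
    have t1 := sum_triple_product_le D X τ F hF0 hτ
    have t2 := sum_fractional_le X N hX β Hm hβ0 hH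
    have t3 : ∑ h ∈ Icc 1 D, (4 * X ^ 2 : ℝ) = 4 * N := by
      simp [hN]; ring
    rw [t3]
    refine add_le_add le_rfl (t1.trans ?_)
    gcongr
  have hfinal : (∑ h ∈ Icc 1 D, ‖expSum (Ico a b) (fun x : ℤ => (x + h) ^ 4 - x ^ 4) α‖) ^ 4
      ≤ 8 * D ^ 3 * X * (4 * N + τ * (4 * (β * N + 2) * (X + 2 / β * Hm))) := by
    set f : ℕ → ℝ := fun h => ‖expSum (Ico a b) (fun x : ℤ => (x + h) ^ 4 - x ^ 4) α‖
    calc (∑ h ∈ Icc 1 D, f h) ^ 4 ≤ (#(Icc 1 D) : ℝ) ^ 2 * (∑ h ∈ Icc 1 D, f h ^ 2) ^ 2 :=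
          sum_pow_four_le _ _
      _ ≤ (#(Icc 1 D) : ℝ) ^ 2 * (#(Icc 1 D) * ∑ h ∈ Icc 1 D, (f h ^ 2) ^ 2) := by
          gcongr; exact sq_sum_le_card_mul_sum_sq
      _ = D ^ 3 * ∑ h ∈ Icc 1 D, f h ^ 4 := by
          simp; ring_nf
      _ ≤ D ^ 3 * ∑ h ∈ Icc 1 D, 2 * X * (4 * ∑ u ∈ range X, ∑ v ∈ range X, F (h * u * v)) := by
          gcongr with h _; exact main h
      _ = 8 * D ^ 3 * X * ∑ h ∈ Icc 1 D, ∑ u ∈ range X, ∑ v ∈ range X, F (h * u * v) := by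
          rw [← mul_sum, ← mul_sum]; ring
      _ ≤ _ := by gcongr
  refine hfinal.trans ?_
  have hNr : (N : ℝ) = D * X ^ 2 := by simp [hN]
  have hXN : (X : ℝ) ≤ N := by
    rw [hNr]; nlinarith
  have hN1' : (1 : ℝ) ≤ N := by exact_mod_cast hN1
  have b1 : 4 * (N : ℝ) + τ * (4 * (β * N + 2) * (X + 2 / β * Hm))
      ≤ τ * Hm * (100 * (N * (1 + α * X + 1 / (α * N)))) := by
    have e1 : (4 * (β * N + 2) * (X + 2 / β * Hm))
        = 96 * α * N * X + 8 * N * Hm + 8 * X + 2 / 3 * (1 / α) * Hm := by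
      rw [hβ]; field_simp; ring
    have e2 : 100 * ((N : ℝ) * (1 + α * X + 1 / (α * N)))
        = 100 * N + 100 * α * N * X + 100 * (1 / α) := by
      field_simp
    rw [e1, e2]
    have c1 : (N : ℝ) ≤ τ * Hm * N := by
      have : 1 ≤ τ * Hm := one_le_mul_of_one_le_of_one_le hτ1 hHm1
      nlinarith
    have c2 : (τ : ℝ) * (8 * X) ≤ τ * Hm * (8 * N) := by
      have : (τ : ℝ) * (8 * X) ≤ τ * (8 * N) := by gcongr
      have h3 : (τ : ℝ) * (8 * N) ≤ τ * (Hm * (8 * N)) := by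
        exact mul_le_mul_of_nonneg_left (by nlinarith) (by positivity)
      linarith
    have c3 : (τ : ℝ) * (96 * α * N * X) ≤ τ * Hm * (96 * α * N * X) := by
      rw [mul_assoc]
      gcongr
      have : 0 ≤ 96 * α * N * X := by positivity
      nlinarith
    have c4 : 0 ≤ τ * Hm * (α * N * X) := by positivity
    have c5 : 0 ≤ τ * Hm * (1 / α) := by positivity
    have c6 : 0 ≤ τ * Hm * N := by positivity
    linarith
  calc 8 * (D : ℝ) ^ 3 * X * (4 * N + τ * (4 * (β * N + 2) * (X + 2 / β * Hm)))
      ≤ 8 * (D : ℝ) ^ 3 * X * (τ * Hm * (100 * (N * (1 + α * X + 1 / (α * N))))) := by gcongr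
    _ = _ := by rw [hNr]; ring

section

/-- Two convexity ratios that cannot agree up to a small relative error. -/
lemma curvature_ratio_ne (q u e0 e1 e2 : ℝ) (hq : 0 < q) (hq9 : q ≤ 1 / 9) (hu : 0 ≤ u)
    (huq : u ≤ q / 1000) (h0 : |e0| ≤ q / 1000) (h1 : |e1| ≤ q / 1000) (h2 : |e2| ≤ q / 1000) :
    (3 + q + e1) ^ 2 * (1 + u) ≠ (1 + q + e0) * (1 + e2) * (3 + u) ^ 2 := by
  rw [abs_le] at h0 h1 h2
  apply ne_of_lt
  have a1 : (3 + q + e1) ^ 2 ≤ (3 + q + q / 1000) ^ 2 := by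
    apply pow_le_pow_left₀ <;> linarith
  have a2 : (3 + q + q / 1000) ^ 2 ≤ 9 + 6.2 * q := by nlinarith
  have a3 : (3 + q + e1) ^ 2 * (1 + u) ≤ (9 + 6.2 * q) * (1 + q / 1000) := by
    apply mul_le_mul (a1.trans a2) <;> nlinarith
  have a4 : (9 + 6.2 * q) * (1 + q / 1000) ≤ 9 + 6.3 * q := by nlinarith
  have b1 : (1 + q - q / 1000) * (1 - q / 1000) ≤ (1 + q + e0) * (1 + e2) := by
    apply mul_le_mul <;> linarith
  have b2 : 1 + 0.99 * q ≤ (1 + q - q / 1000) * (1 - q / 1000) := by nlinarith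
  have b3 : (9 : ℝ) ≤ (3 + u) ^ 2 := by nlinarith
  have b4 : (1 + 0.99 * q) * 9 ≤ (1 + q + e0) * (1 + e2) * (3 + u) ^ 2 := by
    apply mul_le_mul (b2.trans b1) b3 (by norm_num)
    linarith [b2.trans b1]
  linarith

/-- A cubic that is small at `0, t₁, t₂` has small low coefficients. -/
lemma cubic_coeff_bounds (c0 c1 c2 c3 L G : ℝ) (t1 t2 : ℤ) (h1 : t1 ≠ 0) (h2 : t2 ≠ 0)
    (h12 : t1 ≠ t2) (hG1 : |(t1 : ℝ)| ≤ G) (hG2 : |(t2 : ℝ)| ≤ G) (p0 : |c0| ≤ L)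
    (p1 : |c0 + c1 * t1 + c2 * t1 ^ 2 + c3 * t1 ^ 3| ≤ L)
    (p2 : |c0 + c1 * t2 + c2 * t2 ^ 2 + c3 * t2 ^ 3| ≤ L) :
    |c2| ≤ 4 * L + 2 * G * |c3| ∧ |c1| ≤ 2 * L + G * |c2| + G ^ 2 * |c3| := by
  have ge1 : ∀ t : ℤ, t ≠ 0 → (1 : ℝ) ≤ |(t : ℝ)| := by
    intro t ht
    exact_mod_cast Int.one_le_abs ht
  have slope : ∀ t : ℤ, t ≠ 0 → |c0 + c1 * t + c2 * t ^ 2 + c3 * t ^ 3| ≤ L →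
      |c1 + c2 * t + c3 * t ^ 2| ≤ 2 * L := by
    intro t ht hp
    have ht' := ge1 t ht
    have e : |c1 + c2 * t + c3 * t ^ 2| * |(t : ℝ)|
        = |(c0 + c1 * t + c2 * t ^ 2 + c3 * t ^ 3) - c0| := by
      rw [← abs_mul]; congr 1; ring
    have := abs_sub (c0 + c1 * t + c2 * t ^ 2 + c3 * t ^ 3) c0
    nlinarith [abs_nonneg (c1 + c2 * t + c3 * t ^ 2)]
  have s1 := slope t1 h1 p1
  have s2 := slope t2 h2 p2
  have hd := ge1 (t1 - t2) (sub_ne_zero.2 h12)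
  push_cast at hd
  have e : |c2 + c3 * (t1 + t2)| * |(t1 : ℝ) - t2|
      = |(c1 + c2 * t1 + c3 * t1 ^ 2) - (c1 + c2 * t2 + c3 * t2 ^ 2)| := by
    rw [← abs_mul]; congr 1; ring
  have e' := abs_sub (c1 + c2 * t1 + c3 * t1 ^ 2) (c1 + c2 * t2 + c3 * t2 ^ 2)
  have f : |c2 + c3 * (t1 + t2)| ≤ 4 * L := by
    nlinarith [abs_nonneg (c2 + c3 * ((t1 : ℝ) + t2))]
  have f2 : |c3 * ((t1 : ℝ) + t2)| ≤ 2 * G * |c3| := by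
    rw [abs_mul]
    have := abs_add_le (t1 : ℝ) t2
    nlinarith [abs_nonneg c3]
  have f3 : |c2| ≤ |c2 + c3 * (t1 + t2)| + |c3 * ((t1 : ℝ) + t2)| := by
    have := abs_sub (c2 + c3 * ((t1 : ℝ) + t2)) (c3 * ((t1 : ℝ) + t2))
    rwa [add_sub_cancel_right] at this
  refine ⟨by linarith, ?_⟩
  have g1 : |c1| ≤ |c1 + c2 * t1 + c3 * t1 ^ 2| + |c2 * t1| + |c3 * (t1 : ℝ) ^ 2| := by
    have q1 := abs_sub (c1 + c2 * t1 + c3 * t1 ^ 2) (c2 * t1 + c3 * t1 ^ 2)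
    have q2 := abs_add_le (c2 * t1) (c3 * (t1 : ℝ) ^ 2)
    rw [show (c1 + c2 * t1 + c3 * t1 ^ 2) - (c2 * t1 + c3 * (t1 : ℝ) ^ 2) = c1 by ring] at q1
    linarith
  have g2 : |c2 * (t1 : ℝ)| ≤ G * |c2| := by
    rw [abs_mul, mul_comm]; gcongr
  have g3 : |c3 * (t1 : ℝ) ^ 2| ≤ G ^ 2 * |c3| := by
    rw [abs_mul, abs_pow, mul_comm]; gcongr
  linarith

section Quartic
variable {x h a P : ℝ}

lemma quartic_diff_lower (hP : 0 ≤ P) (hh : 0 ≤ h) (hx : P ≤ x) :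
    4 * h * P ^ 3 ≤ (x + h) ^ 4 - x ^ 4 := by
  have h1 : P ^ 3 ≤ x ^ 3 := by gcongr
  have h2 : (x + h) ^ 4 - x ^ 4 = 4 * h * x ^ 3 + (6 * h ^ 2 * x ^ 2 + 4 * h ^ 3 * x + h ^ 4) := by ring
  have hx0 : 0 ≤ x := hP.trans hx
  have h3 : 0 ≤ 6 * h ^ 2 * x ^ 2 + 4 * h ^ 3 * x + h ^ 4 := by positivity
  have h4 : 4 * h * P ^ 3 ≤ 4 * h * x ^ 3 := by gcongr
  linarith

lemma quartic_diff_upper (hh : 0 ≤ h) (hx : 0 ≤ x) (hxP : x + h ≤ 2 * P) :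
    (x + h) ^ 4 - x ^ 4 ≤ 32 * h * P ^ 3 := by
  have h1 : (x + h) ^ 3 ≤ (2 * P) ^ 3 := by gcongr
  have h2 : (x + h) ^ 4 - x ^ 4 ≤ 4 * h * (x + h) ^ 3 := by
    have : 4 * h * (x + h) ^ 3 - ((x + h) ^ 4 - x ^ 4)
      = h ^ 2 * (6 * x ^ 2 + 8 * x * h + 3 * h ^ 2) := by ring
    have h3 : 0 ≤ h ^ 2 * (6 * x ^ 2 + 8 * x * h + 3 * h ^ 2) := by positivity
    linarith
  have h4 : 4 * h * (x + h) ^ 3 ≤ 4 * h * (2 * P) ^ 3 := by gcongr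
  nlinarith

lemma quartic_diff_increment (hP : 0 ≤ P) (hh : 0 ≤ h) (hx : P ≤ x) (ha : 0 ≤ a) :
    12 * h * P ^ 2 * a ≤ ((x + a + h) ^ 4 - (x + a) ^ 4) - ((x + h) ^ 4 - x ^ 4) := by
  have hx0 : 0 ≤ x := hP.trans hx
  have h1 : P ^ 2 ≤ x ^ 2 := by gcongr
  have h2 : ((x + a + h) ^ 4 - (x + a) ^ 4) - ((x + h) ^ 4 - x ^ 4) = 12 * h * x ^ 2 * a +
    h * a * (12 * x * h + 12 * x * a + 4 * h ^ 2 + 6 * h * a + 4 * a ^ 2) := by ring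
  have h3 : 0 ≤ h * a * (12 * x * h + 12 * x * a + 4 * h ^ 2 + 6 * h * a + 4 * a ^ 2) := by
    positivity
  have h4 : 12 * h * P ^ 2 * a ≤ 12 * h * x ^ 2 * a := by gcongr
  linarith

lemma abs_quartic_diff_increment_lower (hP : 0 ≤ P) (hh : 0 ≤ h) (hx : P ≤ x) (hxa : P ≤ x + a) :
    12 * h * P ^ 2 * |a| ≤ |((x + a + h) ^ 4 - (x + a) ^ 4) - ((x + h) ^ 4 - x ^ 4)| := by
  rcases le_total 0 a with h0 | h0
  · rw [abs_of_nonneg h0]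
    exact (quartic_diff_increment hP hh hx h0).trans (le_abs_self _)
  · rw [abs_of_nonpos h0]
    have := quartic_diff_increment (x := x + a) (a := -a) hP hh hxa (by linarith)
    rw [abs_sub_comm]
    refine le_trans (this.trans (le_of_eq ?_)) (le_abs_self _)
    ring

lemma abs_quartic_diff_linearize (hP : 0 ≤ P) (hh : 0 ≤ h) (hx : 0 ≤ x) (hxP : x + h ≤ 2 * P)
    (ha : |a| ≤ P) :
    |((x + a + h) ^ 4 - (x + a) ^ 4) - ((x + h) ^ 4 - x ^ 4) - h * (3 * (2 * x + h) ^ 2 + h ^ 2) * a|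
      ≤ 28 * h * P * a ^ 2 := by
  have e : ((x + a + h) ^ 4 - (x + a) ^ 4) - ((x + h) ^ 4 - x ^ 4)
      - h * (3 * (2 * x + h) ^ 2 + h ^ 2) * a = h * a ^ 2 * (6 * (2 * x + h) + 4 * a) := by ring
  rw [e, abs_mul, abs_of_nonneg (by positivity : 0 ≤ h * a ^ 2)]
  have : |6 * (2 * x + h) + 4 * a| ≤ 28 * P := by
    rw [abs_le] at ha ⊢
    constructor <;> linarith
  calc h * a ^ 2 * |6 * (2 * x + h) + 4 * a| ≤ h * a ^ 2 * (28 * P) := by gcongr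
    _ = _ := by ring

lemma abs_quartic_diff_increment_upper (hP : 0 ≤ P) (hh : 0 ≤ h) (hx : 0 ≤ x)
    (hxP : x + h ≤ 2 * P) (ha : |a| ≤ P) :
    |((x + a + h) ^ 4 - (x + a) ^ 4) - ((x + h) ^ 4 - x ^ 4)| ≤ 80 * h * P ^ 2 * |a| := by
  have h1 := abs_quartic_diff_linearize hP hh hx hxP ha
  have h2 : |h * (3 * (2 * x + h) ^ 2 + h ^ 2) * a| ≤ 52 * h * P ^ 2 * |a| := by
    rw [abs_mul, abs_of_nonneg (by positivity)]
    have : 3 * (2 * x + h) ^ 2 + h ^ 2 ≤ 52 * P ^ 2 := by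
      have e1 : (2 * x + h) ^ 2 ≤ (4 * P) ^ 2 := by
        apply pow_le_pow_left₀ <;> linarith
      have e2 : h ^ 2 ≤ (2 * P) ^ 2 := by apply pow_le_pow_left₀ <;> linarith
      linarith
    calc h * (3 * (2 * x + h) ^ 2 + h ^ 2) * |a| ≤ h * (52 * P ^ 2) * |a| := by gcongr
      _ = _ := by ring
  have h3 : 28 * h * P * a ^ 2 ≤ 28 * h * P ^ 2 * |a| := by
    have : a ^ 2 ≤ P * |a| := by rw [← sq_abs]; nlinarith [abs_nonneg a]
    calc 28 * h * P * a ^ 2 ≤ 28 * h * P * (P * |a|) := by gcongr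
      _ = _ := by ring
  have h4 := abs_sub_abs_le_abs_sub (((x + a + h) ^ 4 - (x + a) ^ 4) - ((x + h) ^ 4 - x ^ 4))
    (h * (3 * (2 * x + h) ^ 2 + h ^ 2) * a)
  linarith

end Quartic

set_option maxHeartbeats 1000000 in
lemma no_collinear_points (P Q L G K h k x z l : ℝ) (t1 t2 : ℤ)
    (hQ : 1 ≤ Q) (hPQ : 100 * Q ≤ P) (hL : 0 ≤ L) (hG : 1 ≤ G) (hGQ : G ≤ Q) (hK : 1 ≤ K)
    (hK3 : 10 ^ 5 * L * Q ≤ K ^ 3) (hK2 : 10 ^ 12 * G * Q ≤ K ^ 2)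
    (hk : K ≤ k) (hh : 0 < h) (hx : P ≤ x) (hz : Q ≤ z) (hzk : z + k ≤ 2 * Q)
    (s1 : h * P ^ 3 ≤ 9 * k * Q ^ 3) (hlb : Q * |l| ≤ 77 * P)
    (ht1 : t1 ≠ 0) (ht2 : t2 ≠ 0) (ht12 : t1 ≠ t2) (hG1 : |(t1 : ℝ)| ≤ G) (hG2 : |(t2 : ℝ)| ≤ G)
    (p0 : |((x + h) ^ 4 - x ^ 4) - ((z + k) ^ 4 - z ^ 4)| ≤ L)
    (p1 : |((x + l * t1 + h) ^ 4 - (x + l * t1) ^ 4) - ((z + t1 + k) ^ 4 - (z + t1) ^ 4)| ≤ L)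
    (p2 : |((x + l * t2 + h) ^ 4 - (x + l * t2) ^ 4) - ((z + t2 + k) ^ 4 - (z + t2) ^ 4)| ≤ L) :
    False := by
  have hP : 0 < P := by linarith
  have hQ0 : 0 < Q := by linarith
  have hk0 : 0 < k := by linarith
  have hx0 : 0 < x := by linarith
  have hz0 : 0 < z := by linarith
  set A := h * (3 * (2 * x + h) ^ 2 + h ^ 2) with hA
  set C := k * (3 * (2 * z + k) ^ 2 + k ^ 2) with hC
  set s := 2 * x + h with hs
  set w := 2 * z + k with hw
  set c0 := ((x + h) ^ 4 - x ^ 4) - ((z + k) ^ 4 - z ^ 4) with hc0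
  set c1 := l * A - C with hc1
  set c2 := 6 * (l ^ 2 * h * s - k * w) with hc2
  set c3 := 4 * (h * l ^ 3 - k) with hc3
  have b3 : |c3| ≤ 2 * 10 ^ 7 * k := by
    have e1 : |h * l ^ 3| ≤ 4108797 * k := by
      rw [abs_mul, abs_pow, abs_of_pos hh]
      have e2 : (Q * |l|) ^ 3 ≤ (77 * P) ^ 3 := by gcongr
      have e3 : Q ^ 3 * (h * |l| ^ 3) ≤ Q ^ 3 * (4108797 * k) := by
        calc Q ^ 3 * (h * |l| ^ 3) = h * (Q * |l|) ^ 3 := by ring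
          _ ≤ h * (77 * P) ^ 3 := by gcongr
          _ = 456533 * (h * P ^ 3) := by ring
          _ ≤ 456533 * (9 * k * Q ^ 3) := by gcongr
          _ = _ := by ring
      exact le_of_mul_le_mul_left e3 (by positivity)
    have e4 := abs_sub (h * l ^ 3) k
    rw [abs_of_pos hk0] at e4
    rw [hc3, abs_mul, abs_of_pos (by norm_num : (0 : ℝ) < 4)]
    linarith
  obtain ⟨b2, b1⟩ := cubic_coeff_bounds c0 c1 c2 c3 L G t1 t2 ht1 ht2 ht12 hG1 hG2 p0
    (by convert p1 using 2; simp only [hc0, hc1, hc2, hc3, hA, hC, hs, hw]; ring)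
    (by convert p2 using 2; simp only [hc0, hc1, hc2, hc3, hA, hC, hs, hw]; ring)
  have hs0 : 0 < s := by positivity
  have hw0 : 0 < w := by positivity
  have hw3 : 3 * k ≤ w := by rw [hw]; linarith
  have hw4 : w ≤ 4 * Q := by rw [hw]; linarith
  have hwQ : 2 * Q ≤ w := by rw [hw]; linarith
  have K3 : 10 ^ 5 * L * Q ≤ k ^ 3 := hK3.trans (by gcongr)
  have K2 : 10 ^ 12 * G * Q * k ≤ k ^ 3 := by
    calc 10 ^ 12 * G * Q * k ≤ k ^ 2 * k := by gcongr; exact hK2.trans (by gcongr)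
      _ = _ := by ring
  have B2 : |c2| * Q ≤ k ^ 3 / 1000 := by
    have h1 : |c2| ≤ 4 * L + 4 * 10 ^ 7 * (G * k) := by
      have : 2 * G * |c3| ≤ 2 * G * (2 * 10 ^ 7 * k) := by gcongr
      linarith
    have h2 : |c2| * Q ≤ (4 * L + 4 * 10 ^ 7 * (G * k)) * Q := by gcongr
    have h3 : (4 * L + 4 * 10 ^ 7 * (G * k)) * Q
        = 4 / 10 ^ 5 * (10 ^ 5 * L * Q) + 4 / 10 ^ 5 * (10 ^ 12 * G * Q * k) := by ring
    have h4 : 0 < k ^ 3 := by positivity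
    linarith
  have B1 : |c1| ≤ k ^ 3 / 1000 := by
    have h1 : G * |c2| ≤ G * (4 * L + 2 * G * |c3|) := by gcongr
    have h2 : G ^ 2 * |c3| ≤ G ^ 2 * (2 * 10 ^ 7 * k) := by gcongr
    have h3 : |c1| ≤ 2 * L + 4 * (L * G) + 6 * 10 ^ 7 * (G ^ 2 * k) := by
      have : G * (4 * L + 2 * G * |c3|) = 4 * (L * G) + 2 * (G ^ 2 * |c3|) := by ring
      linarith
    have h4 : L * G ≤ L * Q := by gcongr
    have h5 : G ^ 2 * k ≤ G * Q * k := by rw [sq]; gcongr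
    have h6 : L ≤ L * Q := le_mul_of_one_le_right hL hQ
    linarith
  have B0 : |2 * c0| ≤ k ^ 3 * w / 1000 := by
    rw [abs_mul, abs_of_pos (by norm_num : (0 : ℝ) < 2)]
    have h6 : L ≤ L * Q := le_mul_of_one_le_right hL hQ
    have h7 : k ^ 3 ≤ k ^ 3 * w := by
      exact le_mul_of_one_le_right (by positivity) (by linarith)
    linarith
  -- normalisation
  have hhs : 1000 * (h * w) ≤ k * s := by
    have h1 : h * P * P ^ 3 ≤ k * P * P ^ 3 / 100000 := by
      have e1 : (100 * Q) ^ 3 ≤ P ^ 3 := by gcongr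
      have e2 : h * P ^ 3 * P ≤ 9 * k * Q ^ 3 * P := by gcongr
      have e3 : 9 * k * P * Q ^ 3 ≤ 9 * k * P * (P ^ 3 / 1000000) := by gcongr; linarith
      have e4 : 0 < k * P * P ^ 3 := by positivity
      have e5 : 9 * k * P * (P ^ 3 / 1000000) = k * P * P ^ 3 * (9 / 1000000) := by ring
      have e6 : h * P * P ^ 3 = h * P ^ 3 * P := by ring
      have e7 : 9 * k * Q ^ 3 * P = 9 * k * P * Q ^ 3 := by ring
      linarith
    have h2 : h * P ≤ k * P / 100000 := by
      have : P ^ 3 * (h * P) ≤ P ^ 3 * (k * P / 100000) := by linarith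
      exact le_of_mul_le_mul_left this (by positivity)
    have h3 : w ≤ P := by linarith
    have h4 : h * w ≤ h * P := by gcongr
    have h5 : k * P ≤ k * s := by gcongr; rw [hs]; linarith
    have h6 : 0 < k * P := by positivity
    linarith
  refine curvature_ratio_ne ((k / w) ^ 2) ((h / s) ^ 2) (2 * c0 / (k * w ^ 3)) (c1 / (k * w ^ 2))
    (c2 / 6 / (k * w)) (by positivity) ?_ (by positivity) ?_ ?_ ?_ ?_ ?_
  · rw [div_pow, div_le_iff₀ (by positivity)]
    have : (3 * k) ^ 2 ≤ w ^ 2 := by gcongr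
    linarith
  · have : h / s ≤ k / w / 1000 := by
      rw [div_div, div_le_div_iff₀ hs0 (by positivity)]; linarith
    calc (h / s) ^ 2 ≤ (k / w / 1000) ^ 2 := by gcongr
      _ ≤ _ := by
        have : 0 ≤ (k / w) ^ 2 := by positivity
        rw [div_pow]; linarith
  · rw [abs_div, abs_of_pos (by positivity : 0 < k * w ^ 3), div_le_iff₀ (by positivity)]
    refine B0.trans (le_of_eq ?_)
    field_simp
  · rw [abs_div, abs_of_pos (by positivity : 0 < k * w ^ 2), div_le_iff₀ (by positivity)]
    refine B1.trans (le_of_eq ?_)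
    field_simp
  · rw [abs_div, abs_of_pos (by positivity : 0 < k * w), div_le_iff₀ (by positivity)]
    have e1 : (k / w) ^ 2 / 1000 * (k * w) = k ^ 3 / 1000 / w := by field_simp
    rw [e1, le_div_iff₀ hw0, abs_div, abs_of_pos (by norm_num : (0 : ℝ) < 6)]
    have : |c2| * w ≤ |c2| * (4 * Q) := by gcongr
    have : 0 < k ^ 3 := by positivity
    linarith
  · have E0 : h * s ^ 3 * (1 + (h / s) ^ 2) = k * w ^ 3 * (1 + (k / w) ^ 2 + 2 * c0 / (k * w ^ 3)) := by
      have : h * s ^ 3 * (1 + (h / s) ^ 2) = h * s * (s ^ 2 + h ^ 2) := by field_simp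
      rw [this]
      have : k * w ^ 3 * (1 + (k / w) ^ 2 + 2 * c0 / (k * w ^ 3)) = k * w * (w ^ 2 + k ^ 2) + 2 * c0 := by
        field_simp
      rw [this]
      simp only [hc0, hs, hw]; ring
    have E1 : h * l * s ^ 2 * (3 + (h / s) ^ 2) = k * w ^ 2 * (3 + (k / w) ^ 2 + c1 / (k * w ^ 2)) := by
      have : h * l * s ^ 2 * (3 + (h / s) ^ 2) = l * (h * (3 * s ^ 2 + h ^ 2)) := by field_simp
      rw [this]
      have : k * w ^ 2 * (3 + (k / w) ^ 2 + c1 / (k * w ^ 2)) = k * (3 * w ^ 2 + k ^ 2) + c1 := by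
        field_simp
      rw [this]
      simp only [hc1, hA, hC]; ring
    have E2 : h * l ^ 2 * s = k * w * (1 + c2 / 6 / (k * w)) := by
      have : k * w * (1 + c2 / 6 / (k * w)) = k * w + c2 / 6 := by field_simp
      rw [this]
      simp only [hc2]; ring
    set u := (h / s) ^ 2
    set q := (k / w) ^ 2
    set e0 := 2 * c0 / (k * w ^ 3)
    set e1 := c1 / (k * w ^ 2)
    set e2 := c2 / 6 / (k * w)
    have F : (k * w ^ 2) ^ 2 * ((3 + q + e1) ^ 2 * (1 + u))
        = (k * w ^ 2) ^ 2 * ((1 + q + e0) * (1 + e2) * (3 + u) ^ 2) := by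
      calc (k * w ^ 2) ^ 2 * ((3 + q + e1) ^ 2 * (1 + u))
          = (k * w ^ 2 * (3 + q + e1)) ^ 2 * (1 + u) := by ring
        _ = (h * l * s ^ 2 * (3 + u)) ^ 2 * (1 + u) := by rw [E1]
        _ = (h * s ^ 3 * (1 + u)) * (h * l ^ 2 * s) * (3 + u) ^ 2 := by ring
        _ = (k * w ^ 3 * (1 + q + e0)) * (k * w * (1 + e2)) * (3 + u) ^ 2 := by rw [E0, E2]
        _ = _ := by ring
    exact mul_left_cancel₀ (by positivity) F

set_option maxHeartbeats 1000000 in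
/-- The curve `(x + h)⁴ - x⁴ = (z + k)⁴ - z⁴`, thickened by `L`, has no three lattice points
with nearby second coordinates. -/
lemma no_three_points_in_window (P Q L G K h k x z : ℝ) (a1 a2 t1 t2 : ℤ)
    (hQ : 1 ≤ Q) (hPQ : 100 * Q ≤ P) (hL : 0 ≤ L) (hG : 1 ≤ G) (hGQ : G ≤ Q) (hK : 1 ≤ K)
    (hLK : L ≤ K * Q ^ 2) (hd1 : 8 * 10 ^ 6 * P * G ^ 3 ≤ Q ^ 2) (hd2 : 16 * P * G * L ≤ K * Q ^ 3)
    (hK3 : 10 ^ 5 * L * Q ≤ K ^ 3) (hK2 : 10 ^ 12 * G * Q ≤ K ^ 2)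
    (hk : K ≤ k) (hh : 0 < h) (hx : P ≤ x) (hxh : x + h ≤ 2 * P) (hz : Q ≤ z) (hzk : z + k ≤ 2 * Q)
    (hx1 : P ≤ x + a1) (hx1' : x + a1 ≤ 2 * P) (hx2 : P ≤ x + a2) (hx2' : x + a2 ≤ 2 * P)
    (ht1 : t1 ≠ 0) (ht2 : t2 ≠ 0) (ht12 : t1 ≠ t2) (hG1 : |(t1 : ℝ)| ≤ G) (hG2 : |(t2 : ℝ)| ≤ G)
    (p0 : |((x + h) ^ 4 - x ^ 4) - ((z + k) ^ 4 - z ^ 4)| ≤ L)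
    (p1 : |((x + a1 + h) ^ 4 - (x + a1) ^ 4) - ((z + t1 + k) ^ 4 - (z + t1) ^ 4)| ≤ L)
    (p2 : |((x + a2 + h) ^ 4 - (x + a2) ^ 4) - ((z + t2 + k) ^ 4 - (z + t2) ^ 4)| ≤ L) : False := by
  have hP : 0 < P := by linarith
  have hQ0 : 0 < Q := by linarith
  have hk0 : 0 < k := by linarith
  have hx0 : 0 < x := by linarith
  have hz0 : 0 < z := by linarith
  have ge1 : ∀ t : ℤ, t ≠ 0 → (1 : ℝ) ≤ |(t : ℝ)| := by
    intro t ht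
    exact_mod_cast Int.one_le_abs ht
  have hLk : L ≤ k * Q ^ 2 := hLK.trans (by gcongr)
  have hLk3 : L ≤ k * Q ^ 3 :=
    hLk.trans (mul_le_mul_of_nonneg_left (pow_le_pow_right₀ hQ (by norm_num)) hk0.le)
  -- sizes of `h` and `k`
  have s1 : h * P ^ 3 ≤ 9 * k * Q ^ 3 := by
    have := quartic_diff_lower hP.le hh.le hx
    have := quartic_diff_upper hk0.le hz0.le hzk
    have := (abs_le.1 p0).2
    linarith
  have s2 : k * Q ^ 3 ≤ 11 * (h * P ^ 3) := by
    have := quartic_diff_upper hh.le hx0.le hxh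
    have := quartic_diff_lower hQ0.le hk0.le hz
    have := (abs_le.1 p0).1
    linarith
  set gx : ℝ → ℝ := fun a => ((x + a + h) ^ 4 - (x + a) ^ 4) - ((x + h) ^ 4 - x ^ 4) with hgx
  set gz : ℝ → ℝ := fun t => ((z + t + k) ^ 4 - (z + t) ^ 4) - ((z + k) ^ 4 - z ^ 4) with hgz
  have comb : ∀ a t : ℝ, |((x + a + h) ^ 4 - (x + a) ^ 4) - ((z + t + k) ^ 4 - (z + t) ^ 4)| ≤ L →
      |gx a - gz t| ≤ 2 * L := by
    intro a t hp
    rw [abs_le] at hp p0 ⊢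
    simp only [hgx, hgz]
    constructor <;> linarith
  have incr : ∀ a t : ℤ, t ≠ 0 → |(t : ℝ)| ≤ G → P ≤ x + a →
      |((x + a + h) ^ 4 - (x + a) ^ 4) - ((z + t + k) ^ 4 - (z + t) ^ 4)| ≤ L →
      Q * |(a : ℝ)| ≤ 77 * P * |(t : ℝ)| := by
    intro a t ht htG hxa hp
    have h1 := comb a t hp
    have h2 := abs_quartic_diff_increment_lower hP.le hh.le hx hxa
    have h3 := abs_quartic_diff_increment_upper hQ0.le hk0.le hz0.le hzk (htG.trans hGQ)
    have h4 := abs_sub_abs_le_abs_sub (gx a) (gz t)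
    have h5 : L ≤ k * Q ^ 2 * |(t : ℝ)| := by
      exact hLk.trans (le_mul_of_one_le_right (by positivity) (ge1 t ht))
    have h6 : h * P ^ 2 * |(a : ℝ)| ≤ 7 * (k * Q ^ 2 * |(t : ℝ)|) := by
      simp only [hgx, hgz] at h1 h4
      linarith
    have h7 : (h * P ^ 3) * (Q * |(a : ℝ)|) ≤ (h * P ^ 3) * (77 * P * |(t : ℝ)|) := by
      calc (h * P ^ 3) * (Q * |(a : ℝ)|) = (P * Q) * (h * P ^ 2 * |(a : ℝ)|) := by ring
        _ ≤ (P * Q) * (7 * (k * Q ^ 2 * |(t : ℝ)|)) := by gcongr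
        _ = (k * Q ^ 3) * (7 * P * |(t : ℝ)|) := by ring
        _ ≤ (11 * (h * P ^ 3)) * (7 * P * |(t : ℝ)|) := by gcongr
        _ = _ := by ring
    exact le_of_mul_le_mul_left h7 (by positivity)
  have q1 := incr a1 t1 ht1 hG1 hx1 p1
  have q2 := incr a2 t2 ht2 hG2 hx2 p2
  set A := h * (3 * (2 * x + h) ^ 2 + h ^ 2) with hA
  set C := k * (3 * (2 * z + k) ^ 2 + k ^ 2) with hC
  have hA0 : k * Q ^ 3 ≤ P * A := by
    have : 12 * P ^ 2 ≤ 3 * (2 * x + h) ^ 2 + h ^ 2 := by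
      have : (2 * P) ^ 2 ≤ (2 * x + h) ^ 2 := by apply pow_le_pow_left₀ <;> linarith
      linarith [sq_nonneg h]
    calc k * Q ^ 3 ≤ 11 * (h * P ^ 3) := s2
      _ ≤ 12 * (h * P ^ 3) := by have : 0 < h * P ^ 3 := by positivity
                                 linarith
      _ = P * (h * (12 * P ^ 2)) := by ring
      _ ≤ P * A := by rw [hA]; gcongr
  have lin : ∀ a t : ℤ, t ≠ 0 → |(t : ℝ)| ≤ G → P ≤ x + a → x + a ≤ 2 * P →
      |((x + a + h) ^ 4 - (x + a) ^ 4) - ((z + t + k) ^ 4 - (z + t) ^ 4)| ≤ L →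
      Q * |(a : ℝ)| ≤ 77 * P * |(t : ℝ)| →
      |A * a - C * t| ≤ 16 * 10 ^ 5 * (k * Q * G ^ 2) + 2 * L := by
    intro a t ht htG hxa hxa' hp hq
    have h1 := comb a t hp
    have haP : |(a : ℝ)| ≤ P := by rw [abs_le]; constructor <;> linarith
    have h2 := abs_quartic_diff_linearize hP.le hh.le hx0.le hxh haP
    have h3 := abs_quartic_diff_linearize hQ0.le hk0.le hz0.le hzk (htG.trans hGQ)
    have h4 : h * P * (a : ℝ) ^ 2 ≤ 53361 * (k * Q * G ^ 2) := by
      have e1 : (Q * |(a : ℝ)|) ^ 2 ≤ (77 * P * G) ^ 2 := by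
        apply pow_le_pow_left₀ (by positivity)
        exact hq.trans (by gcongr)
      have e2 : Q ^ 2 * (h * P * (a : ℝ) ^ 2) ≤ Q ^ 2 * (53361 * (k * Q * G ^ 2)) := by
        calc Q ^ 2 * (h * P * (a : ℝ) ^ 2) = h * P * (Q * |(a : ℝ)|) ^ 2 := by
              rw [mul_pow, sq_abs]; ring
          _ ≤ h * P * (77 * P * G) ^ 2 := by gcongr
          _ = 5929 * G ^ 2 * (h * P ^ 3) := by ring
          _ ≤ 5929 * G ^ 2 * (9 * k * Q ^ 3) := by gcongr
          _ = _ := by ring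
      exact le_of_mul_le_mul_left e2 (by positivity)
    have h5 : k * Q * (t : ℝ) ^ 2 ≤ k * Q * G ^ 2 := by
      rw [← sq_abs (t : ℝ)]; gcongr
    have h6 : 0 < k * Q * G ^ 2 := by positivity
    have e3 : A * a - C * t = (gx a - gz t) - (gx a - A * a) + (gz t - C * t) := by ring
    have h7 := abs_add_le ((gx a - gz t) - (gx a - A * a)) (gz t - C * t)
    have h8 := abs_sub (gx a - gz t) (gx a - A * a)
    rw [e3]
    simp only [hgx, hgz] at *
    linarith
  have l1 := lin a1 t1 ht1 hG1 hx1 hx1' p1 q1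
  have l2 := lin a2 t2 ht2 hG2 hx2 hx2' p2 q2
  -- the three points are collinear
  have hdet : a1 * t2 - a2 * t1 = 0 := by
    by_contra hne
    have h1 := ge1 _ hne
    push_cast at h1
    set Er := 16 * 10 ^ 5 * (k * Q * G ^ 2) + 2 * L with hEr
    have h2 : A * |(a1 : ℝ) * t2 - a2 * t1| ≤ 2 * G * Er := by
      have hA00 : 0 ≤ A := by positivity
      have e0 : A * |(a1 : ℝ) * t2 - a2 * t1| = |A * ((a1 : ℝ) * t2 - a2 * t1)| := by
        rw [abs_mul, abs_of_nonneg hA00]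
      have e : A * ((a1 : ℝ) * t2 - a2 * t1) = (A * a1 - C * t1) * t2 - (A * a2 - C * t2) * t1 := by
        ring
      rw [e0, e]
      refine (abs_sub _ _).trans ?_
      rw [abs_mul, abs_mul]
      have := mul_le_mul l1 hG2 (abs_nonneg _) ((abs_nonneg _).trans l1)
      have := mul_le_mul l2 hG1 (abs_nonneg _) ((abs_nonneg _).trans l1)
      linarith
    have h3 : A ≤ 2 * G * Er := by
      have hA00 : 0 ≤ A := by positivity
      exact (le_mul_of_one_le_right hA00 h1).trans h2
    have h4 : k * Q ^ 3 ≤ P * (2 * G * Er) := hA0.trans (by gcongr)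
    have h5 : P * (2 * G * Er) = 32 * 10 ^ 5 * (P * G ^ 3) * (k * Q) + 4 * P * G * L := by
      rw [hEr]; ring
    have h6 : 8 * 10 ^ 6 * ((P * G ^ 3) * (k * Q)) ≤ k * Q ^ 3 := by
      calc 8 * 10 ^ 6 * ((P * G ^ 3) * (k * Q)) = 8 * 10 ^ 6 * P * G ^ 3 * (k * Q) := by ring
        _ ≤ Q ^ 2 * (k * Q) := by gcongr
        _ = _ := by ring
    have h6' : P * (2 * G * Er) = 32 * 10 ^ 5 * ((P * G ^ 3) * (k * Q)) + 4 * P * G * L := by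
      rw [h5]; ring
    have h7 : 16 * P * G * L ≤ k * Q ^ 3 := hd2.trans (by gcongr)
    have h8 : 0 < k * Q ^ 3 := by positivity
    linarith
  have hdetr : (a1 : ℝ) * t2 = a2 * t1 := by
    have : a1 * t2 = a2 * t1 := by linarith
    exact_mod_cast this
  have ht1r : (t1 : ℝ) ≠ 0 := by exact_mod_cast ht1
  set l : ℝ := a1 / t1 with hl
  have ha1 : (a1 : ℝ) = l * t1 := by rw [hl]; field_simp
  have ha2 : (a2 : ℝ) = l * t2 := by rw [hl]; field_simp; linarith
  have hlb : Q * |l| ≤ 77 * P := by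
    have h1 := ge1 t1 ht1
    have h2 : (Q * |l|) * |(t1 : ℝ)| ≤ (77 * P) * |(t1 : ℝ)| := by
      rw [mul_assoc, ← abs_mul, ← ha1]; exact q1
    exact le_of_mul_le_mul_right h2 (by linarith)
  rw [ha1] at p1
  rw [ha2] at p2
  exact no_collinear_points P Q L G K h k x z l t1 t2 hQ hPQ hL hG hGQ hK hK3 hK2 hk hh hx hz hzk
    s1 hlb ht1 ht2 ht12 hG1 hG2 p0 p1 p2

end

section

lemma card_mul_le_of_increments (S : Finset ℤ) (f : ℤ → ℤ) (m L d : ℤ) (hL : 0 ≤ L) (hd : 0 ≤ d)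
    (hf : ∀ x ∈ S, ∀ y ∈ S, x ≤ y → d * (y - x) ≤ f y - f x) (hw : ∀ x ∈ S, |f x - m| < L) :
    d * #S ≤ d + 2 * L := by
  rcases S.eq_empty_or_nonempty with rfl | hS
  · simp; positivity
  have hsub : S ⊆ Icc (S.min' hS) (S.max' hS) := fun x hx =>
    mem_Icc.2 ⟨S.min'_le x hx, S.le_max' x hx⟩
  have hc := card_le_card hsub
  have hle := S.min'_le_max' hS
  rw [Int.card_Icc] at hc
  have hc' : (#S : ℤ) ≤ S.max' hS + 1 - S.min' hS := by
    zify at hc; rwa [Int.toNat_of_nonneg (by linarith)] at hc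
  have h1 := hf _ (S.min'_mem hS) _ (S.max'_mem hS) hle
  have h2 := abs_lt.1 (hw _ (S.min'_mem hS))
  have h3 := abs_lt.1 (hw _ (S.max'_mem hS))
  nlinarith

/-- The dyadic block `[P, 2P)`. -/
noncomputable def block (P : ℕ) : Finset ℤ := Ico (P : ℤ) (2 * P)

lemma mem_block {P : ℕ} {x : ℤ} : x ∈ block P ↔ (P : ℤ) ≤ x ∧ x < 2 * P := mem_Ico

lemma card_block (P : ℕ) : #(block P) = P := by
  rw [block, Int.card_Ico]; omega

variable {ι : Type*}

/-- Close triples `(x, i, j)` with `(x + h)⁴ - x⁴` near `c j - c i`. -/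
noncomputable def shiftCount (P : ℕ) (s : Finset ι) (c : ι → ℤ) (L : ℕ) (h : ℕ) : ℕ :=
  #{p ∈ block P ×ˢ (s ×ˢ s) | p.1 + (h : ℤ) < 2 * (P : ℤ) ∧
    |((p.1 + (h : ℤ)) ^ 4 - p.1 ^ 4) - (c p.2.2 - c p.2.1)| < (L : ℤ)}

lemma quartic_sub_lower {P x h : ℤ} (hP : 0 ≤ P) (hh : 0 ≤ h) (hx : P ≤ x) :
    4 * h * P ^ 3 ≤ (x + h) ^ 4 - x ^ 4 := by
  have := quartic_diff_lower (P := (P : ℝ)) (h := h) (x := x) (by exact_mod_cast hP)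
    (by exact_mod_cast hh) (by exact_mod_cast hx)
  exact_mod_cast this

lemma quartic_sub_increment {P x h y : ℤ} (hP : 0 ≤ P) (hh : 0 ≤ h) (hx : P ≤ x) (hy : x ≤ y) :
    12 * h * P ^ 2 * (y - x) ≤ ((y + h) ^ 4 - y ^ 4) - ((x + h) ^ 4 - x ^ 4) := by
  have := quartic_diff_increment (P := (P : ℝ)) (h := h) (x := x) (a := y - x)
    (by exact_mod_cast hP) (by exact_mod_cast hh) (by exact_mod_cast hx)
    (sub_nonneg.2 (by exact_mod_cast hy))
  rw [show (x : ℝ) + (y - x) = y by ring] at this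
  exact_mod_cast this

lemma pairCount_block_le (P D L : ℕ) (s : Finset ι) (c : ι → ℤ) (hP : 0 < P)
    (hD : ∀ i ∈ s, ∀ j ∈ s, |c i - c j| + L ≤ 4 * P ^ 3 * (D + 1)) :
    pairCount (block P ×ˢ s) (fun p => p.1 ^ 4 + c p.2) L
      ≤ P * pairCount s c L + 2 * ∑ h ∈ Icc 1 D, shiftCount P s c L h := by
  classical
  set F := {q ∈ (block P ×ˢ s) ×ˢ (block P ×ˢ s) |
    |(q.1.1 ^ 4 + c q.1.2) - (q.2.1 ^ 4 + c q.2.2)| < (L : ℤ)} with hF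
  have e0 : pairCount (block P ×ˢ s) (fun p => p.1 ^ 4 + c p.2) L = #F := rfl
  have hup : #{q ∈ F | q.2.1 < q.1.1} ≤ ∑ h ∈ Icc 1 D, shiftCount P s c L h := by
    have hmap : ∀ q ∈ {q ∈ F | q.2.1 < q.1.1}, (q.1.1 - q.2.1).toNat ∈ Icc 1 D := by
      rintro ⟨⟨x, i⟩, ⟨y, j⟩⟩ hq
      simp only [hF, mem_filter, mem_product, mem_block] at hq
      obtain ⟨⟨⟨⟨⟨hx1, hx2⟩, hi⟩, ⟨hy1, hy2⟩, hj⟩, hlt⟩, hyx⟩ := hq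
      simp only [mem_Icc]
      refine ⟨by omega, ?_⟩
      by_contra hcon
      have hge : (D : ℤ) + 1 ≤ x - y := by omega
      have h1 := quartic_sub_lower (P := P) (x := y) (h := x - y) (by positivity) (by linarith) hy1
      rw [show y + (x - y) = x by ring] at h1
      have h2 := (abs_lt.1 hlt).2
      have h3 := hD i hi j hj
      have h4 := neg_abs_le (c i - c j)
      have h5 : 4 * (P : ℤ) ^ 3 * (D + 1) ≤ 4 * P ^ 3 * (x - y) := by gcongr
      linarith
    rw [card_eq_sum_card_fiberwise hmap]
    refine sum_le_sum fun h hh => ?_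
    rw [shiftCount]
    refine card_le_card_of_injOn (fun q => (q.2.1, (q.1.2, q.2.2))) ?_ ?_
    · rintro ⟨⟨x, i⟩, ⟨y, j⟩⟩ hq
      simp only [hF, coe_filter, mem_filter, mem_product, mem_block, Set.mem_ofPred_eq] at hq ⊢
      obtain ⟨⟨⟨⟨⟨⟨hx1, hx2⟩, hi⟩, ⟨hy1, hy2⟩, hj⟩, hlt⟩, hyx⟩, rfl⟩ := hq
      have e : y + ((x - y).toNat : ℤ) = x := by omega
      rw [e]
      refine ⟨⟨⟨hy1, hy2⟩, hi, hj⟩, hx2, ?_⟩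
      convert hlt using 2; ring
    · rintro ⟨⟨x, i⟩, ⟨y, j⟩⟩ hq ⟨⟨x', i'⟩, ⟨y', j'⟩⟩ hq' he
      simp only [hF, coe_filter, mem_filter, mem_product, mem_block, Set.mem_ofPred_eq,
        Prod.mk.injEq] at hq hq' he ⊢
      obtain ⟨rfl, rfl, rfl⟩ := he
      have := hq.2; have := hq.1.2; have := hq'.2; have := hq'.1.2
      refine ⟨⟨by omega, rfl⟩, rfl, rfl⟩
  have hdown : #{q ∈ F | q.1.1 < q.2.1} = #{q ∈ F | q.2.1 < q.1.1} := by
    refine card_bij' (fun q _ => (q.2, q.1)) (fun q _ => (q.2, q.1)) ?_ ?_ (fun _ _ => rfl)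
      (fun _ _ => rfl)
    all_goals
      rintro ⟨⟨x, i⟩, ⟨y, j⟩⟩ hq
      simp only [hF, mem_filter, mem_product] at hq ⊢
      rw [abs_sub_comm]
      tauto
  have hdiag : #{q ∈ F | q.1.1 = q.2.1} ≤ P * pairCount s c L := by
    rw [← card_block P, pairCount, ← card_product]
    refine card_le_card_of_injOn (fun q => (q.1.1, (q.1.2, q.2.2))) ?_ ?_
    · rintro ⟨⟨x, i⟩, ⟨y, j⟩⟩ hq
      simp only [hF, coe_filter, coe_product, mem_filter, mem_product, Set.mem_ofPred_eq,
        Set.mem_prod, mem_coe] at hq ⊢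
      obtain ⟨⟨⟨⟨hx, hi⟩, hy, hj⟩, hlt⟩, rfl⟩ := hq
      refine ⟨hx, ⟨hi, hj⟩, ?_⟩
      simpa using hlt
    · rintro ⟨⟨x, i⟩, ⟨y, j⟩⟩ hq ⟨⟨x', i'⟩, ⟨y', j'⟩⟩ hq' he
      simp only [coe_filter, Set.mem_ofPred_eq, Prod.mk.injEq] at hq hq' he ⊢
      obtain ⟨rfl, rfl, rfl⟩ := he
      exact ⟨⟨rfl, rfl⟩, hq.2.symm.trans hq'.2, rfl⟩
  have hsplit : F = ({q ∈ F | q.1.1 = q.2.1} ∪ {q ∈ F | q.1.1 < q.2.1})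
      ∪ {q ∈ F | q.2.1 < q.1.1} := by
    ext q
    simp only [mem_union, mem_filter]
    rcases lt_trichotomy q.1.1 q.2.1 with h | h | h <;> tauto
  rw [e0, hsplit]
  refine (card_union_le _ _).trans ?_
  have := card_union_le {q ∈ F | q.1.1 = q.2.1} {q ∈ F | q.1.1 < q.2.1}
  omega

/-- For a fixed pair `(i, j)` the admissible `x` are spaced. -/
lemma shiftCount_mul_le (P L h : ℕ) (s : Finset ι) (c : ι → ℤ) :
    12 * h * P ^ 2 * shiftCount P s c L h ≤ (12 * h * P ^ 2 + 2 * L) * #s ^ 2 := by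
  classical
  rw [shiftCount, card_eq_sum_card_fiberwise (f := fun p => p.2) (t := s ×ˢ s)
    (fun p hp => (mem_product.1 (mem_filter.1 hp).1).2), mul_sum]
  rw [sq (#s), ← card_product, mul_comm (12 * h * P ^ 2 + 2 * L) #(s ×ˢ s), ← smul_eq_mul (#(s ×ˢ s))]
  refine sum_le_card_nsmul _ _ _ fun ij _ => ?_
  set Fi := {p ∈ {p ∈ block P ×ˢ (s ×ˢ s) | p.1 + (h : ℤ) < 2 * (P : ℤ) ∧
    |((p.1 + (h : ℤ)) ^ 4 - p.1 ^ 4) - (c p.2.2 - c p.2.1)| < (L : ℤ)} | p.2 = ij} with hFi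
  have hcard : #(Fi.image Prod.fst) = #Fi := by
    refine card_image_of_injOn fun p hp q hq he => ?_
    simp only [hFi, coe_filter, mem_filter, Set.mem_ofPred_eq] at hp hq
    exact Prod.ext he (hp.2.trans hq.2.symm)
  have := card_mul_le_of_increments (Fi.image Prod.fst) (fun x => (x + h) ^ 4 - x ^ 4)
    (c ij.2 - c ij.1) L (12 * h * P ^ 2) (by positivity) (by positivity) ?_ ?_
  · rw [hcard] at this
    exact_mod_cast this
  · intro x hx y _ hxy
    obtain ⟨p, hp, rfl⟩ := mem_image.1 hx
    simp only [hFi, mem_filter, mem_product, mem_block] at hp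
    exact quartic_sub_increment (by positivity) (by positivity) hp.1.1.1.1 hxy
  · intro x hx
    obtain ⟨p, hp, rfl⟩ := mem_image.1 hx
    simp only [hFi, mem_filter] at hp
    obtain ⟨⟨-, -, hp⟩, rfl⟩ := hp
    exact hp

/-- Counting close pairs at a coarse scale. -/
lemma pairCount_block_le_coarse (P D L : ℕ) (s : Finset ι) (c : ι → ℤ) (hP : 0 < P) (Hm : ℝ)
    (hD : ∀ i ∈ s, ∀ j ∈ s, |c i - c j| + L ≤ 4 * P ^ 3 * (D + 1)) (hDL : D * P ^ 2 ≤ L)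
    (hH : ∑ j ∈ Icc 1 D, 1 / (j : ℝ) ≤ Hm) :
    (P : ℝ) ^ 2 * pairCount (block P ×ˢ s) (fun p => p.1 ^ 4 + c p.2) L
      ≤ P ^ 3 * pairCount s c L + 3 * Hm * L * (#s : ℝ) ^ 2 := by
  have h1 : (pairCount (block P ×ˢ s) (fun p => p.1 ^ 4 + c p.2) L : ℝ)
      ≤ P * pairCount s c L + 2 * ∑ h ∈ Icc 1 D, (shiftCount P s c L h : ℝ) := by
    exact_mod_cast pairCount_block_le P D L s c hP hD
  have h2 : ∑ h ∈ Icc 1 D, (P : ℝ) ^ 2 * (shiftCount P s c L h : ℝ)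
      ≤ ∑ h ∈ Icc 1 D, 3 / 2 * L * (#s : ℝ) ^ 2 * (1 / (h : ℝ)) := by
    refine sum_le_sum fun h hh => ?_
    obtain ⟨hh1, hh2⟩ := mem_Icc.1 hh
    have hh0 : (0 : ℝ) < h := by exact_mod_cast hh1
    have a1 : (12 * h * P ^ 2 * shiftCount P s c L h : ℝ) ≤ (12 * h * P ^ 2 + 2 * L) * #s ^ 2 := by
      exact_mod_cast shiftCount_mul_le P L h s c
    have a2 : (h * P ^ 2 : ℝ) ≤ L := by
      have : h * P ^ 2 ≤ L := (Nat.mul_le_mul_right _ hh2).trans hDL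
      exact_mod_cast this
    have a3 : (12 * h * P ^ 2 + 2 * L : ℝ) * #s ^ 2 ≤ 14 * L * #s ^ 2 := by
      gcongr; linarith
    rw [mul_one_div, le_div_iff₀ hh0]
    have : (0 : ℝ) ≤ L * #s ^ 2 := by positivity
    linarith
  rw [← mul_sum, ← mul_sum] at h2
  have h3 : 3 / 2 * L * (#s : ℝ) ^ 2 * ∑ h ∈ Icc 1 D, 1 / (h : ℝ) ≤ 3 / 2 * L * (#s : ℝ) ^ 2 * Hm := by
    gcongr
  calc (P : ℝ) ^ 2 * pairCount (block P ×ˢ s) (fun p => p.1 ^ 4 + c p.2) L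
      ≤ P ^ 2 * (P * pairCount s c L + 2 * ∑ h ∈ Icc 1 D, (shiftCount P s c L h : ℝ)) := by gcongr
    _ = P ^ 3 * pairCount s c L + 2 * (P ^ 2 * ∑ h ∈ Icc 1 D, (shiftCount P s c L h : ℝ)) := by ring
    _ ≤ _ := by linarith

/-- Counting close pairs at scales beyond the spacing of the leading fourth powers. -/
lemma pairCount_block_le_trivial (P L : ℕ) (s : Finset ι) (c : ι → ℤ) (hL : P ^ 3 ≤ L) :
    P ^ 2 * pairCount (block P ×ˢ s) (fun p => p.1 ^ 4 + c p.2) L ≤ 2 * L * #s ^ 2 := by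
  classical
  rcases Nat.eq_zero_or_pos P with rfl | hP
  · simp
  have key : 4 * P ^ 3 * pairCount (block P ×ˢ s) (fun p => p.1 ^ 4 + c p.2) L
      ≤ (4 * P ^ 3 + 2 * L) * (P * #s ^ 2) := by
    rw [pairCount, card_eq_sum_card_fiberwise (f := fun q => (q.2, q.1.2))
      (t := (block P ×ˢ s) ×ˢ s) (fun q hq => ?_), mul_sum]
    · have : P * #s ^ 2 = #((block P ×ˢ s) ×ˢ s) := by
        rw [card_product, card_product, card_block]; ring
      rw [this, mul_comm (4 * P ^ 3 + 2 * L), ← smul_eq_mul (#((block P ×ˢ s) ×ˢ s))]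
      refine sum_le_card_nsmul _ _ _ fun t _ => ?_
      set Fi := {q ∈ {q ∈ (block P ×ˢ s) ×ˢ (block P ×ˢ s) |
        |(q.1.1 ^ 4 + c q.1.2) - (q.2.1 ^ 4 + c q.2.2)| < (L : ℤ)} | (q.2, q.1.2) = t} with hFi
      have hcard : #(Fi.image fun q => q.1.1) = #Fi := by
        refine card_image_of_injOn fun p hp q hq he => ?_
        simp only [hFi, coe_filter, mem_filter, Set.mem_ofPred_eq] at hp hq
        have := hp.2.trans hq.2.symm
        simp only [Prod.mk.injEq] at this
        exact Prod.ext (Prod.ext he this.2) this.1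
      have := card_mul_le_of_increments (Fi.image fun q => q.1.1) (fun x => x ^ 4)
        (t.1.1 ^ 4 + c t.1.2 - c t.2) L (4 * P ^ 3) (by positivity) (by positivity) ?_ ?_
      · rw [hcard] at this
        exact_mod_cast this
      · intro x hx y _ hxy
        obtain ⟨p, hp, rfl⟩ := mem_image.1 hx
        simp only [hFi, mem_filter, mem_product, mem_block] at hp
        have := quartic_sub_lower (P := P) (x := p.1.1) (h := y - p.1.1) (by positivity)
          (by linarith) hp.1.1.1.1.1
        rw [show p.1.1 + (y - p.1.1) = y by ring] at this
        linarith
      · intro x hx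
        obtain ⟨p, hp, rfl⟩ := mem_image.1 hx
        simp only [hFi, mem_filter] at hp
        obtain ⟨⟨-, hp⟩, rfl⟩ := hp
        convert hp using 2; ring
    · have := (mem_filter.1 hq).1
      simp only [mem_product, coe_product, Set.mem_prod, mem_coe] at this ⊢
      exact ⟨this.2, this.1.2⟩
  have k2 : 4 * P ^ 3 + 2 * L ≤ 8 * L := by omega
  have k3 : (4 * P) * (P ^ 2 * pairCount (block P ×ˢ s) (fun p => p.1 ^ 4 + c p.2) L)
      ≤ (4 * P) * (2 * L * #s ^ 2) := by
    calc _ = 4 * P ^ 3 * pairCount (block P ×ˢ s) (fun p => p.1 ^ 4 + c p.2) L := by ring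
      _ ≤ (4 * P ^ 3 + 2 * L) * (P * #s ^ 2) := key
      _ ≤ (8 * L) * (P * #s ^ 2) := by gcongr
      _ = _ := by ring
  exact Nat.le_of_mul_le_mul_left k3 (by positivity)

end

section

lemma pairCount_quartic_le {Q L : ℕ} (hL : L ≤ Q ^ 3) :
    pairCount (block Q) (fun z => z ^ 4) L ≤ Q := by
  rw [pairCount]
  calc _ ≤ #(block Q) := by
        refine card_le_card_of_injOn (fun q => q.1) ?_ ?_
        · rintro ⟨z, w⟩ hq
          simp only [coe_filter, mem_product, Set.mem_ofPred_eq] at hq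
          exact hq.1.1
        · have key : ∀ z w : ℤ, z ∈ block Q → w ∈ block Q → |z ^ 4 - w ^ 4| < (L : ℤ) → z = w := by
            have main : ∀ z w : ℤ, z ∈ block Q → w ∈ block Q → z ^ 4 - w ^ 4 < (L : ℤ) → ¬ w < z := by
              intro z w hz hw hlt hwz
              have h1 := quartic_sub_lower (P := Q) (x := w) (h := z - w) (by positivity)
                (by linarith) (mem_block.1 hw).1
              rw [show w + (z - w) = z by ring] at h1
              have h2 : (L : ℤ) ≤ Q ^ 3 := by exact_mod_cast hL
              have h3 : 4 * 1 * (Q : ℤ) ^ 3 ≤ 4 * (z - w) * Q ^ 3 := by gcongr; linarith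
              have h4 : (0 : ℤ) ≤ Q ^ 3 := by positivity
              linarith
            intro z w hz hw hlt
            have h1 := main z w hz hw (abs_lt.1 hlt).2
            have h2 := main w z hw hz (by linarith [(abs_lt.1 hlt).1])
            omega
          rintro ⟨z, w⟩ hq ⟨z', w'⟩ hq' he
          simp only [coe_filter, mem_product, Set.mem_ofPred_eq] at hq hq' he
          subst he
          have a1 := key _ _ hq.1.1 hq.1.2 hq.2
          have a2 := key _ _ hq'.1.1 hq'.1.2 hq'.2
          rw [← a1, ← a2]
    _ = Q := card_block Q

lemma abs_pow_four_sub_le {Q : ℕ} {z w : ℤ} (hz : z ∈ block Q) (hw : w ∈ block Q) :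
    |z ^ 4 - w ^ 4| ≤ 15 * Q ^ 4 := by
  have key : ∀ z ∈ block Q, (Q : ℤ) ^ 4 ≤ z ^ 4 ∧ z ^ 4 ≤ 16 * Q ^ 4 := by
    intro z hz
    obtain ⟨h1, h2⟩ := mem_block.1 hz
    refine ⟨by gcongr, ?_⟩
    calc z ^ 4 ≤ (2 * (Q : ℤ)) ^ 4 := pow_le_pow_left₀ (by omega) h2.le 4
      _ = _ := by ring
  have h1 := key z hz
  have h2 := key w hw
  rw [abs_le]; constructor <;> linarith

section Bottom
variable {P Q L h : ℕ} {x z w : ℤ}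

lemma shift_size (hQ : 1 ≤ Q) (hPQ : 100 * Q ≤ P) (hL : L ≤ Q ^ 3) (hh : 1 ≤ h) (hx : x ∈ block P)
    (hz : z ∈ block Q) (hw : w ∈ block Q)
    (hlt : |((x + h) ^ 4 - x ^ 4) - (w ^ 4 - z ^ 4)| < (L : ℤ)) :
    z < w ∧ (h : ℤ) * P ^ 3 ≤ 9 * (w - z) * Q ^ 3 := by
  obtain ⟨hx1, hx2⟩ := mem_block.1 hx
  obtain ⟨hz1, hz2⟩ := mem_block.1 hz
  obtain ⟨hw1, hw2⟩ := mem_block.1 hw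
  have h1 := quartic_sub_lower (P := P) (x := x) (h := h) (by positivity) (by positivity) hx1
  have h2 := (abs_lt.1 hlt).2
  have h3 : (L : ℤ) ≤ Q ^ 3 := by exact_mod_cast hL
  have hQ0 : (0 : ℤ) < Q ^ 3 := by positivity
  have h4 : (Q : ℤ) ^ 3 ≤ P ^ 3 := by gcongr; omega
  have h5 : 4 * 1 * (P : ℤ) ^ 3 ≤ 4 * h * P ^ 3 := by gcongr; omega
  have hzw : z < w := by
    by_contra hcon
    have : w ^ 4 ≤ z ^ 4 := pow_le_pow_left₀ (by omega) (by omega) 4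
    linarith
  refine ⟨hzw, ?_⟩
  have h6 : w ^ 4 - z ^ 4 ≤ 32 * (w - z) * Q ^ 3 := by
    have := quartic_diff_upper (P := (Q : ℝ)) (h := ((w - z : ℤ) : ℝ)) (x := z)
      (by exact_mod_cast (by omega : (0 : ℤ) ≤ w - z)) (by exact_mod_cast (by omega : (0 : ℤ) ≤ z))
      (by exact_mod_cast (by omega : z + (w - z) ≤ 2 * (Q : ℤ)))
    rw [show (z : ℝ) + ((w - z : ℤ) : ℝ) = w by push_cast; ring] at this
    exact_mod_cast this
  have h7 : 1 * (Q : ℤ) ^ 3 ≤ (w - z) * Q ^ 3 := by gcongr; omega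
  linarith

lemma shift_unique (hPL : L ≤ P ^ 2) (hP : 0 < P) (hh : 1 ≤ h) {x y : ℤ} (hx : x ∈ block P)
    (hy : y ∈ block P) {m : ℤ} (h1 : |((x + h) ^ 4 - x ^ 4) - m| < (L : ℤ))
    (h2 : |((y + h) ^ 4 - y ^ 4) - m| < (L : ℤ)) : x = y := by
  have main : ∀ x y : ℤ, x ∈ block P → |((x + h) ^ 4 - x ^ 4) - m| < (L : ℤ) →
      |((y + h) ^ 4 - y ^ 4) - m| < (L : ℤ) → ¬ x < y := by
    intro x y hx h1 h2 hxy
    have a1 := quartic_sub_increment (P := P) (h := h) (by positivity) (by positivity)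
      (mem_block.1 hx).1 hxy.le
    have a2 : 12 * (1 : ℤ) * P ^ 2 * 1 ≤ 12 * h * P ^ 2 * (y - x) := by
      gcongr <;> omega
    have a3 : (L : ℤ) ≤ P ^ 2 := by exact_mod_cast hPL
    have a4 := (abs_lt.1 h1).1
    have a5 := (abs_lt.1 h2).2
    have a6 : (0 : ℤ) < P ^ 2 := by positivity
    linarith
  have b1 := main x y hx h1 h2
  have b2 := main y x hy h2 h1
  omega

end Bottom

/-- A sharp count of close pairs among sums of two fourth powers. -/
lemma pairCount_two_quartics_le (P Q L D K H G W : ℕ) (hQ : 1 ≤ Q) (hPQ : 100 * Q ≤ P)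
    (hQW : Q = G * W) (hLQ : L ≤ Q ^ 3) (hLP : L ≤ P ^ 2)
    (hD : 15 * Q ^ 4 + L ≤ 4 * P ^ 3 * (D + 1)) (hH : 9 * K * Q ^ 3 ≤ H * P ^ 3) (hHK : H * K ≤ P)
    (hDW : D * W ≤ P) (hG : 1 ≤ G) (hGQ : G ≤ Q) (hK : 1 ≤ K)
    (hLK : L ≤ K * Q ^ 2) (hd1 : 8 * 10 ^ 6 * P * G ^ 3 ≤ Q ^ 2) (hd2 : 16 * P * G * L ≤ K * Q ^ 3)
    (hK3 : 10 ^ 5 * L * Q ≤ K ^ 3) (hK2 : 10 ^ 12 * G * Q ≤ K ^ 2) :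
    pairCount (block P ×ˢ block Q) (fun p => p.1 ^ 4 + p.2 ^ 4) L ≤ 7 * (P * Q) := by
  classical
  have hP : 0 < P := by omega
  refine (pairCount_block_le P D L (block Q) (fun z => z ^ 4) hP ?_).trans ?_
  · intro i hi j hj
    have := abs_pow_four_sub_le hi hj
    have hD' : 15 * (Q : ℤ) ^ 4 + L ≤ 4 * P ^ 3 * (D + 1) := by exact_mod_cast hD
    linarith
  have hdiag := pairCount_quartic_le hLQ
  set S : (h : ℕ) → Finset (ℤ × ℤ × ℤ) := fun h =>
    {p ∈ block P ×ˢ (block Q ×ˢ block Q) | p.1 + (h : ℤ) < 2 * (P : ℤ) ∧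
    |((p.1 + (h : ℤ)) ^ 4 - p.1 ^ 4) - (p.2.2 ^ 4 - p.2.1 ^ 4)| < (L : ℤ)} with hS
  set T := (Icc 1 D).sigma S with hT
  have hsum : ∑ h ∈ Icc 1 D, shiftCount P (block Q) (fun z => z ^ 4) L h = #T := by
    rw [hT, card_sigma]; rfl
  have memT : ∀ q ∈ T, 1 ≤ q.1 ∧ q.1 ≤ D ∧ q.2.1 ∈ block P ∧ q.2.2.1 ∈ block Q ∧
      q.2.2.2 ∈ block Q ∧ q.2.1 + (q.1 : ℤ) < 2 * P ∧
      |((q.2.1 + (q.1 : ℤ)) ^ 4 - q.2.1 ^ 4) - (q.2.2.2 ^ 4 - q.2.2.1 ^ 4)| < (L : ℤ) := by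
    rintro ⟨h, x, z, w⟩ hq
    simp only [hT, hS, mem_sigma, mem_Icc, mem_filter, mem_product] at hq
    tauto
  have uniqT : ∀ q ∈ T, ∀ q' ∈ T, q.1 = q'.1 → q.2.2.2 - q.2.2.1 = q'.2.2.2 - q'.2.2.1 →
      q.2.2.1 = q'.2.2.1 → q = q' := by
    rintro ⟨h, x, z, w⟩ hq ⟨h', x', z', w'⟩ hq' e1 e2 e3
    dsimp only at e1 e2 e3
    subst e1 e3
    have e4 : w = w' := by linarith
    subst e4
    obtain ⟨b1, b2, b3, b4, b5, b6, b7⟩ := memT _ hq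
    obtain ⟨-, -, c3, c4, c5, c6, c7⟩ := memT _ hq'
    have e : x = x' := shift_unique hLP hP b1 b3 c3 b7 c7
    rw [e]
  have hT1 : #{q ∈ T | q.2.2.2 - q.2.2.1 < (K : ℤ)} ≤ P * Q := by
    calc #{q ∈ T | q.2.2.2 - q.2.2.1 < (K : ℤ)}
        ≤ #(Icc 1 H ×ˢ (Ico (0 : ℤ) K ×ˢ block Q)) := by
          refine card_le_card_of_injOn (fun q => (q.1, (q.2.2.2 - q.2.2.1, q.2.2.1))) ?_ ?_
          · intro q hq
            simp only [coe_filter, Set.mem_ofPred_eq] at hq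
            obtain ⟨b1, b2, b3, b4, b5, b6, b7⟩ := memT _ hq.1
            obtain ⟨s1, s2⟩ := shift_size hQ hPQ hLQ b1 b3 b4 b5 b7
            simp only [coe_product, Set.mem_prod, mem_coe, mem_Icc, mem_Ico]
            refine ⟨⟨b1, ?_⟩, ⟨by linarith, hq.2⟩, b4⟩
            have hH' : 9 * (K : ℤ) * Q ^ 3 ≤ H * P ^ 3 := by exact_mod_cast hH
            have s3 : 9 * (q.2.2.2 - q.2.2.1) * (Q : ℤ) ^ 3 ≤ 9 * K * Q ^ 3 := by
              gcongr; exact hq.2.le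
            have s4 : (q.1 : ℤ) * P ^ 3 ≤ H * P ^ 3 := by linarith
            exact_mod_cast le_of_mul_le_mul_right s4 (by positivity)
          · intro q hq q' hq' he
            simp only [coe_filter, Set.mem_ofPred_eq, Prod.mk.injEq] at hq hq' he
            exact uniqT q hq.1 q' hq'.1 he.1 he.2.1 he.2.2
      _ = H * K * Q := by
          rw [card_product, card_product, card_block, Nat.card_Icc, Int.card_Ico]
          simp [mul_assoc]
      _ ≤ P * Q := by gcongr
  have hT2 : #{q ∈ T | ¬ q.2.2.2 - q.2.2.1 < (K : ℤ)} ≤ 2 * (P * Q) := by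
    have hG0 : (0 : ℤ) < G := by exact_mod_cast hG
    have hQW' : (Q : ℤ) = G * W := by exact_mod_cast hQW
    calc #{q ∈ T | ¬ q.2.2.2 - q.2.2.1 < (K : ℤ)}
        ≤ 2 * #(Icc 1 D ×ˢ (Ico (0 : ℤ) Q ×ˢ block W)) := by
          refine card_le_mul_card_image_of_maps_to
            (f := fun q => (q.1, (q.2.2.2 - q.2.2.1, q.2.2.1 / (G : ℤ)))) ?_ 2 ?_
          · intro q hq
            obtain ⟨hq, hk⟩ := mem_filter.1 hq
            obtain ⟨b1, b2, b3, b4, b5, b6, b7⟩ := memT _ hq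
            obtain ⟨s1, s2⟩ := shift_size hQ hPQ hLQ b1 b3 b4 b5 b7
            obtain ⟨z1, z2⟩ := mem_block.1 b4
            obtain ⟨w1, w2⟩ := mem_block.1 b5
            simp only [mem_product, mem_Icc, mem_Ico, mem_block]
            refine ⟨⟨b1, b2⟩, ⟨by omega, by omega⟩, ?_, ?_⟩
            · rw [Int.le_ediv_iff_mul_le hG0]; linarith
            · rw [Int.ediv_lt_iff_lt_mul hG0]; linarith
          · intro t _
            by_contra hcon
            rw [not_le, two_lt_card] at hcon
            obtain ⟨q0, h0, q1, h1, q2, h2, n01, n02, n12⟩ := hcon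
            simp only [mem_filter] at h0 h1 h2
            obtain ⟨⟨m0, k0⟩, t0⟩ := h0
            obtain ⟨⟨m1, k1⟩, t1⟩ := h1
            obtain ⟨⟨m2, k2⟩, t2⟩ := h2
            have e1 := t1.trans t0.symm
            have e2 := t2.trans t0.symm
            have e12 := t1.trans t2.symm
            simp only [Prod.mk.injEq] at e1 e2 e12
            have d1 : q1.2.2.1 - q0.2.2.1 ≠ 0 := fun hd => n01
              (uniqT q1 m1 q0 m0 e1.1 e1.2.1 (by linarith)).symm
            have d2 : q2.2.2.1 - q0.2.2.1 ≠ 0 := fun hd => n02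
              (uniqT q2 m2 q0 m0 e2.1 e2.2.1 (by linarith)).symm
            have d12 : q1.2.2.1 - q0.2.2.1 ≠ q2.2.2.1 - q0.2.2.1 := fun hd => n12
              (uniqT q1 m1 q2 m2 e12.1 e12.2.1 (by linarith))
            have close : ∀ a b : ℤ, a / (G : ℤ) = b / (G : ℤ) → |((a - b : ℤ) : ℝ)| ≤ G := by
              intro a b hab
              have h1 := Int.emod_add_mul_ediv a G
              have h2 := Int.emod_add_mul_ediv b G
              have h3 := Int.emod_nonneg a hG0.ne'
              have h4 := Int.emod_nonneg b hG0.ne'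
              have h5 := Int.emod_lt_of_pos a hG0
              have h6 := Int.emod_lt_of_pos b hG0
              rw [hab] at h1
              have : |a - b| ≤ G := by rw [abs_le]; constructor <;> linarith
              exact_mod_cast this
            obtain ⟨a1, a2, a3, a4, a5, a6, a7⟩ := memT _ m0
            obtain ⟨b1, b2, b3, b4, b5, b6, b7⟩ := memT _ m1
            obtain ⟨c1, c2, c3, c4, c5, c6, c7⟩ := memT _ m2
            obtain ⟨x1, x2⟩ := mem_block.1 a3
            obtain ⟨y1, y2⟩ := mem_block.1 b3
            obtain ⟨u1, u2⟩ := mem_block.1 c3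
            obtain ⟨z1, z2⟩ := mem_block.1 a4
            obtain ⟨w1, w2⟩ := mem_block.1 a5
            have cast3 : ∀ q ∈ T, q.1 = q0.1 → q.2.2.2 - q.2.2.1 = q0.2.2.2 - q0.2.2.1 →
                |(((q0.2.1 : ℝ) + ((q.2.1 - q0.2.1 : ℤ) : ℝ) + q0.1) ^ 4
                  - ((q0.2.1 : ℝ) + ((q.2.1 - q0.2.1 : ℤ) : ℝ)) ^ 4)
                  - (((q0.2.2.1 : ℝ) + ((q.2.2.1 - q0.2.2.1 : ℤ) : ℝ)
                    + ((q0.2.2.2 - q0.2.2.1 : ℤ) : ℝ)) ^ 4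
                  - ((q0.2.2.1 : ℝ) + ((q.2.2.1 - q0.2.2.1 : ℤ) : ℝ)) ^ 4)| ≤ L := by
              intro q hq e f
              obtain ⟨-, -, -, -, -, -, h7⟩ := memT _ hq
              rw [e] at h7
              have f' : q.2.2.2 = q0.2.2.1 + (q.2.2.1 - q0.2.2.1) + (q0.2.2.2 - q0.2.2.1) := by
                linarith
              rw [f'] at h7
              have h8 : (q.2.1 : ℝ) = q0.2.1 + ((q.2.1 - q0.2.1 : ℤ) : ℝ) := by push_cast; ring
              have h9 : (q.2.2.1 : ℝ) = q0.2.2.1 + ((q.2.2.1 - q0.2.2.1 : ℤ) : ℝ) := by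
                push_cast; ring
              rw [← h8, ← h9]
              have h7' := h7.le
              rw [show q0.2.2.1 + (q.2.2.1 - q0.2.2.1) + (q0.2.2.2 - q0.2.2.1)
                = q.2.2.1 + (q0.2.2.2 - q0.2.2.1) by ring] at h7'
              exact_mod_cast h7'
            refine no_three_points_in_window P Q L G K q0.1 ((q0.2.2.2 - q0.2.2.1 : ℤ) : ℝ)
              q0.2.1 q0.2.2.1 (q1.2.1 - q0.2.1) (q2.2.1 - q0.2.1) (q1.2.2.1 - q0.2.2.1)
              (q2.2.2.1 - q0.2.2.1) (by exact_mod_cast hQ) (by exact_mod_cast hPQ) (by positivity)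
              (by exact_mod_cast hG) (by exact_mod_cast hGQ) (by exact_mod_cast hK)
              (by exact_mod_cast hLK) (by exact_mod_cast hd1) (by exact_mod_cast hd2)
              (by exact_mod_cast hK3) (by exact_mod_cast hK2) ?_ ?_ ?_ ?_ ?_ ?_ ?_ ?_ ?_ ?_ d1 d2
              d12 (close _ _ e1.2.2) (close _ _ e2.2.2) ?_ (cast3 q1 m1 e1.1 e1.2.1)
              (cast3 q2 m2 e2.1 e2.2.1)
            · exact_mod_cast not_lt.1 k0
            · exact_mod_cast a1
            · exact_mod_cast x1
            · exact_mod_cast a6.le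
            · exact_mod_cast z1
            · exact_mod_cast (by omega : q0.2.2.1 + (q0.2.2.2 - q0.2.2.1) ≤ 2 * (Q : ℤ))
            · exact_mod_cast (by omega : (P : ℤ) ≤ q0.2.1 + (q1.2.1 - q0.2.1))
            · exact_mod_cast (by omega : q0.2.1 + (q1.2.1 - q0.2.1) ≤ 2 * (P : ℤ))
            · exact_mod_cast (by omega : (P : ℤ) ≤ q0.2.1 + (q2.2.1 - q0.2.1))
            · exact_mod_cast (by omega : q0.2.1 + (q2.2.1 - q0.2.1) ≤ 2 * (P : ℤ))
            · have := cast3 q0 m0 rfl rfl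
              simpa using this
      _ = 2 * (D * W * Q) := by
          rw [card_product, card_product, card_block, Nat.card_Icc, Int.card_Ico]
          simp only [add_tsub_cancel_right, sub_zero, Int.toNat_natCast]
          ring
      _ ≤ 2 * (P * Q) := by gcongr
  have hsplit := card_filter_add_card_filter_not (s := T) (fun q => q.2.2.2 - q.2.2.1 < (K : ℤ))
  rw [hsum]
  have hd' : P * pairCount (block Q) (fun z => z ^ 4) L ≤ P * Q := by gcongr
  omega

end

section

lemma weyl_medium (a b : ℤ) (X D τ J : ℕ) (hX : 0 < X) (hD : 0 < D) (hab : b - a ≤ X)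
    (hτ : ∀ n ∈ Icc 1 (D * X ^ 2), (n.divisors.card) ^ 2 ≤ τ) (Hm U : ℝ)
    (hH : ∑ j ∈ Icc 1 (D * X ^ 2), (1 / (j : ℝ)) ≤ Hm) (hJ : J ≤ D * X ^ 2)
    (hU0 : 0 ≤ U) (hU : 8000 * τ * Hm * D ^ 4 * X ^ 3 ≤ U ^ 4) (α : ℝ) (h1 : |α| * X ≤ 1)
    (h2 : 1 ≤ 8 * J * |α|) :
    ∑ h ∈ Icc 1 D, ‖expSum (Ico a b) (fun x : ℤ => (x + h) ^ 4 - x ^ 4) α‖ ≤ U := by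
  have hα : α ≠ 0 := by
    rintro rfl
    norm_num at h2
  have hα' : 0 < |α| := abs_pos.2 hα
  have hw := weyl_differenced a b X D τ hX hD hab hτ Hm hH α hα
  have hDX : (0 : ℝ) < D * X ^ 2 := by positivity
  have h3 : 1 / (|α| * (D * X ^ 2)) ≤ 8 := by
    rw [div_le_iff₀ (by positivity)]
    have : (J : ℝ) ≤ D * X ^ 2 := by exact_mod_cast hJ
    calc (1 : ℝ) ≤ 8 * J * |α| := h2
      _ ≤ 8 * (D * X ^ 2) * |α| := by gcongr
      _ = _ := by ring
  have hHm : 0 ≤ Hm := le_trans (sum_nonneg fun _ _ => by positivity) hH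
  refine le_of_pow_le_pow_left₀ (n := 4) (by norm_num) hU0 (hw.trans (le_trans ?_ hU))
  calc 800 * τ * Hm * D ^ 4 * X ^ 3 * (1 + |α| * X + 1 / (|α| * (D * X ^ 2)))
      ≤ 800 * τ * Hm * D ^ 4 * X ^ 3 * 10 := by gcongr; linarith
    _ = _ := by ring

variable {ι : Type*}

lemma norm_expSum_shift (P h : ℕ) (s : Finset ι) (c : ι → ℤ) (α : ℝ) :
    ‖expSum (block P ×ˢ (s ×ˢ s))
      (fun p => ((p.1 + (h : ℤ)) ^ 4 - p.1 ^ 4) + (c p.2.1 + -c p.2.2)) α‖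
      = ‖expSum (block P) (fun x => (x + (h : ℤ)) ^ 4 - x ^ 4) α‖ * ‖expSum s c α‖ ^ 2 := by
  rw [expSum_prod (block P) (s ×ˢ s) (fun x => (x + (h : ℤ)) ^ 4 - x ^ 4)
    (fun p => c p.1 + -c p.2), expSum_prod s s c (fun i => -c i), expSum_neg_fun, norm_mul, norm_mul,
    RCLike.norm_conj, sq]

/-- Differenced close pairs, controlled by the close pairs of the summand at two scales. -/
lemma sum_shiftCount_le (P D L J τ : ℕ) (s : Finset ι) (c : ι → ℤ) (hc : ∀ i ∈ s, 0 ≤ c i)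
    (hP : 0 < P) (hD : 0 < D) (hL : 0 < L) (hPL : P ≤ L) (hLJ : L ≤ J) (hJ : J ≤ D * P ^ 2)
    (hτ : ∀ n ∈ Icc 1 (D * P ^ 2), (n.divisors.card) ^ 2 ≤ τ) (Hm U : ℝ)
    (hH : ∑ j ∈ Icc 1 (D * P ^ 2), (1 / (j : ℝ)) ≤ Hm)
    (hU0 : 0 ≤ U) (hU : 8000 * τ * Hm * D ^ 4 * P ^ 3 ≤ U ^ 4) :
    (∑ h ∈ Icc 1 D, shiftCount P s c L h : ℝ)
      ≤ 128 * (L * (D * P) * pairCount s c J / J + U * pairCount s c L) := by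
  classical
  obtain ⟨B, hB⟩ : ∃ B : ℕ, ∀ i ∈ s, c i ≤ B := by
    refine ⟨∑ i ∈ s, (c i).toNat, fun i hi => ?_⟩
    have : (c i).toNat ≤ ∑ i ∈ s, (c i).toNat :=
      single_le_sum (f := fun i => (c i).toNat) (fun _ _ => Nat.zero_le _) hi
    have := hc i hi
    omega
  have hJ0 : 0 < J := by omega
  set M := B + J with hM
  set R := 4 * L * M with hR
  have hM0 : 0 < M := by omega
  have hR0 : 0 < R := by positivity
  have hMR : M ≤ R := by rw [hR]; nlinarith
  have hrange : ∀ J' : ℕ, J' ≤ J → ∀ i ∈ s, 0 ≤ c i ∧ c i + J' ≤ 2 * R := by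
    intro J' hJ' i hi
    refine ⟨hc i hi, ?_⟩
    have := hB i hi
    have : (M : ℤ) ≤ R := by exact_mod_cast hMR
    have : (M : ℤ) = B + J := by rw [hM]; push_cast; ring
    omega
  have e1 := sum_norm_sq_expSum_le s c R J hR0 hJ0 (hrange J le_rfl)
  have e2 := sum_norm_sq_expSum_le s c R L hR0 hL (hrange L hLJ)
  set g : ℤ → ℝ := fun k => ‖expSum s c ((k : ℝ) / (2 * R))‖ ^ 2 with hg
  set V : ℤ → ℝ := fun k =>
    ∑ h ∈ Icc 1 D, ‖expSum (block P) (fun x => (x + (h : ℤ)) ^ 4 - x ^ 4) ((k : ℝ) / (2 * R))‖ with hV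
  have hg0 : ∀ k, 0 ≤ g k := fun k => by positivity
  -- passage to exponential sums
  have s1 : (M : ℝ) * ∑ h ∈ Icc 1 D, (shiftCount P s c L h : ℝ)
      ≤ 4 * ∑ k ∈ Ioo (-M : ℤ) M, V k * g k := by
    rw [mul_sum]
    have : ∀ h ∈ Icc 1 D, (M : ℝ) * shiftCount P s c L h ≤ 4 * ∑ k ∈ Ioo (-M : ℤ) M,
        ‖expSum (block P) (fun x => (x + (h : ℤ)) ^ 4 - x ^ 4) ((k : ℝ) / (2 * R))‖ * g k := by
      intro h _
      have h1 := card_small_le_sum_norm_expSum (block P ×ˢ (s ×ˢ s))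
        (fun p => ((p.1 + (h : ℤ)) ^ 4 - p.1 ^ 4) + (c p.2.1 + -c p.2.2)) R M hR0 hM0
      simp only [norm_expSum_shift] at h1
      refine le_trans ?_ h1
      gcongr
      rw [shiftCount]
      refine card_le_card fun p hp => ?_
      rw [mem_filter] at hp ⊢
      refine ⟨hp.1, ?_⟩
      have h2 := hp.2.2
      rw [hR]
      push_cast
      have h3 : |((p.1 + (h : ℤ)) ^ 4 - p.1 ^ 4) + (c p.2.1 + -c p.2.2)| ≤ L := by
        refine le_trans (le_of_eq ?_) h2.le
        congr 1; ring
      calc 4 * (M : ℤ) * |((p.1 + (h : ℤ)) ^ 4 - p.1 ^ 4) + (c p.2.1 + -c p.2.2)|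
          ≤ 4 * M * L := by gcongr
        _ = _ := by ring
    refine (sum_le_sum this).trans (le_of_eq ?_)
    rw [← mul_sum, sum_comm]
    congr 1
    refine sum_congr rfl fun k _ => ?_
    rw [hV, sum_mul]
  have hVtriv : ∀ k, V k ≤ D * P := by
    intro k
    calc V k ≤ ∑ h ∈ Icc 1 D, (P : ℝ) := by
          refine sum_le_sum fun h _ => ?_
          refine (norm_expSum_le _ _ _).trans (le_of_eq ?_)
          rw [card_block]
      _ = D * P := by simp
  have hR' : (0 : ℝ) < R := by exact_mod_cast hR0
  have hVmed : ∀ k ∈ Ioo (-M : ℤ) M, ¬ 4 * (J : ℤ) * |k| ≤ R → V k ≤ U := by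
    intro k hk hkJ
    refine weyl_medium P (2 * P) P D τ J hP hD (by linarith) hτ Hm U hH hJ hU0 hU _ ?_ ?_
    · rw [abs_div, abs_of_pos (by positivity : (0 : ℝ) < 2 * R), div_mul_eq_mul_div,
        div_le_one (by positivity)]
      have h1 : |k| ≤ M := by
        rw [mem_Ioo] at hk; rw [abs_le]; constructor <;> linarith
      have h2 : (|(k : ℝ)|) ≤ M := by exact_mod_cast h1
      have h3 : (P : ℝ) ≤ L := by exact_mod_cast hPL
      calc |(k : ℝ)| * P ≤ M * L := by gcongr
        _ ≤ 2 * R := by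
          rw [hR]; push_cast
          have : (0 : ℝ) ≤ M * L := by positivity
          linarith
    · rw [abs_div, abs_of_pos (by positivity : (0 : ℝ) < 2 * R), mul_div_assoc',
        le_div_iff₀ (by positivity)]
      have : (R : ℝ) ≤ 4 * J * |(k : ℝ)| := by exact_mod_cast (not_le.1 hkJ).le
      linarith
  have s2 : ∑ k ∈ Ioo (-M : ℤ) M, V k * g k
      ≤ D * P * ∑ k ∈ Ico (-R : ℤ) R with 4 * (J : ℤ) * |k| ≤ R, g k
        + U * ∑ k ∈ Ico (-R : ℤ) R with 4 * (L : ℤ) * |k| ≤ R, g k := by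
    rw [← sum_filter_add_sum_filter_not (Ioo (-M : ℤ) M) (fun k => 4 * (J : ℤ) * |k| ≤ R)]
    have hMR' : (M : ℤ) ≤ R := by exact_mod_cast hMR
    refine add_le_add ?_ ?_
    · rw [mul_sum]
      refine (sum_le_sum fun k _ => mul_le_mul_of_nonneg_right (hVtriv k) (hg0 k)).trans ?_
      refine sum_le_sum_of_subset_of_nonneg (fun k hk => ?_) fun k _ _ => by positivity
      rw [mem_filter, mem_Ioo] at hk
      rw [mem_filter, mem_Ico]
      exact ⟨⟨by linarith, by linarith⟩, hk.2⟩
    · rw [mul_sum]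
      refine (sum_le_sum fun k hk => mul_le_mul_of_nonneg_right
        (hVmed k (mem_filter.1 hk).1 (mem_filter.1 hk).2) (hg0 k)).trans ?_
      refine sum_le_sum_of_subset_of_nonneg (fun k hk => ?_) fun k _ _ => by positivity
      rw [mem_filter, mem_Ioo] at hk
      rw [mem_filter, mem_Ico]
      refine ⟨⟨by linarith, by linarith⟩, ?_⟩
      have : |k| ≤ M := by rw [abs_le]; constructor <;> linarith
      rw [hR]; push_cast
      nlinarith
  have hJ' : (0 : ℝ) < J := by exact_mod_cast hJ0
  have hL' : (0 : ℝ) < L := by exact_mod_cast hL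
  have t1 : ∑ k ∈ Ico (-R : ℤ) R with 4 * (J : ℤ) * |k| ≤ R, g k ≤ 8 * R * pairCount s c J / J := by
    rw [le_div_iff₀ hJ', mul_comm]; exact e1
  have t2 : ∑ k ∈ Ico (-R : ℤ) R with 4 * (L : ℤ) * |k| ≤ R, g k ≤ 8 * R * pairCount s c L / L := by
    rw [le_div_iff₀ hL', mul_comm]; exact e2
  have hM' : (0 : ℝ) < M := by exact_mod_cast hM0
  refine le_of_mul_le_mul_left ?_ hM'
  calc (M : ℝ) * ∑ h ∈ Icc 1 D, (shiftCount P s c L h : ℝ)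
      ≤ 4 * (D * P * (8 * R * pairCount s c J / J) + U * (8 * R * pairCount s c L / L)) := by
        refine s1.trans ?_
        gcongr
        refine s2.trans ?_
        gcongr
    _ = M * (128 * (L * (D * P) * pairCount s c J / J + U * pairCount s c L)) := by
        rw [hR]; push_cast
        field_simp
        ring

end

lemma const_mul_pow_le {C T a b : ℕ} (hC : C ≤ T) (h : a + 1 ≤ b) (hT : 1 ≤ T) :
    C * T ^ a ≤ T ^ b :=
  calc C * T ^ a ≤ T * T ^ a := by gcongr
    _ = T ^ (a + 1) := by ring
    _ ≤ T ^ b := Nat.pow_le_pow_right hT h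

lemma pairCount_pair_fine {T k₃ k₄ l d κ η g : ℕ} (hT : 10 ^ 13 ≤ T) (h34 : k₄ + 1 ≤ k₃)
    (hg : g ≤ k₄) (hlQ : l ≤ 3 * k₄) (hlP : l ≤ 2 * k₃) (hd : 4 * k₄ + 1 ≤ 3 * k₃ + d)
    (hη : κ + 3 * k₄ + 1 ≤ η + 3 * k₃) (hηκ : η + κ ≤ k₃) (hdg : d + k₄ ≤ k₃ + g)
    (hlκ : l ≤ κ + 2 * k₄) (h3g : k₃ + 3 * g + 1 ≤ 2 * k₄) (hgl : k₃ + g + l + 1 ≤ κ + 3 * k₄)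
    (hκ3 : l + k₄ + 1 ≤ 3 * κ) (hκ2 : g + k₄ + 1 ≤ 2 * κ) :
    pairCount (block (T ^ k₃) ×ˢ block (T ^ k₄)) (fun p => p.1 ^ 4 + p.2 ^ 4) (T ^ l)
      ≤ 7 * (T ^ k₃ * T ^ k₄) := by
  have hT1 : 1 ≤ T := by omega
  have key : ∀ {a b : ℕ} (C : ℕ), C ≤ T → a + 1 ≤ b → C * T ^ a ≤ T ^ b :=
    fun C hC h => const_mul_pow_le hC h hT1
  have mono : ∀ {a b : ℕ}, a ≤ b → T ^ a ≤ T ^ b := fun h => Nat.pow_le_pow_right hT1 h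
  refine pairCount_two_quartics_le (T ^ k₃) (T ^ k₄) (T ^ l) (T ^ d) (T ^ κ) (T ^ η) (T ^ g)
    (T ^ (k₄ - g)) (Nat.one_le_pow _ _ hT1) (key 100 (by omega) h34) ?_ ?_ ?_ ?_ ?_ ?_ ?_
    (Nat.one_le_pow _ _ hT1) (mono hg) (Nat.one_le_pow _ _ hT1) ?_ ?_ ?_ ?_ ?_
  · rw [← pow_add]; congr 1; omega
  · rw [← pow_mul]; exact mono (by omega)
  · rw [← pow_mul]; exact mono (by omega)
  · calc 15 * (T ^ k₄) ^ 4 + T ^ l ≤ 15 * T ^ (4 * k₄) + 1 * T ^ (4 * k₄) := by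
          rw [← pow_mul, mul_comm k₄, one_mul]
          gcongr
          omega
      _ = 16 * T ^ (4 * k₄) := by ring
      _ ≤ T ^ (3 * k₃ + d) := key 16 (by omega) hd
      _ = (T ^ k₃) ^ 3 * T ^ d := by ring
      _ ≤ (4 * (T ^ k₃) ^ 3) * (T ^ d + 1) := Nat.mul_le_mul (by omega) (by omega)
  · calc 9 * T ^ κ * (T ^ k₄) ^ 3 = 9 * T ^ (κ + 3 * k₄) := by ring
      _ ≤ T ^ (η + 3 * k₃) := key 9 (by omega) hη
      _ = _ := by ring
  · rw [← pow_add]; exact mono hηκ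
  · rw [← pow_add]; exact mono (by omega)
  · calc T ^ l ≤ T ^ (κ + 2 * k₄) := mono hlκ
      _ = _ := by ring
  · calc 8 * 10 ^ 6 * T ^ k₃ * (T ^ g) ^ 3 = (8 * 10 ^ 6) * T ^ (k₃ + 3 * g) := by ring
      _ ≤ T ^ (2 * k₄) := key _ (by omega) h3g
      _ = _ := by ring
  · calc 16 * T ^ k₃ * T ^ g * T ^ l = 16 * T ^ (k₃ + g + l) := by ring
      _ ≤ T ^ (κ + 3 * k₄) := key _ (by omega) hgl
      _ = _ := by ring
  · calc 10 ^ 5 * T ^ l * T ^ k₄ = 10 ^ 5 * T ^ (l + k₄) := by ring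
      _ ≤ T ^ (3 * κ) := key _ (by omega) hκ3
      _ = _ := by ring
  · calc 10 ^ 12 * T ^ g * T ^ k₄ = 10 ^ 12 * T ^ (g + k₄) := by ring
      _ ≤ T ^ (2 * κ) := key _ (by omega) hκ2
      _ = _ := by ring

lemma sum_inv_Icc_mono {m n : ℕ} (h : m ≤ n) :
    ∑ j ∈ Icc 1 m, 1 / (j : ℝ) ≤ ∑ j ∈ Icc 1 n, 1 / (j : ℝ) :=
  sum_le_sum_of_subset_of_nonneg (Icc_subset_Icc_right h) fun _ _ _ => by positivity

/-- Trivial counting on a single block of fourth powers. -/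
lemma pairCount_single_le_trivial (P L : ℕ) (hL : P ^ 3 ≤ L) :
    P ^ 2 * pairCount (block P) (fun x => x ^ 4) L ≤ 2 * L := by
  classical
  have h := pairCount_block_le_trivial P L (univ : Finset Unit) (fun _ => 0) hL
  have : pairCount (block P) (fun x => x ^ 4) L
      ≤ pairCount (block P ×ˢ (univ : Finset Unit)) (fun p => p.1 ^ 4 + 0) L := by
    unfold pairCount
    refine card_le_card_of_injOn (fun p => ((p.1, ()), (p.2, ()))) ?_ ?_
    · intro p hp
      simp only [coe_filter, Set.mem_ofPred_eq, mem_product, mem_univ] at hp ⊢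
      simpa using hp
    · intro p _ q _ h
      simpa [Prod.ext_iff] using h
  calc _ ≤ _ := Nat.mul_le_mul_left _ this
    _ ≤ _ := h
    _ = _ := by simp

lemma abs_pair_sub_le {P Q : ℕ} (hPQ : Q ≤ P) : ∀ i ∈ block P ×ˢ block Q,
    ∀ j ∈ block P ×ˢ block Q,
      |(i.1 ^ 4 + i.2 ^ 4) - (j.1 ^ 4 + j.2 ^ 4)| ≤ 30 * (P : ℤ) ^ 4 := by
  intro i hi j hj
  rw [mem_product] at hi hj
  have h1 := abs_pow_four_sub_le hi.1 hj.1
  have h2 := abs_pow_four_sub_le hi.2 hj.2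
  have h3 : (Q : ℤ) ^ 4 ≤ P ^ 4 := by gcongr
  calc |(i.1 ^ 4 + i.2 ^ 4) - (j.1 ^ 4 + j.2 ^ 4)|
      = |(i.1 ^ 4 - j.1 ^ 4) + (i.2 ^ 4 - j.2 ^ 4)| := by congr 1; ring
    _ ≤ |i.1 ^ 4 - j.1 ^ 4| + |i.2 ^ 4 - j.2 ^ 4| := abs_add_le _ _
    _ ≤ 30 * (P : ℤ) ^ 4 := by linarith

/-- Coarse pair count for sums of two fourth powers. -/
lemma pairCount_pair_coarse {T k₃ k₄ d j : ℕ} (hT : 100 ≤ T) (Hm : ℝ)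
    (hH : ∑ j ∈ Icc 1 (T ^ d), 1 / (j : ℝ) ≤ Hm) (hHT : 8 * Hm ≤ T) (hd : 4 * k₄ + 1 ≤ 3 * k₃ + d)
    (hj : j + 1 ≤ 3 * k₃ + d) (hdj : d + 2 * k₃ ≤ j) (hjk : 3 * k₄ ≤ j) (h34 : 3 * k₃ ≤ 4 * k₄) :
    ((T : ℝ) ^ k₃) ^ 2 * pairCount (block (T ^ k₃) ×ˢ block (T ^ k₄))
      (fun p => p.1 ^ 4 + p.2 ^ 4) (T ^ j) ≤ T * T ^ j * (T ^ k₄) ^ 2 := by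
  have hT1 : 1 ≤ T := by omega
  have hTr : (100 : ℝ) ≤ T := by exact_mod_cast hT
  have hTr1 : (1 : ℝ) ≤ T := by linarith
  have h := pairCount_block_le_coarse (T ^ k₃) (T ^ d) (T ^ j) (block (T ^ k₄)) (fun z => z ^ 4)
    (by positivity) Hm ?_ ?_ hH
  · have h0 := pairCount_single_le_trivial (T ^ k₄) (T ^ j)
      (by rw [← pow_mul]; exact Nat.pow_le_pow_right hT1 (by omega))
    have h0' : ((T : ℝ) ^ k₄) ^ 2 * pairCount (block (T ^ k₄)) (fun x => x ^ 4) (T ^ j)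
        ≤ 2 * T ^ j := by exact_mod_cast h0
    rw [card_block] at h
    push_cast at h
    refine h.trans ?_
    have h1 : ((T : ℝ) ^ k₃) ^ 3 ≤ ((T : ℝ) ^ k₄) ^ 4 := by
      rw [← pow_mul, ← pow_mul]
      exact pow_le_pow_right₀ hTr1 (by omega)
    have h2 : ((T : ℝ) ^ k₃) ^ 3 * pairCount (block (T ^ k₄)) (fun x => x ^ 4) (T ^ j)
        ≤ 2 * T ^ j * (T ^ k₄) ^ 2 := by
      calc ((T : ℝ) ^ k₃) ^ 3 * pairCount (block (T ^ k₄)) (fun x => x ^ 4) (T ^ j)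
          ≤ ((T : ℝ) ^ k₄) ^ 4 * pairCount (block (T ^ k₄)) (fun x => x ^ 4) (T ^ j) := by gcongr
        _ = (((T : ℝ) ^ k₄) ^ 2 * pairCount (block (T ^ k₄)) (fun x => x ^ 4) (T ^ j))
            * (T ^ k₄) ^ 2 := by ring
        _ ≤ _ := by gcongr
    have h3 : 3 * Hm * T ^ j * ((T : ℝ) ^ k₄) ^ 2 ≤ (T / 2) * T ^ j * ((T : ℝ) ^ k₄) ^ 2 := by
      gcongr
      linarith
    have h4 : 2 * T ^ j * ((T : ℝ) ^ k₄) ^ 2 ≤ (T / 2) * T ^ j * ((T : ℝ) ^ k₄) ^ 2 := by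
      gcongr
      linarith
    linarith
  · intro a ha b hb
    have h1 := abs_pow_four_sub_le ha hb
    have h2 : 15 * (T ^ k₄) ^ 4 + T ^ j ≤ 4 * (T ^ k₃) ^ 3 * (T ^ d + 1) := by
      calc 15 * (T ^ k₄) ^ 4 + T ^ j = 15 * T ^ (4 * k₄) + 1 * T ^ j := by ring
        _ ≤ T ^ (3 * k₃ + d) + T ^ (3 * k₃ + d) := Nat.add_le_add
            (const_mul_pow_le (by omega) hd hT1) (const_mul_pow_le hT1 hj hT1)
        _ = 2 * (T ^ k₃) ^ 3 * T ^ d := by ring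
        _ ≤ _ := Nat.mul_le_mul (Nat.mul_le_mul_right _ (by norm_num)) (by omega)
    have h3 : 15 * (((T ^ k₄ : ℕ) : ℤ)) ^ 4 + ((T ^ j : ℕ) : ℤ)
        ≤ 4 * ((T ^ k₃ : ℕ) : ℤ) ^ 3 * (((T ^ d : ℕ) : ℤ) + 1) := by exact_mod_cast h2
    linarith
  · rw [← pow_mul, ← pow_add]
    exact Nat.pow_le_pow_right hT1 (by omega)

/-- Product of three dyadic blocks of sizes `P`, `Q`, `R`. -/
noncomputable def tripleBlock (P Q R : ℕ) : Finset (ℤ × ℤ × ℤ) :=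
  block P ×ˢ (block Q ×ˢ block R)

def quarticSum (p : ℤ × ℤ × ℤ) : ℤ := p.1 ^ 4 + (p.2.1 ^ 4 + p.2.2 ^ 4)

lemma card_tripleBlock (P Q R : ℕ) : #(tripleBlock P Q R) = P * (Q * R) := by
  simp [tripleBlock, card_product, card_block]

lemma pairCount_triple_far {T k₂ k₃ k₄ q : ℕ} (hT : 100 ≤ T) (hq : 3 * k₂ ≤ q) :
    ((T : ℝ) ^ k₂) ^ 4 * pairCount (tripleBlock (T ^ k₂) (T ^ k₃) (T ^ k₄)) quarticSum (T ^ q)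
      ≤ T * T ^ q * (#(tripleBlock (T ^ k₂) (T ^ k₃) (T ^ k₄)) : ℝ) ^ 2 := by
  have h : (T ^ k₂) ^ 2 * pairCount (tripleBlock (T ^ k₂) (T ^ k₃) (T ^ k₄)) quarticSum (T ^ q)
      ≤ 2 * T ^ q * #(block (T ^ k₃) ×ˢ block (T ^ k₄)) ^ 2 :=
    pairCount_block_le_trivial (T ^ k₂) (T ^ q) (block (T ^ k₃) ×ˢ block (T ^ k₄))
      (fun p => p.1 ^ 4 + p.2 ^ 4)
      (by rw [← pow_mul]; exact Nat.pow_le_pow_right (by omega) (by omega))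
  rw [card_product, card_block, card_block] at h
  rw [card_tripleBlock]
  have h' : ((T : ℝ) ^ k₂) ^ 2
      * pairCount (tripleBlock (T ^ k₂) (T ^ k₃) (T ^ k₄)) quarticSum (T ^ q)
      ≤ 2 * T ^ q * (T ^ k₃ * T ^ k₄) ^ 2 := by exact_mod_cast h
  have hTr : (100 : ℝ) ≤ T := by exact_mod_cast hT
  push_cast
  calc ((T : ℝ) ^ k₂) ^ 4 * pairCount (tripleBlock (T ^ k₂) (T ^ k₃) (T ^ k₄)) quarticSum (T ^ q)
      = (T ^ k₂) ^ 2 * (((T : ℝ) ^ k₂) ^ 2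
          * pairCount (tripleBlock (T ^ k₂) (T ^ k₃) (T ^ k₄)) quarticSum (T ^ q)) := by ring
    _ ≤ ((T : ℝ) ^ k₂) ^ 2 * (2 * T ^ q * (T ^ k₃ * T ^ k₄) ^ 2) := by gcongr
    _ = 2 * (T : ℝ) ^ q * (T ^ k₂ * (T ^ k₃ * T ^ k₄)) ^ 2 := by ring
    _ ≤ _ := by gcongr; linarith

lemma pow_span_le {T k₂ k₃ k₄ d q : ℕ} (hT : 100 ≤ T) (h34 : k₄ ≤ k₃)
    (hd : 4 * k₃ + 1 ≤ 3 * k₂ + d) (hq : q + 1 ≤ 3 * k₂ + d) :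
    ∀ i ∈ block (T ^ k₃) ×ˢ block (T ^ k₄), ∀ j ∈ block (T ^ k₃) ×ˢ block (T ^ k₄),
      |(i.1 ^ 4 + i.2 ^ 4) - (j.1 ^ 4 + j.2 ^ 4)| + ((T ^ q : ℕ) : ℤ)
        ≤ 4 * ((T ^ k₂ : ℕ) : ℤ) ^ 3 * (((T ^ d : ℕ) : ℤ) + 1) := by
  intro i hi j hj
  have hT1 : 1 ≤ T := by omega
  have h1 := abs_pair_sub_le (Nat.pow_le_pow_right hT1 h34) i hi j hj
  have h2 : 30 * (T ^ k₃) ^ 4 + T ^ q ≤ 4 * (T ^ k₂) ^ 3 * (T ^ d + 1) := by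
    calc 30 * (T ^ k₃) ^ 4 + T ^ q = 30 * T ^ (4 * k₃) + 1 * T ^ q := by ring
      _ ≤ T ^ (3 * k₂ + d) + T ^ (3 * k₂ + d) := Nat.add_le_add
          (const_mul_pow_le (by omega) hd hT1) (const_mul_pow_le hT1 hq hT1)
      _ = 2 * (T ^ k₂) ^ 3 * T ^ d := by ring
      _ ≤ _ := Nat.mul_le_mul (Nat.mul_le_mul_right _ (by norm_num)) (by omega)
  have h3 : 30 * (((T ^ k₃ : ℕ) : ℤ)) ^ 4 + ((T ^ q : ℕ) : ℤ)
      ≤ 4 * ((T ^ k₂ : ℕ) : ℤ) ^ 3 * (((T ^ d : ℕ) : ℤ) + 1) := by exact_mod_cast h2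
  linarith

lemma pairCount_triple_mid {T k₂ k₃ k₄ d q : ℕ} (hT : 100 ≤ T) (Hm : ℝ)
    (hH : ∑ j ∈ Icc 1 (T ^ d), 1 / (j : ℝ) ≤ Hm) (hHT : 8 * Hm ≤ T) (h34 : k₄ ≤ k₃)
    (hd : 4 * k₃ + 1 ≤ 3 * k₂ + d) (hq : q + 1 ≤ 3 * k₂ + d) (hdq : d + 2 * k₂ ≤ q)
    (hq3 : 3 * k₃ ≤ q) (h23 : 3 * k₂ ≤ 4 * k₃) :
    ((T : ℝ) ^ k₂) ^ 4 * pairCount (tripleBlock (T ^ k₂) (T ^ k₃) (T ^ k₄)) quarticSum (T ^ q)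
      ≤ T * T ^ q * (#(tripleBlock (T ^ k₂) (T ^ k₃) (T ^ k₄)) : ℝ) ^ 2 := by
  have hT1 : 1 ≤ T := by omega
  have hTr : (100 : ℝ) ≤ T := by exact_mod_cast hT
  have hTr1 : (1 : ℝ) ≤ T := by linarith
  have h : (((T ^ k₂ : ℕ) : ℝ)) ^ 2
      * pairCount (tripleBlock (T ^ k₂) (T ^ k₃) (T ^ k₄)) quarticSum (T ^ q)
      ≤ ((T ^ k₂ : ℕ) : ℝ) ^ 3 * pairCount (block (T ^ k₃) ×ˢ block (T ^ k₄))
          (fun p => p.1 ^ 4 + p.2 ^ 4) (T ^ q)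
        + 3 * Hm * (T ^ q : ℕ) * (#(block (T ^ k₃) ×ˢ block (T ^ k₄)) : ℝ) ^ 2 :=
    pairCount_block_le_coarse (T ^ k₂) (T ^ d) (T ^ q) (block (T ^ k₃) ×ˢ block (T ^ k₄))
      (fun p => p.1 ^ 4 + p.2 ^ 4) (by positivity) Hm (pow_span_le hT h34 hd hq)
      (by rw [← pow_mul, ← pow_add]; exact Nat.pow_le_pow_right hT1 (by omega)) hH
  have h0 := pairCount_block_le_trivial (T ^ k₃) (T ^ q) (block (T ^ k₄)) (fun z => z ^ 4)
    (by rw [← pow_mul]; exact Nat.pow_le_pow_right hT1 (by omega))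
  rw [card_block] at h0
  have h0' : ((T : ℝ) ^ k₃) ^ 2 * pairCount (block (T ^ k₃) ×ˢ block (T ^ k₄))
      (fun p => p.1 ^ 4 + p.2 ^ 4) (T ^ q) ≤ 2 * T ^ q * (T ^ k₄) ^ 2 := by exact_mod_cast h0
  have h1 : ((T : ℝ) ^ k₂) ^ 3 ≤ ((T : ℝ) ^ k₃) ^ 4 := by
    rw [← pow_mul, ← pow_mul]
    exact pow_le_pow_right₀ hTr1 (by omega)
  have h2 : ((T : ℝ) ^ k₂) ^ 3 * pairCount (block (T ^ k₃) ×ˢ block (T ^ k₄))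
      (fun p => p.1 ^ 4 + p.2 ^ 4) (T ^ q) ≤ 2 * T ^ q * (T ^ k₃ * T ^ k₄) ^ 2 := by
    calc _ ≤ ((T : ℝ) ^ k₃) ^ 4 * pairCount (block (T ^ k₃) ×ˢ block (T ^ k₄))
          (fun p => p.1 ^ 4 + p.2 ^ 4) (T ^ q) := by gcongr
      _ = (((T : ℝ) ^ k₃) ^ 2 * pairCount (block (T ^ k₃) ×ˢ block (T ^ k₄))
          (fun p => p.1 ^ 4 + p.2 ^ 4) (T ^ q)) * (T ^ k₃) ^ 2 := by ring
      _ ≤ (2 * T ^ q * (T ^ k₄) ^ 2) * (T ^ k₃) ^ 2 := by gcongr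
      _ = _ := by ring
  rw [card_product, card_block, card_block] at h
  rw [card_tripleBlock]
  push_cast at h ⊢
  calc ((T : ℝ) ^ k₂) ^ 4 * pairCount (tripleBlock (T ^ k₂) (T ^ k₃) (T ^ k₄)) quarticSum (T ^ q)
      = (T ^ k₂) ^ 2 * (((T : ℝ) ^ k₂) ^ 2
          * pairCount (tripleBlock (T ^ k₂) (T ^ k₃) (T ^ k₄)) quarticSum (T ^ q)) := by ring
    _ ≤ ((T : ℝ) ^ k₂) ^ 2 * (2 * T ^ q * (T ^ k₃ * T ^ k₄) ^ 2
          + 3 * Hm * T ^ q * (T ^ k₃ * T ^ k₄) ^ 2) := by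
        gcongr
        linarith
    _ = (2 + 3 * Hm) * ((T : ℝ) ^ q * (T ^ k₂ * (T ^ k₃ * T ^ k₄)) ^ 2) := by ring
    _ ≤ T * ((T : ℝ) ^ q * (T ^ k₂ * (T ^ k₃ * T ^ k₄)) ^ 2) := by gcongr; linarith
    _ = _ := by ring

lemma pairCount_triple_fine {T k₂ k₃ k₄ d l τ : ℕ} (hT : 10 ^ 13 ≤ T) (Hm : ℝ)
    (hE : pairCount (block (T ^ k₃) ×ˢ block (T ^ k₄)) (fun p => p.1 ^ 4 + p.2 ^ 4) (T ^ l)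
      ≤ 7 * (T ^ k₃ * T ^ k₄))
    (hE' : ((T : ℝ) ^ k₃) ^ 2 * pairCount (block (T ^ k₃) ×ˢ block (T ^ k₄))
      (fun p => p.1 ^ 4 + p.2 ^ 4) (T ^ (d + 2 * k₂)) ≤ T * T ^ (d + 2 * k₂) * (T ^ k₄) ^ 2)
    (hτ : ∀ n ∈ Icc 1 (T ^ (d + 2 * k₂)), n.divisors.card ^ 2 ≤ τ)
    (hH : ∑ j ∈ Icc 1 (T ^ (d + 2 * k₂)), 1 / (j : ℝ) ≤ Hm) (hHT : 8000 * τ * Hm ≤ T)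
    (h34 : k₄ ≤ k₃) (hd : 4 * k₃ + 1 ≤ 3 * k₂ + d) (hl : l + 1 ≤ 3 * k₂ + d)
    (hd2 : 4 * d + 1 ≤ k₂) (hkl : k₂ ≤ l) (hld : l ≤ d + 2 * k₂) (hld3 : l + d + k₄ ≤ 3 * k₃) :
    (pairCount (tripleBlock (T ^ k₂) (T ^ k₃) (T ^ k₄)) quarticSum (T ^ l) : ℝ)
      ≤ T ^ 2 * #(tripleBlock (T ^ k₂) (T ^ k₃) (T ^ k₄)) := by
  have hT1 : 1 ≤ T := by omega
  have hTr : (10 ^ 13 : ℝ) ≤ T := by exact_mod_cast hT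
  have hTr1 : (1 : ℝ) ≤ T := by linarith
  have hT0 : (0 : ℝ) < T := by linarith
  set B := block (T ^ k₃) ×ˢ block (T ^ k₄) with hB
  set EB := pairCount B (fun p => p.1 ^ 4 + p.2 ^ 4) (T ^ l) with hEB
  set EJ := pairCount B (fun p => p.1 ^ 4 + p.2 ^ 4) (T ^ (d + 2 * k₂)) with hEJ
  have hDP : T ^ d * (T ^ k₂) ^ 2 = T ^ (d + 2 * k₂) := by ring
  have h1 : pairCount (tripleBlock (T ^ k₂) (T ^ k₃) (T ^ k₄)) quarticSum (T ^ l)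
      ≤ T ^ k₂ * EB + 2 * ∑ h ∈ Icc 1 (T ^ d),
          shiftCount (T ^ k₂) B (fun p => p.1 ^ 4 + p.2 ^ 4) (T ^ l) h :=
    pairCount_block_le (T ^ k₂) (T ^ d) (T ^ l) B (fun p => p.1 ^ 4 + p.2 ^ 4) (by positivity)
      (pow_span_le (by omega) h34 hd hl)
  have h2 := sum_shiftCount_le (T ^ k₂) (T ^ d) (T ^ l) (T ^ (d + 2 * k₂)) τ B
    (fun p => p.1 ^ 4 + p.2 ^ 4) (fun i _ => by positivity) (by positivity) (by positivity)
    (by positivity) (Nat.pow_le_pow_right hT1 hkl) (Nat.pow_le_pow_right hT1 hld) hDP.ge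
    (by rwa [hDP]) Hm (T ^ k₂) (by rwa [hDP]) (by positivity) (by
      push_cast
      calc 8000 * τ * Hm * ((T : ℝ) ^ d) ^ 4 * (T ^ k₂) ^ 3
          ≤ T * ((T : ℝ) ^ d) ^ 4 * (T ^ k₂) ^ 3 := by gcongr
        _ = (T : ℝ) ^ (4 * d + 1 + 3 * k₂) := by ring
        _ ≤ (T : ℝ) ^ (4 * k₂) := pow_le_pow_right₀ hTr1 (by omega)
        _ = _ := by ring)
  have h1' : (pairCount (tripleBlock (T ^ k₂) (T ^ k₃) (T ^ k₄)) quarticSum (T ^ l) : ℝ)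
      ≤ T ^ k₂ * EB + 2 * ∑ h ∈ Icc 1 (T ^ d),
          (shiftCount (T ^ k₂) B (fun p => p.1 ^ 4 + p.2 ^ 4) (T ^ l) h : ℝ) := by
    exact_mod_cast h1
  have hE1 : (EB : ℝ) ≤ 7 * (T ^ k₃ * T ^ k₄) := by exact_mod_cast hE
  have h3 : (T ^ l : ℕ) * ((T ^ d : ℕ) * (T ^ k₂ : ℕ)) * (EJ : ℝ) / (T ^ (d + 2 * k₂) : ℕ)
      ≤ T * (T ^ k₂ * (T ^ k₃ * T ^ k₄)) := by
    push_cast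
    rw [div_le_iff₀ (by positivity)]
    refine le_of_mul_le_mul_left ?_ (by positivity : (0 : ℝ) < (T ^ k₃) ^ 2)
    calc ((T : ℝ) ^ k₃) ^ 2 * (T ^ l * (T ^ d * T ^ k₂) * EJ)
        = ((T : ℝ) ^ l * (T ^ d * T ^ k₂)) * (((T : ℝ) ^ k₃) ^ 2 * EJ) := by ring
      _ ≤ ((T : ℝ) ^ l * (T ^ d * T ^ k₂)) * (T * T ^ (d + 2 * k₂) * (T ^ k₄) ^ 2) := by gcongr
      _ = (T : ℝ) ^ (l + d + k₄) * (T ^ k₂ * T * T ^ (d + 2 * k₂) * T ^ k₄) := by ring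
      _ ≤ (T : ℝ) ^ (3 * k₃) * (T ^ k₂ * T * T ^ (d + 2 * k₂) * T ^ k₄) := by
          gcongr
      _ = _ := by ring
  rw [card_tripleBlock]
  push_cast at h2 h3 ⊢
  set S : ℝ := T ^ k₂ * (T ^ k₃ * T ^ k₄) with hS
  have hS0 : 0 ≤ S := by positivity
  have h4 : (T : ℝ) ^ k₂ * EB ≤ 7 * S := by
    calc (T : ℝ) ^ k₂ * EB ≤ T ^ k₂ * (7 * (T ^ k₃ * T ^ k₄)) := by gcongr
      _ = _ := by rw [hS]; ring
  have h5 : (1799 + 256 * (T : ℝ)) * S ≤ T ^ 2 * S := by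
    gcongr
    nlinarith
  linarith

/-- Mean square over windows of a quartic Weyl sum, by differencing. -/
lemma sum_norm_sq_window_le (a b : ℤ) (D : ℕ) (α U : ℝ)
    (hU : ∀ j : ℕ, ∑ h ∈ Icc 1 D,
      ‖expSum (Ico (a + j) (b + j)) (fun x : ℤ => (x + h) ^ 4 - x ^ 4) α‖ ≤ U) :
    ∑ y ∈ Ico a b, ‖expSum (Ico y (y + D)) (fun x => x ^ 4) α‖ ^ 2
      ≤ D * (b - a).toNat + 2 * D * U := by
  classical
  set c : ℕ → ℕ → ℂ := fun i j =>
    expSum (Ico a b) (fun y => (y + i) ^ 4 + -(y + j) ^ 4) α with hc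
  have hf : ∀ y : ℤ, expSum (Ico y (y + D)) (fun x => x ^ 4) α
      = expSum (range D) (fun i => (y + i) ^ 4) α := by
    intro y
    unfold expSum
    symm
    refine sum_nbij (fun i => y + i) ?_ ?_ ?_ ?_
    · intro i hi
      simp only [mem_range, mem_Ico] at hi ⊢
      omega
    · intro i _ j _ h
      simpa using h
    · intro x hx
      simp only [coe_Ico, Set.mem_Ico] at hx
      refine ⟨(x - y).toNat, ?_, ?_⟩
      · simp only [coe_range, Set.mem_Iio]
        omega
      · simp only
        omega
    · intro i _
      rfl
  have hsum : ((∑ y ∈ Ico a b, ‖expSum (Ico y (y + D)) (fun x => x ^ 4) α‖ ^ 2 : ℝ) : ℂ)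
      = ∑ i ∈ range D, ∑ j ∈ range D, c i j := by
    push_cast
    have : ∀ y : ℤ, ((‖expSum (Ico y (y + D)) (fun x => x ^ 4) α‖ : ℂ)) ^ 2
        = ∑ i ∈ range D, ∑ j ∈ range D, ee (α * ((y + i) ^ 4 + -(y + j) ^ 4 : ℤ)) := by
      intro y
      rw [hf y, ← Complex.mul_conj', ← expSum_neg_fun, ← expSum_prod, expSum, sum_product]
    rw [sum_congr rfl fun y _ => this y, sum_comm]
    refine sum_congr rfl fun i _ => ?_
    rw [sum_comm]
    rfl
  have hsymm : ∀ i j, ‖c i j‖ = ‖c j i‖ := by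
    intro i j
    have : c i j = (starRingEnd ℂ) (c j i) := by
      simp only [hc]
      rw [← expSum_neg_fun]
      congr 1
      funext y
      ring
    rw [this, RCLike.norm_conj]
  have hup : ∀ i, ∑ j ∈ range D with i < j, ‖c i j‖ ≤ U := by
    intro i
    refine le_trans ?_ (hU i)
    have h1 : ∀ j, i < j → ‖c i j‖
        = ‖expSum (Ico (a + i) (b + i)) (fun x : ℤ => (x + (j - i : ℕ)) ^ 4 - x ^ 4) α‖ := by
      intro j hij
      rw [hsymm]
      congr 1
      simp only [hc]
      unfold expSum
      refine sum_nbij (fun y => y + i) ?_ ?_ ?_ ?_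
      · intro y hy
        simp only [mem_Ico] at hy ⊢
        omega
      · intro x _ y _ h
        simpa using h
      · intro x hx
        simp only [coe_Ico, Set.mem_Ico] at hx
        refine ⟨x - i, ?_, ?_⟩
        · simp only [coe_Ico, Set.mem_Ico]
          omega
        · simp
      · intro y _
        have : ((j - i : ℕ) : ℤ) = j - i := by omega
        rw [this]
        congr 3
        ring
    rw [sum_congr rfl fun j hj => h1 j (mem_filter.1 hj).2]
    rw [← sum_image (f := fun h : ℕ => ‖expSum (Ico (a + i) (b + i))
      (fun x : ℤ => (x + h) ^ 4 - x ^ 4) α‖) (g := fun j => j - i)]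
    · refine sum_le_sum_of_subset_of_nonneg ?_ fun _ _ _ => norm_nonneg _
      intro h hh
      simp only [mem_image, mem_filter, mem_range, mem_Icc] at hh ⊢
      omega
    · intro x hx y hy hxy
      simp only [coe_filter, Set.mem_ofPred_eq, mem_range] at hx hy hxy
      omega
  have hdiag : ∀ i, ‖c i i‖ ≤ (b - a).toNat := fun i =>
    (norm_expSum_le _ _ _).trans (by simp)
  have hnn : (0 : ℝ) ≤ ∑ y ∈ Ico a b, ‖expSum (Ico y (y + D)) (fun x => x ^ 4) α‖ ^ 2 :=
    sum_nonneg fun _ _ => sq_nonneg _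
  have hsplit : ∀ i j, ‖c i j‖ = (if i = j then ‖c i i‖ else 0) + (if i < j then ‖c i j‖ else 0)
      + (if j < i then ‖c j i‖ else 0) := by
    intro i j
    rcases lt_trichotomy i j with h | h | h
    · simp [h, h.ne, h.not_gt]
    · subst h; simp
    · simp [h, h.ne', h.not_gt, hsymm i j]
  calc ∑ y ∈ Ico a b, ‖expSum (Ico y (y + D)) (fun x => x ^ 4) α‖ ^ 2
      = ‖((∑ y ∈ Ico a b, ‖expSum (Ico y (y + D)) (fun x => x ^ 4) α‖ ^ 2 : ℝ) : ℂ)‖ := by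
        rw [Complex.norm_real, Real.norm_of_nonneg hnn]
    _ ≤ ∑ i ∈ range D, ∑ j ∈ range D, ‖c i j‖ := by
        rw [hsum]
        exact (norm_sum_le _ _).trans (sum_le_sum fun i _ => norm_sum_le _ _)
    _ = ∑ i ∈ range D, ‖c i i‖ + ∑ i ∈ range D, ∑ j ∈ range D with i < j, ‖c i j‖
        + ∑ j ∈ range D, ∑ i ∈ range D with j < i, ‖c j i‖ := by
        rw [sum_congr rfl fun i _ => sum_congr rfl fun j _ => hsplit i j]
        simp_rw [sum_add_distrib, sum_filter]
        congr 1
        · congr 1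
          refine sum_congr rfl fun i hi => ?_
          rw [sum_ite_eq, if_pos hi]
        · exact sum_comm
    _ ≤ ∑ _i ∈ range D, ((b - a).toNat : ℝ) + ∑ _i ∈ range D, U + ∑ _i ∈ range D, U := by
        gcongr with i hi i hi i hi
        · exact hdiag i
        · exact hup i
        · exact hup i
    _ = D * (b - a).toNat + 2 * D * U := by
        simp only [sum_const, card_range, nsmul_eq_mul]
        ring

section

/-- The exponential sum over an initial segment of integers. -/
noncomputable def linSum (J : ℕ) (α : ℝ) : ℂ := expSum (Ico (0 : ℤ) J) (fun n => n) α

lemma norm_linSum_le (J : ℕ) (α : ℝ) : ‖linSum J α‖ ≤ J :=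
  (norm_expSum_le _ _ _).trans (by simp)

lemma norm_linSum_le_two_div (J : ℕ) {α : ℝ} (h0 : α ≠ 0) (h1 : |α| ≤ 1 / 2) :
    ‖linSum J α‖ ≤ 2 / |α| := by
  rcases Nat.eq_zero_or_pos J with rfl | hJ
  · simp only [linSum, expSum]
    norm_num
    positivity
  have hα : 0 < |α| := abs_pos.2 h0
  have h := norm_sum_ee_linear_le 0 J α 0 J (by exact_mod_cast hJ) (by simp)
  have hd : |α| ≤ |α - round α| := by
    have := round_le α 0
    rcases eq_or_ne (round α) 0 with h' | h'
    · rw [h']; simp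
    · have h3 : (1 : ℝ) ≤ |((round α : ℤ) : ℝ)| := by
        rw [← Int.cast_abs]
        exact_mod_cast Int.one_le_abs h'
      have h4 := abs_sub_abs_le_abs_sub ((round α : ℤ) : ℝ) α
      rw [abs_sub_comm] at h4
      linarith
  have hJ' : (0 : ℝ) < J := by exact_mod_cast hJ
  simp only [add_zero] at h
  refine h.trans ?_
  rw [div_le_div_iff₀ (by positivity) hα]
  have : (J : ℝ) * |α| ≤ J * |α - round α| := by gcongr
  linarith

lemma norm_one_sub_linSum_div_le (B : ℕ) (hB : 0 < B) (α : ℝ) :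
    ‖1 - linSum B α / B‖ ≤ 2 := by
  have hB' : (0 : ℝ) < B := by exact_mod_cast hB
  refine (norm_sub_le _ _).trans ?_
  rw [norm_one, norm_div, RCLike.norm_natCast]
  have := (div_le_one hB').2 (norm_linSum_le B α)
  linarith

lemma norm_one_sub_linSum_div_le_mul (B : ℕ) (hB : 0 < B) (α : ℝ) :
    ‖1 - linSum B α / B‖ ≤ 2 * Real.pi * B * |α| := by
  have hB' : (0 : ℝ) < B := by exact_mod_cast hB
  have hBc : (B : ℂ) ≠ 0 := by exact_mod_cast hB.ne'
  have h : 1 - linSum B α / B = (∑ n ∈ Ico (0 : ℤ) B, (1 - ee (α * n))) / B := by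
    rw [sum_sub_distrib, sub_div]
    congr 1
    simp [hBc]
  rw [h, norm_div, RCLike.norm_natCast, div_le_iff₀ hB']
  calc ‖∑ n ∈ Ico (0 : ℤ) B, (1 - ee (α * n))‖
      ≤ ∑ n ∈ Ico (0 : ℤ) B, ‖1 - ee (α * n)‖ := norm_sum_le _ _
    _ ≤ ∑ _n ∈ Ico (0 : ℤ) B, 2 * Real.pi * B * |α| := by
        refine sum_le_sum fun n hn => ?_
        rw [norm_sub_rev]
        refine (norm_ee_sub_one_le _).trans ?_
        rw [mem_Ico] at hn
        have h1 : |(n : ℝ)| ≤ B := by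
          rw [abs_of_nonneg (by exact_mod_cast hn.1)]
          exact_mod_cast hn.2.le
        rw [abs_mul]
        calc 2 * Real.pi * (|α| * |(n : ℝ)|) ≤ 2 * Real.pi * (|α| * B) := by
              have := Real.pi_pos
              gcongr
          _ = _ := by ring
    _ = _ := by simp; ring

lemma sum_piFinset_ee (J r : ℕ) (α : ℝ) :
    ∑ u ∈ Fintype.piFinset (fun _ : Fin r => Ico (0 : ℤ) J), ee (α * (∑ t, u t : ℤ))
      = linSum J α ^ r := by
  have h := Finset.prod_univ_sum (fun _ : Fin r => Ico (0 : ℤ) J)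
    (fun _ n => ee (α * (n : ℝ)))
  rw [prod_const, card_univ, Fintype.card_fin] at h
  rw [linSum, expSum, h]
  refine sum_congr rfl fun u _ => ?_
  rw [← ee_sum]
  congr 1
  push_cast
  rw [mul_sum]

lemma sum_weight_ee (B : ℕ) (hB : 0 < B) (α : ℝ) :
    ∑ n ∈ Ico (0 : ℤ) B, ((if n = 0 then 1 else 0) - 1 / (B : ℂ)) * ee (α * n)
      = 1 - linSum B α / B := by
  simp_rw [sub_mul]
  rw [sum_sub_distrib]
  congr 1
  · rw [sum_eq_single 0]
    · simp [ee_zero]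
    · intro n _ hn
      simp [hn]
    · intro h
      simp at h
      omega
  · rw [← mul_sum, linSum, expSum]
    ring

variable {ι : Type*}

/-- Second moment of the discrepancy of the representation function over a short window. -/
lemma window_variance (s : Finset ι) (c : ι → ℤ) (y : ℤ) (D J r B R : ℕ) (hy : 0 ≤ y)
    (hc : ∀ i ∈ s, 0 ≤ c i) (hB : 0 < B)
    (hR : ∀ i ∈ s, (y + D) ^ 4 + c i + r * J + B ≤ 2 * R) (hR0 : 0 < R)
    (A : Finset ℤ) (hA : ∀ a ∈ A, 0 ≤ a ∧ a < 2 * R)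
    (hbad : ∀ a ∈ A, ∀ x : ℤ, 0 ≤ x → ∀ i ∈ s, x ^ 4 + c i ≤ a → x ^ 4 + c i + r * J ≤ a)
    (hrep : ∀ a ∈ A, ∀ m : ℤ, 0 ≤ m → m ≤ r * J → ∀ i ∈ s,
      ∃ x : ℤ, y ≤ x ∧ x < y + D ∧ x ^ 4 ≤ a - c i - m ∧ a - c i - m < x ^ 4 + B)
    (hr : 0 < r) (hJ : 0 < J) :
    2 * R * (#A * ((J : ℝ) ^ r * #s / B) ^ 2)
      ≤ ∑ k ∈ Ico (-R : ℤ) R, ‖expSum (Ico y (y + D)) (fun x => x ^ 4) ((k : ℝ) / (2 * R))‖ ^ 2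
        * ‖expSum s c ((k : ℝ) / (2 * R))‖ ^ 2
        * (‖linSum J ((k : ℝ) / (2 * R))‖ ^ r * ‖1 - linSum B ((k : ℝ) / (2 * R)) / B‖) ^ 2 := by
  classical
  set S : Finset ((ℤ × ι) × (Fin r → ℤ) × ℤ) := (Ico y (y + D) ×ˢ s) ×ˢ
    (Fintype.piFinset (fun _ : Fin r => Ico (0 : ℤ) J) ×ˢ Ico (0 : ℤ) B) with hS
  set v : (ℤ × ι) × (Fin r → ℤ) × ℤ → ℤ := fun p =>
    (p.1.1 ^ 4 + c p.1.2) + ((∑ t, p.2.1 t) + p.2.2) with hv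
  set w : (ℤ × ι) × (Fin r → ℤ) × ℤ → ℂ := fun p =>
    (if p.2.2 = 0 then 1 else 0) - 1 / (B : ℂ) with hw
  have hpi : ∀ u ∈ Fintype.piFinset (fun _ : Fin r => Ico (0 : ℤ) J),
      0 ≤ ∑ t, u t ∧ ∑ t, u t < r * J := by
    intro u hu
    simp only [Fintype.mem_piFinset, mem_Ico] at hu
    refine ⟨sum_nonneg fun t _ => (hu t).1, ?_⟩
    have : Nonempty (Fin r) := ⟨⟨0, hr⟩⟩
    calc ∑ t, u t < ∑ _t : Fin r, (J : ℤ) :=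
          sum_lt_sum_of_nonempty univ_nonempty fun t _ => (hu t).2
      _ = r * J := by simp
  have hmem : ∀ p ∈ S, (y ≤ p.1.1 ∧ p.1.1 < y + D) ∧ p.1.2 ∈ s ∧
      p.2.1 ∈ Fintype.piFinset (fun _ : Fin r => Ico (0 : ℤ) J) ∧ (0 ≤ p.2.2 ∧ p.2.2 < B) := by
    intro p hp
    simp only [hS, mem_product, mem_Ico] at hp
    exact ⟨hp.1.1, hp.1.2, hp.2.1, hp.2.2⟩
  have hvR : ∀ p ∈ S, v p ∈ Ico (0 : ℤ) (2 * R) := by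
    intro p hp
    obtain ⟨h1, h2, h3, h4⟩ := hmem p hp
    have h5 := hpi _ h3
    have h6 := hc _ h2
    have h7 := hR _ h2
    have h8 : 0 ≤ p.1.1 ^ 4 := by positivity
    have h9 : p.1.1 ^ 4 ≤ (y + D) ^ 4 := pow_le_pow_left₀ (by omega) h1.2.le 4
    simp only [hv, mem_Ico]
    constructor <;> omega
  have hpars := parseval S w v R hR0 hvR
  have hfac : ∀ α : ℝ, ∑ p ∈ S, w p * ee (α * v p)
      = expSum (Ico y (y + D)) (fun x => x ^ 4) α * expSum s c α
        * (linSum J α ^ r * (1 - linSum B α / B)) := by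
    intro α
    rw [← expSum_prod, ← sum_piFinset_ee, ← sum_weight_ee B hB, expSum, hS, sum_product, sum_mul]
    refine sum_congr rfl fun p _ => ?_
    rw [sum_product, sum_mul_sum, mul_sum]
    refine sum_congr rfl fun u _ => ?_
    rw [mul_sum]
    refine sum_congr rfl fun n _ => ?_
    have : ee (α * v (p, u, n)) = ee (α * (p.1 ^ 4 + c p.2 : ℤ)) * (ee (α * (∑ t, u t : ℤ))
        * ee (α * n)) := by
      rw [← ee_add, ← ee_add]
      congr 1
      simp only [hv]
      push_cast
      ring
    rw [this]
    simp only [hw]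
    ring
  have hlower : ∀ a ∈ A, ((J : ℝ) ^ r * #s / B) ^ 2 ≤ ‖∑ p ∈ S with v p = a, w p‖ ^ 2 := by
    intro a ha
    have hB' : (0 : ℝ) < B := by exact_mod_cast hB
    have hwa : ∑ p ∈ S with v p = a, w p = -((#{p ∈ S | v p = a} : ℂ) / B) := by
      rw [sum_congr rfl (g := fun _ => -(1 / (B : ℂ)))]
      · simp only [sum_const, nsmul_eq_mul]
        ring
      · intro p hp
        rw [mem_filter] at hp
        obtain ⟨h1, h2, h3, h4⟩ := hmem p hp.1
        have h5 := hpi _ h3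
        have h6 : p.2.2 ≠ 0 := by
          intro h0
          have h7 := hp.2
          simp only [hv] at h7
          have := hbad a ha p.1.1 (by omega) _ h2 (by omega)
          omega
        simp [hw, h6]
    have hcard : J ^ r * #s ≤ #{p ∈ S | v p = a} := by
      have : J ^ r * #s = #(Fintype.piFinset (fun _ : Fin r => Ico (0 : ℤ) J) ×ˢ s) := by
        rw [card_product, Fintype.card_piFinset]
        simp
      rw [this]
      refine card_le_card_of_surjOn (fun p => (p.2.1, p.1.2)) ?_
      intro q hq
      simp only [coe_product, Set.mem_prod, mem_coe] at hq
      have h5 := hpi _ hq.1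
      obtain ⟨x, hx1, hx2, hx3, hx4⟩ := hrep a ha (∑ t, q.1 t) h5.1 h5.2.le q.2 hq.2
      refine ⟨((x, q.2), (q.1, a - c q.2 - ∑ t, q.1 t - x ^ 4)), ?_, rfl⟩
      simp only [hS, hv, coe_filter, Set.mem_ofPred_eq, mem_product, mem_Ico]
      refine ⟨⟨⟨⟨hx1, hx2⟩, hq.2⟩, hq.1, by omega, by omega⟩, by ring⟩
    rw [hwa, norm_neg, norm_div, RCLike.norm_natCast, RCLike.norm_natCast]
    gcongr
    exact_mod_cast hcard
  calc 2 * R * (#A * ((J : ℝ) ^ r * #s / B) ^ 2)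
      = 2 * R * ∑ _a ∈ A, ((J : ℝ) ^ r * #s / B) ^ 2 := by rw [sum_const, nsmul_eq_mul]
    _ ≤ 2 * R * ∑ a ∈ A, ‖∑ p ∈ S with v p = a, w p‖ ^ 2 := by
        exact mul_le_mul_of_nonneg_left (sum_le_sum hlower) (by positivity)
    _ ≤ 2 * R * ∑ a ∈ Ico (0 : ℤ) (2 * R), ‖∑ p ∈ S with v p = a, w p‖ ^ 2 := by
        gcongr
        intro a ha
        rw [mem_Ico]
        exact hA a ha
    _ = _ := by
        rw [← hpars]
        refine sum_congr rfl fun k _ => ?_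
        have : ∀ p, w p * ee ((k : ℝ) * v p / (2 * R)) = w p * ee ((k : ℝ) / (2 * R) * v p) := by
          intro p
          congr 2
          ring
        rw [sum_congr rfl fun p _ => this p, hfac]
        simp only [norm_mul, norm_pow, mul_pow]

end

section

lemma exists_fourth_root (m : ℤ) (hm : 0 ≤ m) : ∃ x : ℤ, 0 ≤ x ∧ x ^ 4 ≤ m ∧ m < (x + 1) ^ 4 := by
  obtain ⟨n, rfl⟩ := Int.eq_ofNat_of_zero_le hm
  refine ⟨(n.sqrt.sqrt : ℕ), by positivity, ?_, ?_⟩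
  · have : n.sqrt.sqrt ^ 4 ≤ n := by
      calc n.sqrt.sqrt ^ 4 = (n.sqrt.sqrt ^ 2) ^ 2 := by ring
        _ ≤ n.sqrt ^ 2 := Nat.pow_le_pow_left (Nat.sqrt_le' _) 2
        _ ≤ n := Nat.sqrt_le' _
    exact_mod_cast this
  · have : n < (n.sqrt.sqrt + 1) ^ 4 := by
      have h1 : n.sqrt + 1 ≤ (n.sqrt.sqrt + 1) ^ 2 := Nat.lt_succ_sqrt' _
      calc n < (n.sqrt + 1) ^ 2 := Nat.lt_succ_sqrt' _
        _ ≤ ((n.sqrt.sqrt + 1) ^ 2) ^ 2 := Nat.pow_le_pow_left h1 2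
        _ = _ := by ring
    exact_mod_cast this

variable {ι : Type*}

lemma exists_root_in_window {X E B y a m : ℤ} (hX : 1 ≤ X) (hE : 0 ≤ E) (hy : X ≤ y)
    (hm : m ≤ a) (hm' : a ≤ m + 4 * E * X ^ 3) (ha : (y + E) ^ 4 ≤ a) (ha' : a < (y + 2 * E) ^ 4)
    (hX4 : a < (4 * X) ^ 4) (hB : 960 * X ^ 3 ≤ B) :
    ∃ x : ℤ, y ≤ x ∧ x < y + 2 * E ∧ x ^ 4 ≤ m ∧ m < x ^ 4 + B := by
  have hy0 : 0 ≤ y := by omega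
  have hym : y ^ 4 ≤ m := by
    have h1 : X ^ 3 ≤ y ^ 3 := pow_le_pow_left₀ (by omega) hy 3
    have h2 : 4 * E * X ^ 3 ≤ 4 * E * y ^ 3 := by gcongr
    have h3 : y ^ 4 + 4 * E * y ^ 3 ≤ (y + E) ^ 4 := by
      have h4 : (y + E) ^ 4 = y ^ 4 + 4 * E * y ^ 3 + (6 * y ^ 2 * E ^ 2 + 4 * y * E ^ 3 + E ^ 4) := by
        ring
      have h5 : 0 ≤ 6 * y ^ 2 * E ^ 2 + 4 * y * E ^ 3 + E ^ 4 := by positivity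
      linarith
    linarith
  obtain ⟨x, hx0, hx1, hx2⟩ := exists_fourth_root m (le_trans (by positivity) hym)
  have hxy : y ≤ x := by
    have := lt_of_pow_lt_pow_left₀ 4 (by omega : 0 ≤ x + 1) (hym.trans_lt hx2)
    omega
  have hxu : x < y + 2 * E :=
    lt_of_pow_lt_pow_left₀ 4 (by omega) (hx1.trans_lt (hm.trans_lt ha'))
  have hxX : x < 4 * X := lt_of_pow_lt_pow_left₀ 4 (by omega) (hx1.trans_lt (hm.trans_lt hX4))
  refine ⟨x, hxy, hxu, hx1, hx2.trans_le ?_⟩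
  have h1 : x ^ 3 ≤ (4 * X) ^ 3 := pow_le_pow_left₀ hx0 hxX.le 3
  have hx1' : 1 ≤ x := by omega
  have h2 : x ^ 2 ≤ x ^ 3 := pow_le_pow_right₀ hx1' (by norm_num)
  have h3 : x ≤ x ^ 3 := le_self_pow₀ hx1' (by norm_num)
  have h4 : 1 ≤ x ^ 3 := one_le_pow₀ hx1'
  have h5 : (x + 1) ^ 4 = x ^ 4 + (4 * x ^ 3 + 6 * x ^ 2 + 4 * x + 1) := by ring
  have h6 : (4 * X) ^ 3 = 64 * X ^ 3 := by ring
  linarith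

lemma bad_card_le_sum (s : Finset ι) (c : ι → ℤ) (X E J r B R : ℕ) (hX : 1 ≤ X) (hr : 0 < r)
    (hJ : 0 < J) (hE : 0 < E) (hc : ∀ i ∈ s, 0 ≤ c i ∧ c i + r * J ≤ 4 * E * X ^ 3)
    (hB : 960 * X ^ 3 ≤ B) (hR : (4 * X + 2 * E) ^ 4 + 4 * E * X ^ 3 + B ≤ 2 * R)
    (A : Finset ℤ) (hA : ∀ a ∈ A, ((X + 2 * E : ℕ) : ℤ) ^ 4 ≤ a ∧ a < (4 * X : ℤ) ^ 4)
    (hbad : ∀ a ∈ A, ∀ x : ℤ, 0 ≤ x → ∀ i ∈ s, x ^ 4 + c i ≤ a → x ^ 4 + c i + r * J ≤ a) :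
    2 * R * (E * #A * ((J : ℝ) ^ r * #s / B) ^ 2)
      ≤ ∑ k ∈ Ico (-R : ℤ) R, (∑ y ∈ Ico (X : ℤ) (4 * X),
          ‖expSum (Ico y (y + (2 * E : ℕ))) (fun x => x ^ 4) ((k : ℝ) / (2 * R))‖ ^ 2)
        * ‖expSum s c ((k : ℝ) / (2 * R))‖ ^ 2
        * (‖linSum J ((k : ℝ) / (2 * R))‖ ^ r * ‖1 - linSum B ((k : ℝ) / (2 * R)) / B‖) ^ 2 := by
  classical
  have hB0 : 0 < B := lt_of_lt_of_le (by positivity) hB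
  have hRz : ((4 * X + 2 * E) ^ 4 + 4 * E * X ^ 3 + B : ℤ) ≤ 2 * R := by exact_mod_cast hR
  have hR0 : 0 < R := by
    have : 0 < 2 * R := lt_of_lt_of_le (by positivity) hR
    omega
  set Ay : ℤ → Finset ℤ := fun y => {a ∈ A | (y + E) ^ 4 ≤ a ∧ a < (y + 2 * E) ^ 4} with hAy
  have hEA : (E : ℝ) * #A ≤ ∑ y ∈ Ico (X : ℤ) (4 * X), (#(Ay y) : ℝ) := by
    have : E * #A ≤ ∑ y ∈ Ico (X : ℤ) (4 * X), #(Ay y) := by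
      have h1 : ∑ y ∈ Ico (X : ℤ) (4 * X), #(Ay y)
          = ∑ a ∈ A, #{y ∈ Ico (X : ℤ) (4 * X) | (y + E) ^ 4 ≤ a ∧ a < (y + 2 * E) ^ 4} := by
        simp only [hAy, card_filter]
        exact sum_comm
      rw [h1, mul_comm, ← smul_eq_mul, ← sum_const]
      refine sum_le_sum fun a ha => ?_
      obtain ⟨h2, h3⟩ := hA a ha
      push_cast at h2
      obtain ⟨z, hz0, hz1, hz2⟩ := exists_fourth_root a (le_trans (by positivity) h2)
      have hz3 : (X + 2 * E : ℤ) < z + 1 :=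
        lt_of_pow_lt_pow_left₀ 4 (by omega) (h2.trans_lt hz2)
      have hz4 : z < 4 * X := lt_of_pow_lt_pow_left₀ 4 (by omega) (hz1.trans_lt h3)
      have h5 : #(Ioc (z - 2 * E) (z - E)) = E := by
        rw [Int.card_Ioc]
        omega
      rw [← h5]
      refine card_le_card fun y hy => ?_
      rw [mem_Ioc] at hy
      rw [mem_filter, mem_Ico]
      refine ⟨⟨by omega, by omega⟩, le_trans ?_ hz1, lt_of_lt_of_le hz2 ?_⟩
      · exact pow_le_pow_left₀ (by omega) (by omega) 4
      · exact pow_le_pow_left₀ (by omega) (by omega) 4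
    exact_mod_cast this
  have hwin : ∀ y ∈ Ico (X : ℤ) (4 * X), 2 * R * (#(Ay y) * ((J : ℝ) ^ r * #s / B) ^ 2)
      ≤ ∑ k ∈ Ico (-R : ℤ) R,
        ‖expSum (Ico y (y + (2 * E : ℕ))) (fun x => x ^ 4) ((k : ℝ) / (2 * R))‖ ^ 2
        * ‖expSum s c ((k : ℝ) / (2 * R))‖ ^ 2
        * (‖linSum J ((k : ℝ) / (2 * R))‖ ^ r * ‖1 - linSum B ((k : ℝ) / (2 * R)) / B‖) ^ 2 := by
    intro y hy
    rw [mem_Ico] at hy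
    have hbig : (y + (2 * E : ℕ)) ^ 4 ≤ (4 * X + 2 * E : ℤ) ^ 4 :=
      pow_le_pow_left₀ (by omega) (by push_cast; omega) 4
    refine window_variance s c y (2 * E) J r B R (by omega) (fun i hi => (hc i hi).1) hB0 ?_ hR0
      (Ay y) ?_ ?_ ?_ hr hJ
    · intro i hi
      have := (hc i hi).2
      linarith
    · intro a ha
      simp only [hAy, mem_filter] at ha
      have h1 : (0 : ℤ) ≤ (y + E) ^ 4 := by positivity
      refine ⟨by omega, ?_⟩
      have h2 : (y + 2 * E) ^ 4 ≤ (4 * X + 2 * E : ℤ) ^ 4 :=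
        pow_le_pow_left₀ (by omega) (by omega) 4
      have h3 : (0 : ℤ) ≤ 4 * E * X ^ 3 := by positivity
      omega
    · intro a ha
      exact hbad a (mem_filter.1 ha).1
    · intro a ha m hm0 hm1 i hi
      simp only [hAy, mem_filter] at ha
      have h1 := hc i hi
      obtain ⟨x, hx⟩ := exists_root_in_window (X := X) (E := E) (B := B) (y := y) (a := a)
        (m := a - c i - m) (by exact_mod_cast hX) (by positivity) hy.1 (by omega) (by linarith)
        ha.2.1 ha.2.2 (hA a ha.1).2 (by exact_mod_cast hB)
      exact ⟨x, by push_cast; exact hx⟩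
  calc 2 * R * (E * #A * ((J : ℝ) ^ r * #s / B) ^ 2)
      ≤ 2 * R * ((∑ y ∈ Ico (X : ℤ) (4 * X), (#(Ay y) : ℝ)) * ((J : ℝ) ^ r * #s / B) ^ 2) := by
        gcongr
    _ = ∑ y ∈ Ico (X : ℤ) (4 * X), 2 * R * (#(Ay y) * ((J : ℝ) ^ r * #s / B) ^ 2) := by
        rw [sum_mul, mul_sum]
    _ ≤ _ := sum_le_sum hwin
    _ = _ := by
        rw [sum_comm]
        refine sum_congr rfl fun k _ => ?_
        rw [sum_mul, sum_mul]

/-- Splitting a weighted moment according to the size of the frequency. -/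
lemma sum_weighted_le (W : ℝ → ℝ) (s : Finset ι) (c : ι → ℤ) (J r B R Q₁ Q₂ Q₃ : ℕ)
    (W₁ W₂ W₃ E₁ E₂ E₃ : ℝ) (hR0 : 0 < R) (hB0 : 0 < B) (hQ₁ : 0 < Q₁) (hQ₂ : 0 < Q₂) (hQ₃ : 0 < Q₃)
    (hc₁ : ∀ i ∈ s, 0 ≤ c i ∧ c i + Q₁ ≤ 2 * R) (hc₂ : ∀ i ∈ s, 0 ≤ c i ∧ c i + Q₂ ≤ 2 * R)
    (hc₃ : ∀ i ∈ s, 0 ≤ c i ∧ c i + Q₃ ≤ 2 * R)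
    (hE₁ : pairCount s c Q₁ ≤ E₁ * Q₁) (hE₂ : pairCount s c Q₂ ≤ E₂ * Q₂)
    (hE₃ : pairCount s c Q₃ ≤ E₃ * Q₃) (h0W₂ : 0 ≤ W₂) (h0W₃ : 0 ≤ W₃)
    (hW0 : ∀ α, 0 ≤ W α) (hW₁ : ∀ α, W α ≤ W₁)
    (hW₂ : ∀ α : ℝ, 1 < 8 * Q₁ * |α| → 8 * Q₂ * |α| ≤ 1 → W α ≤ W₂)
    (hW₃ : ∀ α : ℝ, 1 < 8 * Q₂ * |α| → 8 * Q₃ * |α| ≤ 1 → W α ≤ W₃) :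
    ∑ k ∈ Ico (-R : ℤ) R, W ((k : ℝ) / (2 * R)) * ‖expSum s c ((k : ℝ) / (2 * R))‖ ^ 2
        * (‖linSum J ((k : ℝ) / (2 * R))‖ ^ r * ‖1 - linSum B ((k : ℝ) / (2 * R)) / B‖) ^ 2
      ≤ 2 * R * (4 * W₁ * ((J : ℝ) ^ r * (B / Q₁)) ^ 2 * E₁ + 16 * W₂ * ((J : ℝ) ^ r) ^ 2 * E₂
        + 16 * W₃ * ((J : ℝ) ^ r) ^ 2 * E₃ + 4 * W₁ * ((16 * Q₃ : ℝ) ^ r) ^ 2 * (#s : ℝ) ^ 2) := by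
  have hRr : (0 : ℝ) < R := by exact_mod_cast hR0
  have h0W₁ : 0 ≤ W₁ := (hW0 0).trans (hW₁ 0)
  have henergy : ∀ (Q : ℕ) (E : ℝ), 0 < Q → (∀ i ∈ s, 0 ≤ c i ∧ c i + Q ≤ 2 * R) →
      (pairCount s c Q : ℝ) ≤ E * Q →
      ∑ k ∈ Ico (-R : ℤ) R, (if 4 * (Q : ℤ) * |k| ≤ R
        then ‖expSum s c ((k : ℝ) / (2 * R))‖ ^ 2 else 0) ≤ 8 * R * E := by
    intro Q E hQ hc hE
    have h := sum_norm_sq_expSum_le s c R Q hR0 hQ hc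
    rw [← sum_filter]
    have hQr : (0 : ℝ) < Q := by exact_mod_cast hQ
    refine le_of_mul_le_mul_left (h.trans ?_) hQr
    calc 8 * R * (pairCount s c Q : ℝ) ≤ 8 * R * (E * Q) := by gcongr
      _ = _ := by ring
  have hfreq : ∀ (Q : ℕ) (k : ℤ), 4 * (Q : ℤ) * |k| ≤ R ↔ 8 * Q * |(k : ℝ) / (2 * R)| ≤ 1 := by
    intro Q k
    rw [abs_div, abs_of_pos (by positivity : (0 : ℝ) < 2 * R), mul_div_assoc', div_le_one
      (by positivity)]
    constructor
    · intro h
      have h' : 4 * (Q : ℝ) * |(k : ℝ)| ≤ R := by exact_mod_cast h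
      linarith
    · intro h
      have h' : 4 * (Q : ℝ) * |(k : ℝ)| ≤ R := by linarith
      exact_mod_cast h'
  have hpt : ∀ k ∈ Ico (-R : ℤ) R, W ((k : ℝ) / (2 * R)) * ‖expSum s c ((k : ℝ) / (2 * R))‖ ^ 2
        * (‖linSum J ((k : ℝ) / (2 * R))‖ ^ r * ‖1 - linSum B ((k : ℝ) / (2 * R)) / B‖) ^ 2
      ≤ W₁ * ((J : ℝ) ^ r * (B / Q₁)) ^ 2 * (if 4 * (Q₁ : ℤ) * |k| ≤ R
          then ‖expSum s c ((k : ℝ) / (2 * R))‖ ^ 2 else 0)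
        + W₂ * (2 * (J : ℝ) ^ r) ^ 2 * (if 4 * (Q₂ : ℤ) * |k| ≤ R
          then ‖expSum s c ((k : ℝ) / (2 * R))‖ ^ 2 else 0)
        + W₃ * (2 * (J : ℝ) ^ r) ^ 2 * (if 4 * (Q₃ : ℤ) * |k| ≤ R
          then ‖expSum s c ((k : ℝ) / (2 * R))‖ ^ 2 else 0)
        + W₁ * (2 * (16 * Q₃ : ℝ) ^ r) ^ 2 * (#s : ℝ) ^ 2 := by
    intro k hk
    simp only [hfreq]
    rw [mem_Ico] at hk
    have hk2 : |(k : ℝ) / (2 * R)| ≤ 1 / 2 := by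
      rw [abs_div, abs_of_pos (by positivity : (0 : ℝ) < 2 * R), div_le_div_iff₀ (by positivity)
        (by norm_num)]
      have : |k| ≤ R := abs_le.2 ⟨by omega, by omega⟩
      have : |(k : ℝ)| ≤ R := by exact_mod_cast this
      linarith
    generalize (k : ℝ) / (2 * R) = α at hk2 ⊢
    have hJB : ‖linSum J α‖ ^ r * ‖1 - linSum B α / B‖ ≤ 2 * (J : ℝ) ^ r := by
      calc _ ≤ (J : ℝ) ^ r * 2 := by
            gcongr
            · exact norm_linSum_le J α
            · exact norm_one_sub_linSum_div_le B hB0 α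
        _ = _ := by ring
    have hG : ‖expSum s c α‖ ≤ #s := norm_expSum_le _ _ _
    have hWα := hW0 α
    have n1 : 0 ≤ W₁ * ((J : ℝ) ^ r * (B / Q₁)) ^ 2 * (if 8 * Q₁ * |α| ≤ 1
        then ‖expSum s c α‖ ^ 2 else 0) := by split_ifs <;> positivity
    have n2 : 0 ≤ W₂ * (2 * (J : ℝ) ^ r) ^ 2 * (if 8 * Q₂ * |α| ≤ 1
        then ‖expSum s c α‖ ^ 2 else 0) := by split_ifs <;> positivity
    have n3 : 0 ≤ W₃ * (2 * (J : ℝ) ^ r) ^ 2 * (if 8 * Q₃ * |α| ≤ 1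
        then ‖expSum s c α‖ ^ 2 else 0) := by split_ifs <;> positivity
    have n4 : 0 ≤ W₁ * (2 * (16 * Q₃ : ℝ) ^ r) ^ 2 * (#s : ℝ) ^ 2 := by positivity
    by_cases h1 : 8 * Q₁ * |α| ≤ 1
    · have hq : ‖linSum J α‖ ^ r * ‖1 - linSum B α / B‖ ≤ (J : ℝ) ^ r * (B / Q₁) := by
        have hQr : (0 : ℝ) < Q₁ := by exact_mod_cast hQ₁
        gcongr
        · exact norm_linSum_le J α
        · refine (norm_one_sub_linSum_div_le_mul B hB0 α).trans ?_
          rw [le_div_iff₀ hQr]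
          have hpi := Real.pi_le_four
          calc 2 * Real.pi * B * |α| * Q₁ = Real.pi * (2 * (B * |α| * Q₁)) := by ring
            _ ≤ 4 * (2 * (B * |α| * Q₁)) := by gcongr
            _ = B * (8 * Q₁ * |α|) := by ring
            _ ≤ B * 1 := by gcongr
            _ = B := by ring
      have : W α * ‖expSum s c α‖ ^ 2 * (‖linSum J α‖ ^ r * ‖1 - linSum B α / B‖) ^ 2
          ≤ W₁ * ‖expSum s c α‖ ^ 2 * ((J : ℝ) ^ r * (B / Q₁)) ^ 2 := by
        gcongr
        exact hW₁ α
      rw [if_pos h1] at n1 ⊢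
      linarith
    by_cases h2 : 8 * Q₂ * |α| ≤ 1
    · have : W α * ‖expSum s c α‖ ^ 2 * (‖linSum J α‖ ^ r * ‖1 - linSum B α / B‖) ^ 2
          ≤ W₂ * ‖expSum s c α‖ ^ 2 * (2 * (J : ℝ) ^ r) ^ 2 := by
        gcongr
        exact hW₂ α (not_le.1 h1) h2
      rw [if_pos h2] at n2 ⊢
      linarith
    by_cases h3 : 8 * Q₃ * |α| ≤ 1
    · have : W α * ‖expSum s c α‖ ^ 2 * (‖linSum J α‖ ^ r * ‖1 - linSum B α / B‖) ^ 2
          ≤ W₃ * ‖expSum s c α‖ ^ 2 * (2 * (J : ℝ) ^ r) ^ 2 := by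
        gcongr
        exact hW₃ α (not_le.1 h2) h3
      rw [if_pos h3] at n3 ⊢
      linarith
    · have hα : α ≠ 0 := by
        rintro rfl
        norm_num at h3
      have hα' : 0 < |α| := abs_pos.2 hα
      have hlin : ‖linSum J α‖ ≤ 16 * Q₃ := by
        refine (norm_linSum_le_two_div J hα hk2).trans ?_
        rw [div_le_iff₀ hα']
        linarith
      have hq : ‖linSum J α‖ ^ r * ‖1 - linSum B α / B‖ ≤ 2 * (16 * Q₃ : ℝ) ^ r := by
        calc _ ≤ (16 * Q₃ : ℝ) ^ r * 2 := by
              gcongr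
              exact norm_one_sub_linSum_div_le B hB0 α
          _ = _ := by ring
      have : W α * ‖expSum s c α‖ ^ 2 * (‖linSum J α‖ ^ r * ‖1 - linSum B α / B‖) ^ 2
          ≤ W₁ * (#s : ℝ) ^ 2 * (2 * (16 * Q₃ : ℝ) ^ r) ^ 2 :=
        mul_le_mul (mul_le_mul (hW₁ α) (pow_le_pow_left₀ (norm_nonneg _) hG 2) (sq_nonneg _) h0W₁)
          (pow_le_pow_left₀ (mul_nonneg (pow_nonneg (norm_nonneg _) r) (norm_nonneg _)) hq 2)
          (sq_nonneg _) (mul_nonneg h0W₁ (sq_nonneg _))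
      linarith
  refine (sum_le_sum hpt).trans ?_
  rw [sum_add_distrib, sum_add_distrib, sum_add_distrib, ← mul_sum, ← mul_sum, ← mul_sum, sum_const,
    Int.card_Ico, nsmul_eq_mul]
  have e1 := henergy Q₁ E₁ hQ₁ hc₁ hE₁
  have e2 := henergy Q₂ E₂ hQ₂ hc₂ hE₂
  have e3 := henergy Q₃ E₃ hQ₃ hc₃ hE₃
  have hcardR : (((R : ℤ) - -(R : ℤ)).toNat : ℝ) = 2 * R := by
    have : ((R : ℤ) - -(R : ℤ)).toNat = 2 * R := by omega
    rw [this]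
    push_cast
    ring
  rw [hcardR]
  calc _ ≤ W₁ * ((J : ℝ) ^ r * (B / Q₁)) ^ 2 * (8 * R * E₁) + W₂ * (2 * (J : ℝ) ^ r) ^ 2
        * (8 * R * E₂) + W₃ * (2 * (J : ℝ) ^ r) ^ 2 * (8 * R * E₃)
        + 2 * R * (W₁ * (2 * (16 * Q₃ : ℝ) ^ r) ^ 2 * (#s : ℝ) ^ 2) := by gcongr
    _ = _ := by ring

end

lemma sum_norm_sq_window_trivial (X D : ℕ) (α : ℝ) :
    ∑ y ∈ Ico (X : ℤ) (4 * X), ‖expSum (Ico y (y + D)) (fun x => x ^ 4) α‖ ^ 2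
      ≤ 3 * X * (D : ℝ) ^ 2 := by
  have h : ∀ y ∈ Ico (X : ℤ) (4 * X),
      ‖expSum (Ico y (y + D)) (fun x => x ^ 4) α‖ ^ 2 ≤ (D : ℝ) ^ 2 := by
    intro y _
    gcongr
    exact (norm_expSum_le _ _ _).trans (by simp)
  refine (sum_le_sum h).trans ?_
  rw [sum_const, Int.card_Ico, nsmul_eq_mul]
  have : (4 * (X : ℤ) - X).toNat = 3 * X := by omega
  rw [this]
  push_cast
  exact le_rfl

lemma sum_norm_sq_window_weyl (X D τ : ℕ) (hX : 0 < X) (hD : 0 < D)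
    (hτ : ∀ n ∈ Icc 1 (D * (3 * X) ^ 2), n.divisors.card ^ 2 ≤ τ) (Hm : ℝ)
    (hH : ∑ j ∈ Icc (1 : ℕ) (D * (3 * X) ^ 2), (1 / (j : ℝ)) ≤ Hm) (α : ℝ) (hα : α ≠ 0) (U : ℝ)
    (hU0 : 0 ≤ U)
    (hU : 800 * τ * Hm * D ^ 4 * (3 * X) ^ 3
      * (1 + |α| * (3 * X) + 1 / (|α| * (D * (3 * X) ^ 2))) ≤ U ^ 4) :
    ∑ y ∈ Ico (X : ℤ) (4 * X), ‖expSum (Ico y (y + D)) (fun x => x ^ 4) α‖ ^ 2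
      ≤ D * (3 * X) + 2 * D * U := by
  have h := sum_norm_sq_window_le X (4 * X) D α U ?_
  · have h3 : (4 * (X : ℤ) - X).toNat = 3 * X := by omega
    rw [h3] at h
    push_cast at h
    exact h
  · intro j
    refine le_of_pow_le_pow_left₀ (n := 4) (by norm_num) hU0 (le_trans ?_ hU)
    have hw := weyl_differenced (X + j) (4 * X + j) (3 * X) D τ (by omega) hD (by push_cast; omega)
      hτ Hm hH α hα
    push_cast at hw
    exact hw

lemma weyl_factor_le {X D Q q a : ℝ} (hX : 0 < X) (hD : 0 < D) (ha : 0 < a) (hQ : 0 < Q)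
    (hq : 0 < q) (h1 : 1 ≤ 8 * Q * a) (h2 : 8 * q * a ≤ 1) :
    1 + a * (3 * X) + 1 / (a * (D * (3 * X) ^ 2)) ≤ 1 + X / q + Q / (D * X ^ 2) := by
  have h3 : a * (3 * X) ≤ X / q := by
    rw [le_div_iff₀ hq]
    have : X * (8 * q * a) ≤ X * 1 := by gcongr
    have : 0 ≤ a * X * q := by positivity
    linarith
  have h4 : 1 / (a * (D * (3 * X) ^ 2)) ≤ Q / (D * X ^ 2) := by
    rw [div_le_div_iff₀ (by positivity) (by positivity)]
    have : D * X ^ 2 * 1 ≤ D * X ^ 2 * (8 * Q * a) := by gcongr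
    have : 0 ≤ D * X ^ 2 * (Q * a) := by positivity
    linarith
  linarith

lemma quarticSum_bounds {P Q R : ℕ} (hQ : Q ≤ P) (hR : R ≤ P) : ∀ i ∈ tripleBlock P Q R,
    0 ≤ quarticSum i ∧ quarticSum i ≤ 48 * (P : ℤ) ^ 4 := by
  intro i hi
  simp only [tripleBlock, mem_product, mem_block] at hi
  obtain ⟨⟨h1, h2⟩, ⟨h3, h4⟩, h5, h6⟩ := hi
  unfold quarticSum
  refine ⟨by positivity, ?_⟩
  have e1 : i.1 ^ 4 ≤ (2 * P : ℤ) ^ 4 := pow_le_pow_left₀ (by omega) h2.le 4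
  have e2 : i.2.1 ^ 4 ≤ (2 * P : ℤ) ^ 4 := pow_le_pow_left₀ (by omega) (by omega) 4
  have e3 : i.2.2 ^ 4 ≤ (2 * P : ℤ) ^ 4 := pow_le_pow_left₀ (by omega) (by omega) 4
  have e4 : (2 * P : ℤ) ^ 4 = 16 * P ^ 4 := by ring
  linarith

section

variable {T K d k₂ k₃ k₄ l q u τ M : ℕ}

lemma window_weyl_mid (hT : 10 ^ 13 ≤ T) (Hm : ℝ)
    (hτ : ∀ n ∈ Icc 1 (T ^ M), n.divisors.card ^ 2 ≤ τ)
    (hH : ∑ j ∈ Icc 1 (T ^ M), 1 / (j : ℝ) ≤ Hm) (hHT : 8000 * τ * Hm ≤ T)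
    (hM : d + 2 * K + 1 ≤ M) (hq : d + 2 * K ≤ q) (hu : 2 + 3 * d + K + q ≤ 4 * u) (hKu : K ≤ u)
    (α : ℝ) (h1 : 1 < 8 * (T ^ q : ℕ) * |α|) (h2 : 8 * (T ^ (d + 2 * K) : ℕ) * |α| ≤ 1) :
    ∑ y ∈ Ico ((T ^ K : ℕ) : ℤ) (4 * (T ^ K : ℕ)),
      ‖expSum (Ico y (y + (2 * T ^ d : ℕ))) (fun x => x ^ 4) α‖ ^ 2
      ≤ 10 * (T : ℝ) ^ d * T ^ u := by
  have hT1 : 1 ≤ T := by omega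
  have hTr : (10 ^ 13 : ℝ) ≤ T := by exact_mod_cast hT
  have hTr1 : (1 : ℝ) ≤ T := by linarith
  have hT0 : (0 : ℝ) < T := by linarith
  have hα' : 0 < |α| := by
    rcases eq_or_ne α 0 with rfl | h
    · norm_num at h1
    · exact abs_pos.2 h
  have hr : 2 * T ^ d * (3 * T ^ K) ^ 2 ≤ T ^ M := by
    calc 2 * T ^ d * (3 * T ^ K) ^ 2 = 18 * T ^ (d + 2 * K) := by ring
      _ ≤ T ^ M := const_mul_pow_le (by omega) hM hT1
  push_cast at h1 h2
  have hfac := weyl_factor_le (X := (T : ℝ) ^ K) (D := 2 * (T : ℝ) ^ d) (by positivity)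
    (by positivity) hα' (by positivity) (by positivity) h1.le h2
  have hHm : 0 ≤ Hm := le_trans (sum_nonneg fun _ _ => by positivity) hH
  have h := sum_norm_sq_window_weyl (T ^ K) (2 * T ^ d) τ (by positivity) (by positivity)
    (fun n hn => hτ n (Icc_subset_Icc_right hr hn)) Hm ((sum_inv_Icc_mono hr).trans hH) α
    (abs_pos.1 hα') (T ^ u) (by positivity) ?_
  · push_cast at h ⊢
    refine h.trans ?_
    have : (T : ℝ) ^ K ≤ T ^ u := pow_le_pow_right₀ hTr1 hKu
    calc 2 * (T : ℝ) ^ d * (3 * T ^ K) + 2 * (2 * T ^ d) * T ^ u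
        ≤ 2 * (T : ℝ) ^ d * (3 * T ^ u) + 2 * (2 * T ^ d) * T ^ u := by gcongr
      _ = _ := by ring
  · push_cast
    have e1 : (T : ℝ) ^ K / T ^ (d + 2 * K) ≤ T ^ q / (T ^ d * (T ^ K) ^ 2) := by
      rw [← pow_mul, ← pow_add, mul_comm K]
      gcongr
      omega
    have e2 : (T : ℝ) ^ q / (2 * T ^ d * (T ^ K) ^ 2) ≤ T ^ q / (T ^ d * (T ^ K) ^ 2) := by
      apply div_le_div_of_nonneg_left (by positivity) (by positivity)
      have : (0 : ℝ) ≤ T ^ d * (T ^ K) ^ 2 := by positivity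
      linarith
    have e3 : (1 : ℝ) ≤ T ^ q / (T ^ d * (T ^ K) ^ 2) := by
      rw [one_le_div (by positivity), ← pow_mul, ← pow_add]
      exact pow_le_pow_right₀ hTr1 (by omega)
    calc 800 * τ * Hm * (2 * (T : ℝ) ^ d) ^ 4 * (3 * T ^ K) ^ 3
          * (1 + |α| * (3 * T ^ K) + 1 / (|α| * (2 * T ^ d * (3 * T ^ K) ^ 2)))
        ≤ 800 * τ * Hm * (2 * (T : ℝ) ^ d) ^ 4 * (3 * T ^ K) ^ 3
          * (3 * (T ^ q / (T ^ d * (T ^ K) ^ 2))) := by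
          gcongr
          linarith
      _ = (8000 * τ * Hm) * (129.6 * ((T : ℝ) ^ d) ^ 3 * T ^ K * T ^ q) := by
          field_simp
          ring
      _ ≤ T * (T * ((T : ℝ) ^ d) ^ 3 * T ^ K * T ^ q) := by
          gcongr
          linarith
      _ = (T : ℝ) ^ (2 + 3 * d + K + q) := by ring
      _ ≤ (T : ℝ) ^ (4 * u) := pow_le_pow_right₀ hTr1 hu
      _ = _ := by ring

lemma window_weyl_near (hT : 10 ^ 13 ≤ T) (Hm : ℝ)
    (hτ : ∀ n ∈ Icc 1 (T ^ M), n.divisors.card ^ 2 ≤ τ)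
    (hH : ∑ j ∈ Icc 1 (T ^ M), 1 / (j : ℝ) ≤ Hm) (hHT : 8000 * τ * Hm ≤ T)
    (hM : d + 2 * K + 1 ≤ M) (hlK : l ≤ K) (hdl : 2 + 4 * d ≤ l)
    (α : ℝ) (h1 : 1 < 8 * (T ^ (d + 2 * K) : ℕ) * |α|) (h2 : 8 * (T ^ l : ℕ) * |α| ≤ 1) :
    ∑ y ∈ Ico ((T ^ K : ℕ) : ℤ) (4 * (T ^ K : ℕ)),
      ‖expSum (Ico y (y + (2 * T ^ d : ℕ))) (fun x => x ^ 4) α‖ ^ 2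
      ≤ 10 * (T : ℝ) ^ d * T ^ K := by
  have hT1 : 1 ≤ T := by omega
  have hTr : (10 ^ 13 : ℝ) ≤ T := by exact_mod_cast hT
  have hTr1 : (1 : ℝ) ≤ T := by linarith
  have hT0 : (0 : ℝ) < T := by linarith
  have hα' : 0 < |α| := by
    rcases eq_or_ne α 0 with rfl | h
    · norm_num at h1
    · exact abs_pos.2 h
  have hr : 2 * T ^ d * (3 * T ^ K) ^ 2 ≤ T ^ M := by
    calc 2 * T ^ d * (3 * T ^ K) ^ 2 = 18 * T ^ (d + 2 * K) := by ring
      _ ≤ T ^ M := const_mul_pow_le (by omega) hM hT1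
  push_cast at h1 h2
  have hfac := weyl_factor_le (X := (T : ℝ) ^ K) (D := 2 * (T : ℝ) ^ d) (by positivity)
    (by positivity) hα' (by positivity) (by positivity) h1.le h2
  have hHm : 0 ≤ Hm := le_trans (sum_nonneg fun _ _ => by positivity) hH
  have h := sum_norm_sq_window_weyl (T ^ K) (2 * T ^ d) τ (by positivity) (by positivity)
    (fun n hn => hτ n (Icc_subset_Icc_right hr hn)) Hm ((sum_inv_Icc_mono hr).trans hH) α
    (abs_pos.1 hα') (T ^ K) (by positivity) ?_
  · push_cast at h ⊢
    refine h.trans (le_of_eq ?_)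
    ring
  · push_cast
    have e1 : (T : ℝ) ^ (d + 2 * K) / (2 * T ^ d * (T ^ K) ^ 2) ≤ 1 := by
      rw [div_le_one (by positivity), ← pow_mul, mul_assoc, ← pow_add, mul_comm K]
      have : (0 : ℝ) ≤ T ^ (d + 2 * K) := by positivity
      linarith
    have e3 : (1 : ℝ) ≤ T ^ K / T ^ l := by
      rw [one_le_div (by positivity)]
      exact pow_le_pow_right₀ hTr1 (by omega)
    calc 800 * τ * Hm * (2 * (T : ℝ) ^ d) ^ 4 * (3 * T ^ K) ^ 3
          * (1 + |α| * (3 * T ^ K) + 1 / (|α| * (2 * T ^ d * (3 * T ^ K) ^ 2)))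
        ≤ 800 * τ * Hm * (2 * (T : ℝ) ^ d) ^ 4 * (3 * T ^ K) ^ 3 * (3 * (T ^ K / T ^ l)) := by
          gcongr
          linarith
      _ = (8000 * τ * Hm) * (129.6 * ((T : ℝ) ^ d) ^ 4 * (T ^ K) ^ 4) / T ^ l := by
          field_simp
          ring
      _ ≤ T * (T * ((T : ℝ) ^ d) ^ 4 * (T ^ K) ^ 4) / T ^ l := by
          gcongr
          linarith
      _ ≤ (T ^ K) ^ 4 := by
          rw [div_le_iff₀ (by positivity)]
          calc (T : ℝ) * (T * ((T : ℝ) ^ d) ^ 4 * (T ^ K) ^ 4)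
              = ((T : ℝ) ^ K) ^ 4 * (T : ℝ) ^ (2 + 4 * d) := by ring
            _ ≤ ((T : ℝ) ^ K) ^ 4 * (T : ℝ) ^ l := by gcongr

end

lemma card_mul_le_of_moment_bound {t n : ℝ} {K d s k l q u r : ℕ} (ht : 640 ≤ t)
    (h₁ : 7 + 9 * K + d ≤ 2 * q + 4 * k) (h₂ : 5 + u + 2 * K ≤ 4 * k) (h₃ : 6 + 3 * K ≤ l + s)
    (h₄ : 4 + 3 * K + d ≤ r)
    (h : t ^ d * n * (t ^ s / (t * (t ^ K) ^ 3)) ^ 2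
      ≤ 4 * (12 * t ^ K * (t ^ d) ^ 2) * (t * (t ^ K) ^ 3 / t ^ q) ^ 2
          * (t * (t ^ s) ^ 2 / (t ^ k) ^ 4)
        + 16 * (10 * t ^ d * t ^ u) * (t * (t ^ s) ^ 2 / (t ^ k) ^ 4)
        + 16 * (10 * t ^ d * t ^ K) * (t ^ 2 * t ^ s / t ^ l)
        + 4 * (12 * t ^ K * (t ^ d) ^ 2) * (t ^ s) ^ 2 / t ^ r) :
    n * t ≤ (t ^ K) ^ 4 := by
  have ht1 : 1 ≤ t := by linarith
  have ht0 : 0 < t := by linarith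
  have key : ∀ {C : ℝ} {a b : ℕ}, 0 ≤ C → 4 * C ≤ t → a + 1 ≤ b + 4 * K →
      C * t ^ a / t ^ b ≤ (t ^ K) ^ 4 / 4 := by
    intro C a b hC hCt hab
    rw [div_le_div_iff₀ (by positivity) (by norm_num)]
    calc C * t ^ a * 4 = (4 * C) * t ^ a := by ring
      _ ≤ t * t ^ a := by gcongr
      _ = t ^ (a + 1) := by ring
      _ ≤ t ^ (b + 4 * K) := pow_le_pow_right₀ ht1 hab
      _ = _ := by ring
  have e₁ := key (C := 48) (a := 6 + 13 * K + d) (b := 2 * q + 4 * k) (by norm_num) (by linarith)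
    (by omega)
  have e₂ := key (C := 160) (a := 4 + u + 6 * K) (b := 4 * k) (by norm_num) (by linarith)
    (by omega)
  have e₃ := key (C := 160) (a := 5 + 7 * K) (b := l + s) (by norm_num) (by linarith) (by omega)
  have e₄ := key (C := 48) (a := 3 + 7 * K + d) (b := r) (by norm_num) (by linarith) (by omega)
  have h' := mul_le_mul_of_nonneg_right h
    (by positivity : 0 ≤ t * (t * (t ^ K) ^ 3) ^ 2 / (t ^ d * (t ^ s) ^ 2))
  have f₀ : t ^ d * n * (t ^ s / (t * (t ^ K) ^ 3)) ^ 2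
      * (t * (t * (t ^ K) ^ 3) ^ 2 / (t ^ d * (t ^ s) ^ 2)) = n * t := by
    field_simp
  have f₁ : 4 * (12 * t ^ K * (t ^ d) ^ 2) * (t * (t ^ K) ^ 3 / t ^ q) ^ 2
      * (t * (t ^ s) ^ 2 / (t ^ k) ^ 4) * (t * (t * (t ^ K) ^ 3) ^ 2 / (t ^ d * (t ^ s) ^ 2))
      = 48 * t ^ (6 + 13 * K + d) / t ^ (2 * q + 4 * k) := by
    simp only [pow_add, pow_mul']
    field_simp
    ring
  have f₂ : 16 * (10 * t ^ d * t ^ u) * (t * (t ^ s) ^ 2 / (t ^ k) ^ 4)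
      * (t * (t * (t ^ K) ^ 3) ^ 2 / (t ^ d * (t ^ s) ^ 2))
      = 160 * t ^ (4 + u + 6 * K) / t ^ (4 * k) := by
    simp only [pow_add, pow_mul']
    field_simp
    ring
  have f₃ : 16 * (10 * t ^ d * t ^ K) * (t ^ 2 * t ^ s / t ^ l)
      * (t * (t * (t ^ K) ^ 3) ^ 2 / (t ^ d * (t ^ s) ^ 2))
      = 160 * t ^ (5 + 7 * K) / t ^ (l + s) := by
    simp only [pow_add, pow_mul']
    field_simp
    ring
  have f₄ : 4 * (12 * t ^ K * (t ^ d) ^ 2) * (t ^ s) ^ 2 / t ^ r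
      * (t * (t * (t ^ K) ^ 3) ^ 2 / (t ^ d * (t ^ s) ^ 2))
      = 48 * t ^ (3 + 7 * K + d) / t ^ r := by
    simp only [pow_add, pow_mul']
    field_simp
    ring
  rw [f₀, add_mul, add_mul, add_mul, f₁, f₂, f₃, f₄] at h'
  linarith

lemma card_mul_le_of_tripleBlock {T K d k₂ k₃ k₄ l q u r τ M : ℕ} (hT : 10 ^ 13 ≤ T)
    (hrT : r ≤ T) (hr : 0 < r) (Hm : ℝ)
    (hτ : ∀ n ∈ Icc 1 (T ^ M), n.divisors.card ^ 2 ≤ τ)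
    (hH : ∑ j ∈ Icc 1 (T ^ M), 1 / (j : ℝ) ≤ Hm) (hHT : 8000 * τ * Hm ≤ T)
    (hM : d + 2 * K + 1 ≤ M) (hq : d + 2 * K ≤ q) (hu : 2 + 3 * d + K + q ≤ 4 * u) (hKu : K ≤ u)
    (hlK : l ≤ K) (hdl : 2 + 4 * d ≤ l) (hk : 4 * k₂ + 1 ≤ d + 3 * K) (hlr : l + 2 ≤ d + 3 * K)
    (h32 : k₃ ≤ k₂) (h42 : k₄ ≤ k₂)
    (h₁ : 7 + 9 * K + d ≤ 2 * q + 4 * k₂) (h₂ : 5 + u + 2 * K ≤ 4 * k₂)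
    (h₃ : 6 + 3 * K ≤ l + (k₂ + (k₃ + k₄))) (h₄ : 4 + 3 * K + d ≤ r)
    (hfar : ((T : ℝ) ^ k₂) ^ 4 * pairCount (tripleBlock (T ^ k₂) (T ^ k₃) (T ^ k₄)) quarticSum (T ^ q)
      ≤ T * T ^ q * (#(tripleBlock (T ^ k₂) (T ^ k₃) (T ^ k₄)) : ℝ) ^ 2)
    (hmid : ((T : ℝ) ^ k₂) ^ 4
        * pairCount (tripleBlock (T ^ k₂) (T ^ k₃) (T ^ k₄)) quarticSum (T ^ (d + 2 * K))
      ≤ T * T ^ (d + 2 * K) * (#(tripleBlock (T ^ k₂) (T ^ k₃) (T ^ k₄)) : ℝ) ^ 2)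
    (hfine : (pairCount (tripleBlock (T ^ k₂) (T ^ k₃) (T ^ k₄)) quarticSum (T ^ l) : ℝ)
      ≤ T ^ 2 * #(tripleBlock (T ^ k₂) (T ^ k₃) (T ^ k₄)))
    (A : Finset ℤ)
    (hA : ∀ a ∈ A, ((T ^ K + 2 * T ^ d : ℕ) : ℤ) ^ 4 ≤ a ∧ a < (4 * (T ^ K : ℕ) : ℤ) ^ 4)
    (hbad : ∀ a ∈ A, ∀ x : ℤ, 0 ≤ x → ∀ i ∈ tripleBlock (T ^ k₂) (T ^ k₃) (T ^ k₄),
      x ^ 4 + quarticSum i ≤ a → x ^ 4 + quarticSum i + r * (T ^ (l + 1) : ℕ) ≤ a) :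
    (#A : ℝ) * T ≤ ((T : ℝ) ^ K) ^ 4 := by
  have hT1 : 1 ≤ T := by omega
  have hTr : (10 ^ 13 : ℝ) ≤ T := by exact_mod_cast hT
  have hTr1 : (1 : ℝ) ≤ T := by linarith
  have hT0 : (0 : ℝ) < T := by linarith
  set s := tripleBlock (T ^ k₂) (T ^ k₃) (T ^ k₄) with hs
  have hcard : (#s : ℝ) = (T : ℝ) ^ (k₂ + (k₃ + k₄)) := by
    rw [hs, card_tripleBlock]
    push_cast
    ring
  set R : ℕ := (4 * T ^ K + 2 * T ^ d) ^ 4 + 4 * T ^ d * (T ^ K) ^ 3 + T * (T ^ K) ^ 3 + T ^ q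
    with hR
  have hR0 : 0 < R := by positivity
  have hc48 : 48 * (T ^ k₂) ^ 4 + r * T ^ (l + 1) ≤ 4 * T ^ d * (T ^ K) ^ 3 := by
    have a1 : 48 * T ^ (4 * k₂) ≤ T ^ (d + 3 * K) := const_mul_pow_le (by omega) hk hT1
    have a2 : r * T ^ (l + 1) ≤ T ^ (d + 3 * K) := const_mul_pow_le hrT (by omega) hT1
    have e1 : (T ^ k₂) ^ 4 = T ^ (4 * k₂) := by ring
    have e2 : 4 * T ^ d * (T ^ K) ^ 3 = 4 * T ^ (d + 3 * K) := by ring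
    rw [e1, e2]
    omega
  have hbd := quarticSum_bounds (pow_le_pow_right₀ hT1 h32) (pow_le_pow_right₀ hT1 h42)
  have hcJ : ∀ i ∈ s, 0 ≤ quarticSum i
      ∧ quarticSum i + r * (T ^ (l + 1) : ℕ) ≤ 4 * (T ^ d : ℕ) * (T ^ K : ℕ) ^ 3 := by
    intro i hi
    obtain ⟨b0, b1⟩ := hbd i hi
    have : (48 * (T ^ k₂ : ℕ) ^ 4 + r * (T ^ (l + 1) : ℕ) : ℤ) ≤ 4 * (T ^ d : ℕ) * (T ^ K : ℕ) ^ 3 := by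
      exact_mod_cast hc48
    exact ⟨b0, by linarith⟩
  have hcQ : ∀ b ≤ q, ∀ i ∈ s, 0 ≤ quarticSum i ∧ quarticSum i + (T ^ b : ℕ) ≤ 2 * (R : ℤ) := by
    intro b hb i hi
    obtain ⟨b0, b1⟩ := hcJ i hi
    have a1 : T ^ b ≤ R := (pow_le_pow_right₀ hT1 hb).trans (Nat.le_add_left _ _)
    have a2 : 4 * T ^ d * (T ^ K) ^ 3 ≤ R := by rw [hR]; omega
    zify at a1 a2
    push_cast at b1 a1 a2 ⊢
    have : (0 : ℤ) ≤ r * T ^ (l + 1) := by positivity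
    exact ⟨b0, by linarith⟩
  have hlow := bad_card_le_sum s quarticSum (T ^ K) (T ^ d) (T ^ (l + 1)) r (T * (T ^ K) ^ 3) R
    (one_le_pow₀ hT1) hr (by positivity) (by positivity) hcJ
    (Nat.mul_le_mul_right _ (by omega)) (by omega) A hA hbad
  have hpc : ∀ b : ℕ, ((T : ℝ) ^ k₂) ^ 4 * pairCount s quarticSum (T ^ b)
        ≤ T * T ^ b * (#s : ℝ) ^ 2 →
      (pairCount s quarticSum (T ^ b) : ℝ)
        ≤ T * ((T : ℝ) ^ (k₂ + (k₃ + k₄))) ^ 2 / (T ^ k₂) ^ 4 * (T ^ b : ℕ) := by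
    intro b hb
    rw [hcard] at hb
    rw [div_mul_eq_mul_div, le_div_iff₀ (by positivity)]
    push_cast
    linarith
  have hup := sum_weighted_le
    (fun α => ∑ y ∈ Ico ((T ^ K : ℕ) : ℤ) (4 * (T ^ K : ℕ)),
      ‖expSum (Ico y (y + (2 * T ^ d : ℕ))) (fun x => x ^ 4) α‖ ^ 2)
    s quarticSum (T ^ (l + 1)) r (T * (T ^ K) ^ 3) R (T ^ q) (T ^ (d + 2 * K)) (T ^ l)
    (12 * T ^ K * (T ^ d) ^ 2) (10 * T ^ d * T ^ u) (10 * T ^ d * T ^ K)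
    (T * (T ^ (k₂ + (k₃ + k₄))) ^ 2 / (T ^ k₂) ^ 4)
    (T * (T ^ (k₂ + (k₃ + k₄))) ^ 2 / (T ^ k₂) ^ 4)
    (T ^ 2 * T ^ (k₂ + (k₃ + k₄)) / T ^ l)
    hR0 (by positivity) (by positivity) (by positivity) (by positivity)
    (hcQ _ le_rfl) (hcQ _ hq) (hcQ _ (by omega)) (hpc _ hfar) (hpc _ hmid) ?_
    (by positivity) (by positivity) (fun α => sum_nonneg fun _ _ => by positivity) ?_
    (fun α ha hb => window_weyl_mid hT Hm hτ hH hHT hM hq hu hKu α ha hb)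
    (fun α ha hb => window_weyl_near hT Hm hτ hH hHT hM hlK hdl α ha hb)
  · have h := (mul_le_mul_iff_of_pos_left (by positivity)).1 (hlow.trans hup)
    rw [hcard] at h
    refine card_mul_le_of_moment_bound (by linarith) h₁ h₂ h₃ h₄ ?_
    have hJ : (0 : ℝ) < ((T : ℝ) ^ (l + 1)) ^ r := by positivity
    have h16 : ((16 * (T : ℝ) ^ l) ^ r) ^ 2 * T ^ r ≤ (((T : ℝ) ^ (l + 1)) ^ r) ^ 2 := by
      calc ((16 * (T : ℝ) ^ l) ^ r) ^ 2 * T ^ r = (256 * ((T : ℝ) ^ l) ^ 2 * T) ^ r := by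
            rw [← pow_mul, mul_comm r 2, pow_mul, ← mul_pow]
            ring
        _ ≤ (T * ((T : ℝ) ^ l) ^ 2 * T) ^ r := by
            apply pow_le_pow_left₀ (by positivity)
            gcongr
            linarith
        _ = _ := by
            rw [pow_right_comm _ r 2]
            congr 1
            ring
    have h17 : ((16 * (T : ℝ) ^ l) ^ r) ^ 2 ≤ (((T : ℝ) ^ (l + 1)) ^ r) ^ 2 / T ^ r := by
      rwa [le_div_iff₀ (by positivity)]
    push_cast at h
    generalize (#A : ℝ) = n at h ⊢
    generalize ((16 * (T : ℝ) ^ l) ^ r) ^ 2 = w at h h17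
    generalize ((T : ℝ) ^ (l + 1)) ^ r = j at h h17 hJ
    generalize k₂ + (k₃ + k₄) = v at h ⊢
    have h18 : 4 * (12 * (T : ℝ) ^ K * (T ^ d) ^ 2) * w * (T ^ v) ^ 2
        ≤ 4 * (12 * (T : ℝ) ^ K * (T ^ d) ^ 2) * (j ^ 2 / T ^ r) * (T ^ v) ^ 2 := by gcongr
    refine le_of_mul_le_mul_right (a := j ^ 2) ?_ (by positivity)
    have e : ∀ a b : ℝ, (j * a / b) ^ 2 = (a / b) ^ 2 * j ^ 2 := fun a b => by ring
    rw [e] at h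
    refine le_trans (le_trans (le_of_eq ?_) (h.trans (add_le_add_right h18 _))) (le_of_eq ?_) <;>
      ring
  · rw [hcard] at hfine
    push_cast
    rwa [div_mul_cancel₀ _ (by positivity)]
  · intro α
    have h := sum_norm_sq_window_trivial (T ^ K) (2 * T ^ d) α
    push_cast at h ⊢
    refine h.trans (le_of_eq ?_)
    ring

lemma exists_bad_card_bound : ∃ K d l r M : ℕ, 0 < K ∧ d + 1 ≤ K ∧ r ≤ 10 ^ 13 ∧
    16384 * (l + 2) ≤ 16236 * K ∧ ∀ (T τ : ℕ) (Hm : ℝ), 10 ^ 13 ≤ T →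
      (∀ n ∈ Icc 1 (T ^ M), n.divisors.card ^ 2 ≤ τ) →
      (∑ j ∈ Icc 1 (T ^ M), 1 / (j : ℝ) ≤ Hm) → 8000 * τ * Hm ≤ T → ∀ A : Finset ℤ,
      (∀ a ∈ A, ((T ^ K + 2 * T ^ d : ℕ) : ℤ) ^ 4 ≤ a ∧ a < (4 * (T ^ K : ℕ) : ℤ) ^ 4) →
      (∀ a ∈ A, ∀ x y z w : ℤ, 0 ≤ x → 0 ≤ y → 0 ≤ z → 0 ≤ w →
        x ^ 4 + (y ^ 4 + (z ^ 4 + w ^ 4)) ≤ a →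
        x ^ 4 + (y ^ 4 + (z ^ 4 + w ^ 4)) + r * (T ^ (l + 1) : ℕ) ≤ a) →
      (#A : ℝ) * T ≤ ((T : ℝ) ^ K) ^ 4 := by
  obtain ⟨K, hK⟩ : ∃ n : ℕ, n = 1000000 := ⟨_, rfl⟩
  obtain ⟨d₁, hd₁⟩ : ∃ n : ℕ, n = 247152 := ⟨_, rfl⟩
  obtain ⟨d₂, hd₂⟩ : ∃ n : ℕ, n = 202799 := ⟨_, rfl⟩
  obtain ⟨d₃, hd₃⟩ : ∃ n : ℕ, n = 178347 := ⟨_, rfl⟩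
  obtain ⟨k₂, hk₂⟩ : ∃ n : ℕ, n = 811670 := ⟨_, rfl⟩
  obtain ⟨k₃, hk₃⟩ : ∃ n : ℕ, n = 659334 := ⟨_, rfl⟩
  obtain ⟨k₄, hk₄⟩ : ∃ n : ℕ, n = 538970 := ⟨_, rfl⟩
  obtain ⟨l, hl⟩ : ∃ n : ℕ, n = 990496 := ⟨_, rfl⟩
  obtain ⟨κ, hκ⟩ : ∃ n : ℕ, n = 509979 := ⟨_, rfl⟩
  obtain ⟨g, hg⟩ : ∃ n : ℕ, n = 139378 := ⟨_, rfl⟩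
  obtain ⟨η, hη⟩ : ∃ n : ℕ, n = 149087 := ⟨_, rfl⟩
  obtain ⟨q, hq⟩ : ∃ n : ℕ, n = 3000300 := ⟨_, rfl⟩
  obtain ⟨u, hu⟩ : ∃ n : ℕ, n = 1185440 := ⟨_, rfl⟩
  obtain ⟨r, hr⟩ : ∃ n : ℕ, n = 3247157 := ⟨_, rfl⟩
  refine ⟨K, d₁, l, r, 4 * K, by omega, by omega, by omega, by omega, ?_⟩
  intro T τ Hm hT hτ hH hHT A hA hbad
  have hT1 : 1 ≤ T := by omega
  have hHm : 0 ≤ Hm := le_trans (sum_nonneg fun _ _ => by positivity) hH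
  have hτ1 : 1 ≤ τ := by
    have := hτ 1 (mem_Icc.2 ⟨le_rfl, Nat.one_le_pow _ _ hT1⟩)
    simpa using this
  have hHT8 : 8 * Hm ≤ T := by
    have : (1 : ℝ) ≤ τ := by exact_mod_cast hτ1
    nlinarith
  have mono : ∀ {b : ℕ}, b ≤ 4 * K → T ^ b ≤ T ^ (4 * K) := fun h => Nat.pow_le_pow_right hT1 h
  have hH' : ∀ {b : ℕ}, b ≤ 4 * K → ∑ j ∈ Icc 1 (T ^ b), 1 / (j : ℝ) ≤ Hm :=
    fun h => (sum_inv_Icc_mono (mono h)).trans hH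
  have hpair := pairCount_pair_fine (T := T) (k₃ := k₃) (k₄ := k₄) (l := l) (d := d₃) (κ := κ)
    (η := η) (g := g) hT (by omega) (by omega) (by omega) (by omega) (by omega) (by omega)
    (by omega) (by omega) (by omega) (by omega) (by omega) (by omega) (by omega)
  have hpair' := pairCount_pair_coarse (T := T) (k₃ := k₃) (k₄ := k₄) (d := d₃)
    (j := d₂ + 2 * k₂) (by omega) Hm (hH' (by omega)) hHT8 (by omega) (by omega) (by omega)
    (by omega) (by omega)
  have hfine := pairCount_triple_fine hT Hm hpair hpair'
    (fun n hn => hτ n (Icc_subset_Icc_right (mono (by omega)) hn)) (hH' (by omega)) hHT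
    (by omega) (by omega) (by omega) (by omega) (by omega) (by omega) (by omega)
  have hmid := pairCount_triple_mid (T := T) (k₂ := k₂) (k₃ := k₃) (k₄ := k₄) (d := d₂)
    (q := d₁ + 2 * K) (by omega) Hm (hH' (by omega)) hHT8 (by omega) (by omega) (by omega)
    (by omega) (by omega) (by omega)
  have hfar := pairCount_triple_far (T := T) (k₂ := k₂) (k₃ := k₃) (k₄ := k₄) (q := q)
    (by omega) (by omega)
  refine card_mul_le_of_tripleBlock (r := r) (u := u) hT (by omega) (by omega) Hm hτ hH hHT
    (by omega) (by omega) (by omega) (by omega) (by omega) (by omega) (by omega) (by omega)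
    (by omega) (by omega) (by omega) (by omega) (by omega) (by omega) hfar hmid hfine A hA ?_
  intro a ha x hx i hi
  simp only [tripleBlock, mem_product, mem_block] at hi
  obtain ⟨⟨h1, -⟩, ⟨h2, -⟩, h3, -⟩ := hi
  exact hbad a ha x _ _ _ hx (le_trans (by positivity) h1) (le_trans (by positivity) h2)
    (le_trans (by positivity) h3)

lemma sum_inv_Icc_le_one_add_log (n : ℕ) : ∑ j ∈ Icc 1 n, 1 / (j : ℝ) ≤ 1 + Real.log n := by
  have h := harmonic_le_one_add_log n
  rw [harmonic_eq_sum_Icc] at h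
  push_cast at h
  simpa only [one_div] using h

lemma exists_divisor_harmonic_bound (M : ℕ) (hM : 0 < M) : ∃ T₀ : ℕ, ∀ T : ℕ, T₀ ≤ T →
    ∃ (τ : ℕ) (Hm : ℝ), (∀ n ∈ Icc 1 (T ^ M), n.divisors.card ^ 2 ≤ τ) ∧
      (∑ j ∈ Icc 1 (T ^ M), 1 / (j : ℝ) ≤ Hm) ∧ 8000 * τ * Hm ≤ T := by
  obtain ⟨C, hC0, hC⟩ := exists_card_divisors_pow_le (8 * M)
  have hlog := (Real.isLittleO_pow_log_id_atTop (n := 4)).def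
    (by positivity : (0 : ℝ) < 1 / (8000 ^ 4 * C * (M + 1) ^ 4))
  obtain ⟨x₀, hx₀⟩ := Filter.eventually_atTop.1 hlog
  refine ⟨⌈x₀⌉₊ + 3, fun T hT => ?_⟩
  have hT3 : (3 : ℝ) ≤ T := by exact_mod_cast (by omega : 3 ≤ T)
  have hTx : x₀ ≤ T := (Nat.le_ceil x₀).trans (by exact_mod_cast (by omega : ⌈x₀⌉₊ ≤ T))
  have hl1 : 1 ≤ Real.log T := by
    rw [Real.le_log_iff_exp_le (by linarith)]
    exact Real.exp_one_lt_d9.le.trans (by linarith)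
  have hlogT := hx₀ T hTx
  rw [id, Real.norm_of_nonneg (by positivity), Real.norm_of_nonneg (by positivity),
    div_mul_eq_mul_div, one_mul, le_div_iff₀ (by positivity)] at hlogT
  have hne : (Icc 1 (T ^ M)).Nonempty := ⟨1, mem_Icc.2 ⟨le_rfl, Nat.one_le_pow _ _ (by omega)⟩⟩
  obtain ⟨m, hm, hmax⟩ := exists_max_image (Icc 1 (T ^ M)) (fun n => n.divisors.card ^ 2) hne
  refine ⟨m.divisors.card ^ 2, 1 + Real.log (T ^ M : ℕ), hmax, sum_inv_Icc_le_one_add_log _, ?_⟩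
  set τ := m.divisors.card ^ 2 with hτ
  rw [mem_Icc] at hm
  have hτ4 : τ ^ 4 ≤ C * T := by
    refine le_of_pow_le_pow_left₀ hM.ne' (by positivity) ?_
    calc (τ ^ 4) ^ M = m.divisors.card ^ (8 * M) := by
          rw [hτ, ← pow_mul, ← pow_mul]
          congr 1
          ring
      _ ≤ C * m := hC m (by omega)
      _ ≤ C ^ M * T ^ M := Nat.mul_le_mul (Nat.le_self_pow hM.ne' C) hm.2
      _ = _ := by rw [mul_pow]
  have hτ4' : (τ : ℝ) ^ 4 ≤ C * T := by exact_mod_cast hτ4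
  have hHm : 1 + Real.log (T ^ M : ℕ) ≤ (M + 1) * Real.log T := by
    push_cast
    rw [Real.log_pow]
    linarith
  refine le_of_pow_le_pow_left₀ (n := 4) (by norm_num) (by positivity) ?_
  calc (8000 * (τ : ℝ) * (1 + Real.log (T ^ M : ℕ))) ^ 4
      ≤ (8000 * (τ : ℝ) * ((M + 1) * Real.log T)) ^ 4 := by
        have : 0 ≤ Real.log (T ^ M : ℕ) := Real.log_natCast_nonneg _
        gcongr
    _ = (τ : ℝ) ^ 4 * (8000 ^ 4 * (M + 1) ^ 4 * Real.log T ^ 4) := by ring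
    _ ≤ (C * T) * (8000 ^ 4 * (M + 1) ^ 4 * Real.log T ^ 4) := by gcongr
    _ = T * (Real.log T ^ 4 * (8000 ^ 4 * C * (M + 1) ^ 4)) := by ring
    _ ≤ T * T := by gcongr
    _ = (T : ℝ) ^ 2 := by ring
    _ ≤ (T : ℝ) ^ 4 := pow_le_pow_right₀ (by linarith) (by norm_num)

/-- The interval `(a - a ^ θ, a]` contains no sum of four fourth powers. -/
def MissesQuartics (θ : ℝ) (a : ℕ) : Prop :=
  ∀ n : ℕ, (a : ℝ) - (a : ℝ) ^ θ < (n : ℝ) → n ≤ a → r44 n = 0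

lemma r44_ne_zero (x y z w : ℕ) : r44 (x ^ 4 + (y ^ 4 + (z ^ 4 + w ^ 4))) ≠ 0 := by
  set n := x ^ 4 + (y ^ 4 + (z ^ 4 + w ^ 4)) with hn
  have hfin : Set.Finite {v : Fin 4 → ℕ | ∑ i, (v i) ^ 4 = n} := by
    refine (Set.Finite.pi' fun _ : Fin 4 => Set.finite_Iic n).subset fun v hv i => ?_
    rw [Set.mem_ofPred_eq] at hv
    calc v i ≤ v i ^ 4 := Nat.le_self_pow (by norm_num) _
      _ ≤ ∑ i, v i ^ 4 := single_le_sum (f := fun i => v i ^ 4) (fun _ _ => Nat.zero_le _) (mem_univ i)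
      _ = n := hv
  have : Finite {v : Fin 4 → ℕ // ∑ i, (v i) ^ 4 = n} := hfin
  have : Nonempty {v : Fin 4 → ℕ // ∑ i, (v i) ^ 4 = n} :=
    ⟨![x, y, z, w], by simp [Fin.sum_univ_four, hn, add_assoc]⟩
  exact Nat.card_pos.ne'

lemma succ_pow_le_two_mul_pow {T n : ℕ} (h : 2 * n ≤ T + 1) : (T + 1) ^ n ≤ 2 * T ^ n := by
  have hT : (0 : ℝ) < T + 1 := by positivity
  have hn : (2 * n : ℝ) ≤ T + 1 := by exact_mod_cast h
  have hb := one_add_mul_le_pow (a := -1 / ((T : ℝ) + 1)) (by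
    rw [le_div_iff₀ hT]; linarith [(Nat.cast_nonneg T : (0 : ℝ) ≤ T)]) n
  have e : 1 + -1 / ((T : ℝ) + 1) = T / (T + 1) := by field_simp; ring
  have h2 : (n : ℝ) * (-1 / (T + 1)) ≥ -1 / 2 := by
    rw [ge_iff_le, mul_div_assoc', le_div_iff₀ hT]
    linarith
  rw [e, div_pow] at hb
  have h3 : (1 : ℝ) / 2 ≤ T ^ n / (T + 1) ^ n := by linarith
  rw [div_le_div_iff₀ (by norm_num) (by positivity)] at h3
  have : ((T : ℝ) + 1) ^ n ≤ 2 * T ^ n := by linarith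
  exact_mod_cast this

lemma exists_pow_scale {n T₁ N : ℕ} (hn : 0 < n) (hT : 2 * n ≤ T₁) (hN : 4 * T₁ ^ n ≤ N) :
    ∃ T, T₁ ≤ T ∧ 4 * T ^ n ≤ N ∧ N < 8 * T ^ n := by
  have hT₁ : T₁ ≤ N := (Nat.le_self_pow hn.ne' T₁).trans (by omega)
  set T := Nat.findGreatest (fun t => 4 * t ^ n ≤ N) N with hTdef
  have h1 : T₁ ≤ T := Nat.le_findGreatest hT₁ hN
  have h2 : 4 * T ^ n ≤ N := Nat.findGreatest_spec (P := fun t => 4 * t ^ n ≤ N) hT₁ hN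
  refine ⟨T, h1, h2, ?_⟩
  have h3 : N < 4 * (T + 1) ^ n := by
    by_cases h : T + 1 ≤ N
    · have := Nat.findGreatest_is_greatest (P := fun t => 4 * t ^ n ≤ N) (Nat.lt_add_one T) h
      omega
    · have := Nat.le_self_pow hn.ne' (T + 1)
      omega
  have h4 := succ_pow_le_two_mul_pow (T := T) (n := n) (by omega)
  omega

lemma window_length_le_rpow {T K l r a : ℕ} {ε : ℝ} (hT : 1 ≤ T) (hr : r ≤ T) (hε : 0 ≤ ε)
    (hl : 16384 * (l + 2) ≤ 16236 * K) (ha : (T ^ K) ^ 4 ≤ a) :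
    (r : ℝ) * T ^ (l + 1) ≤ (a : ℝ) ^ ((4059 : ℝ) / 16384 + ε) := by
  have hT1 : (1 : ℝ) ≤ T := by exact_mod_cast hT
  have ha' : ((T : ℝ) ^ K) ^ 4 ≤ a := by exact_mod_cast ha
  have ha1 : (1 : ℝ) ≤ a := le_trans (one_le_pow₀ (one_le_pow₀ hT1)) ha'
  have hl' : ((16384 * (l + 2) : ℕ) : ℝ) ≤ (16236 * K : ℕ) := by exact_mod_cast hl
  push_cast at hl'
  have hrT : (r : ℝ) ≤ T := by exact_mod_cast hr
  calc (r : ℝ) * T ^ (l + 1) ≤ T * T ^ (l + 1) := by gcongr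
    _ = (T : ℝ) ^ ((l + 2 : ℕ) : ℝ) := by rw [Real.rpow_natCast]; ring
    _ ≤ (T : ℝ) ^ (((K * 4 : ℕ) : ℝ) * (4059 / 16384)) := by
        apply Real.rpow_le_rpow_of_exponent_le hT1
        push_cast
        linarith
    _ = (((T : ℝ) ^ K) ^ 4) ^ ((4059 : ℝ) / 16384) := by
        rw [Real.rpow_mul (by positivity), Real.rpow_natCast, pow_mul]
    _ ≤ (a : ℝ) ^ ((4059 : ℝ) / 16384) := by gcongr
    _ ≤ _ := Real.rpow_le_rpow_of_exponent_le ha1 (by linarith)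

lemma pow_add_two_mul_pow_le {T K d : ℕ} (hT : 16 ≤ T) (hd : d + 1 ≤ K) :
    (T ^ K + 2 * T ^ d) ^ 4 ≤ 2 * (T ^ K) ^ 4 := by
  have h : 16 * T ^ d ≤ T ^ K := const_mul_pow_le hT hd (by omega)
  have h8 : 8 * (T ^ K + 2 * T ^ d) ≤ 9 * T ^ K := by omega
  have := Nat.pow_le_pow_left h8 4
  rw [mul_pow, mul_pow] at this
  have : 0 ≤ (T ^ K) ^ 4 := by positivity
  omega

open Classical in
lemma exists_dyadic_bad_card_le (ε : ℝ) (hε : 0 < ε) (δ : ℝ) (hδ : 0 < δ) :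
    ∃ N₁ : ℕ, 0 < N₁ ∧ ∀ N : ℕ, N₁ ≤ N →
      (#{a ∈ Ioc (N / 2) N | MissesQuartics (4059 / 16384 + ε) a} : ℝ) ≤ δ * N := by
  obtain ⟨K, d, l, r, M, hK, hdK, hr, hl, hmain⟩ := exists_bad_card_bound
  obtain ⟨T₀, hT₀⟩ := exists_divisor_harmonic_bound (M + 1) (by omega)
  set T₁ := T₀ + 10 ^ 13 + 2 * (4 * K) + ⌈1 / δ⌉₊ with hT₁
  refine ⟨4 * T₁ ^ (4 * K), by positivity, fun N hN => ?_⟩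
  obtain ⟨T, hT, hT4, hT8⟩ := exists_pow_scale (n := 4 * K) (by omega) (by omega) hN
  obtain ⟨τ, Hm, hτ, hH, hHT⟩ := hT₀ T (by omega)
  have hM : T ^ M ≤ T ^ (M + 1) := Nat.pow_le_pow_right (by omega) (by omega)
  have hX : (T ^ K) ^ 4 = T ^ (4 * K) := by ring
  have h2 := pow_add_two_mul_pow_le (T := T) (by omega) hdK
  set S : Finset ℕ := {a ∈ Ioc (N / 2) N | MissesQuartics (4059 / 16384 + ε) a} with hS
  have hSb : ∀ a ∈ S, 2 * (T ^ K) ^ 4 ≤ a ∧ a < (4 * T ^ K) ^ 4 := by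
    intro a ha
    rw [hS, mem_filter, mem_Ioc] at ha
    rw [mul_pow]
    omega
  have h := hmain T τ Hm (by omega) (fun n hn => hτ n (Icc_subset_Icc_right hM hn))
    ((sum_inv_Icc_mono hM).trans hH) hHT (S.map Nat.castEmbedding) ?_ ?_
  · rw [card_map] at h
    have hTδ : 1 / δ ≤ T := (Nat.le_ceil _).trans (by exact_mod_cast (by omega : ⌈1 / δ⌉₊ ≤ T))
    have hXN : ((T : ℝ) ^ K) ^ 4 ≤ N := by exact_mod_cast (by omega : (T ^ K) ^ 4 ≤ N)
    rw [div_le_iff₀ hδ] at hTδ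
    have hS0 : (0 : ℝ) ≤ #S := by positivity
    nlinarith
  · intro a ha
    obtain ⟨b, hb, rfl⟩ := mem_map.1 ha
    obtain ⟨h3, h4⟩ := hSb b hb
    simp only [Nat.castEmbedding_apply]
    exact ⟨by exact_mod_cast h2.trans h3, by exact_mod_cast h4⟩
  · intro a ha x y z w hx hy hz hw hle
    obtain ⟨b, hb, rfl⟩ := mem_map.1 ha
    obtain ⟨h3, -⟩ := hSb b hb
    lift x to ℕ using hx
    lift y to ℕ using hy
    lift z to ℕ using hz
    lift w to ℕ using hw
    simp only [Nat.castEmbedding_apply] at hle ⊢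
    by_contra! hlt
    have hle' : x ^ 4 + (y ^ 4 + (z ^ 4 + w ^ 4)) ≤ b := by exact_mod_cast hle
    have hlt' : b < x ^ 4 + (y ^ 4 + (z ^ 4 + w ^ 4)) + r * T ^ (l + 1) := by exact_mod_cast hlt
    have hlen := window_length_le_rpow (T := T) (K := K) (l := l) (r := r) (a := b) (by omega)
      (by omega) hε.le hl (by omega)
    refine r44_ne_zero x y z w ((mem_filter.1 hb).2 _ ?_ hle')
    have hltr : (b : ℝ) < (x ^ 4 + (y ^ 4 + (z ^ 4 + w ^ 4)) : ℕ) + r * T ^ (l + 1) := by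
      exact_mod_cast hlt'
    linarith

lemma card_filter_Icc_le_of_dyadic {p : ℕ → Prop} [DecidablePred p] {δ : ℝ} {N₁ : ℕ} (hδ : 0 ≤ δ)
    (hN₁ : 0 < N₁) (h : ∀ N : ℕ, N₁ ≤ N → (#{a ∈ Ioc (N / 2) N | p a} : ℝ) ≤ δ * N) (N : ℕ) :
    (#{a ∈ Icc 1 N | p a} : ℝ) ≤ N₁ + 2 * δ * N := by
  induction N using Nat.strong_induction_on with
  | _ N ih =>
    by_cases hN : N₁ ≤ N
    · have h1 := ih (N / 2) (by omega)
      have h2 := h N hN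
      have h3 : #{a ∈ Icc 1 N | p a} ≤ #{a ∈ Icc 1 (N / 2) | p a} + #{a ∈ Ioc (N / 2) N | p a} := by
        refine (card_le_card ?_).trans (card_union_le _ _)
        intro a
        simp only [mem_union, mem_filter, mem_Icc, mem_Ioc]
        intro ha
        rcases le_or_gt a (N / 2) with h4 | h4
        · exact Or.inl ⟨⟨ha.1.1, h4⟩, ha.2⟩
        · exact Or.inr ⟨⟨h4, ha.1.2⟩, ha.2⟩
      have h3' : (#{a ∈ Icc 1 N | p a} : ℝ)
          ≤ #{a ∈ Icc 1 (N / 2) | p a} + #{a ∈ Ioc (N / 2) N | p a} := by exact_mod_cast h3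
      have h5 : ((N / 2 : ℕ) : ℝ) ≤ N / 2 := Nat.cast_div_le
      have h6 : 2 * δ * ((N / 2 : ℕ) : ℝ) ≤ 2 * δ * (N / 2) := by gcongr
      linarith
    · have h1 : #{a ∈ Icc 1 N | p a} ≤ N₁ := by
        refine (card_filter_le _ _).trans ?_
        rw [Nat.card_Icc]
        omega
      have h2 : (#{a ∈ Icc 1 N | p a} : ℝ) ≤ N₁ := by exact_mod_cast h1
      have : 0 ≤ 2 * δ * (N : ℝ) := by positivity
      linarith

/-- For almost every `a ∈ ℕ` the interval `(a − a^{4059/16384+ε}, a]` contains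
a sum of four nonnegative fourth powers: the exceptional set up to `N` has
cardinality at most `δ N`. -/
theorem almost_all_intervals_contain_sum_four_fourth_powers
    (ε : ℝ) (hε : 0 < ε) (δ : ℝ) (hδ0 : 0 < δ) (hδ1 : δ < 1) :
    ∃ N₀ : ℕ, ∀ N : ℕ, N₀ ≤ N →
      (Nat.card {a : ℕ | 1 ≤ a ∧ a ≤ N ∧
        ∀ n : ℕ, (a : ℝ) - (a : ℝ) ^ ((4059 : ℝ) / 16384 + ε) < (n : ℝ) →
          n ≤ a → r44 n = 0} : ℝ) ≤ δ * (N : ℝ) := by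
  classical
  obtain ⟨N₁, hN₁, h⟩ := exists_dyadic_bad_card_le ε hε (δ / 4) (by positivity)
  refine ⟨⌈2 * N₁ / δ⌉₊, fun N hN => ?_⟩
  have hb := card_filter_Icc_le_of_dyadic (by positivity) hN₁ h N
  have hN' : 2 * N₁ / δ ≤ (N : ℝ) := (Nat.le_ceil _).trans (by exact_mod_cast hN)
  rw [div_le_iff₀ hδ0] at hN'
  rw [Nat.subtype_card {a ∈ Icc 1 N | MissesQuartics (4059 / 16384 + ε) a}
    (fun a => by rw [mem_filter, mem_Icc, and_assoc, Set.mem_ofPred_eq, MissesQuartics])]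
  linarith
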